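/- Lyapunov exponent of the Szegő cocycle, nonsingular case: Let t ∈ (−1,1) with t ≠ 0, λ₁ ∈ (0,1), λ₂ ∈ (0, (1−t²)/(1+t²)), Φ irrational, θ ∈ ℝ, and let z belong to the spectrum Σ of W = W_{λ₁,λ₂,Φ,θ}. Then the Lyapunov exponent L(Φ, S_z⁺) exists and: (i) if λ₁ ≤ (1−t²)/(1+t²), then L(Φ, S_z⁺) = max{F(λ₁,λ₂), 0}, where F(λ₁,λ₂) = ln[ λ₂((1−t²)λ₁′ + √((1+t²)²λ₁′² − 4t²)) / (λ₁((1−t²)λ₂′ + √((1+t²)²λ₂′² − 4t²))) ]; (ii) if λ₁ ≥ (1−t²)/(1+t²), then L(Φ, S_z⁺) = 0. -/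

import Mathlib

open MeasureTheory

noncomputable section

/-- `λ' = √(1 - λ²)`. -/
def sq1 (l : ℝ) : ℝ := Real.sqrt (1 - l ^ 2)

/-- The sampling function `f(x) = (1/k)(2 t λ₂ cos(2πx) + (t²−1) λ₂′)` with `k = −(1+t²)`. -/
def fS (t l x : ℝ) : ℝ :=
  (1 / (-(1 + t ^ 2))) * (2 * t * l * Real.cos (2 * Real.pi * x) + (t ^ 2 - 1) * sq1 l)

/-- The sampling function `g(x) = (1/k)(−t² λ₂ e^{2πix} + λ₂ e^{−2πix} + 2 t λ₂′)`. -/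
def gS (t l x : ℝ) : ℂ :=
  ((1 / (-(1 + t ^ 2)) : ℝ) : ℂ) *
    (-(((t ^ 2 * l : ℝ)) : ℂ) * Complex.exp (2 * Real.pi * x * Complex.I)
      + ((l : ℝ) : ℂ) * Complex.exp (-(2 * Real.pi * x) * Complex.I)
      + ((2 * t * sq1 l : ℝ) : ℂ))

/-- The Hilbert space `ℓ²(ℤ; ℂ²)`. -/
abbrev H2 := lp (fun _ : ℤ => EuclideanSpace ℂ (Fin 2)) 2

/-- The `+` component of `W ψ = S_{λ₁} Q ψ` at site `n`. -/
def wPlus (t l1 l2 Φ θ : ℝ) (ψ : ℤ → EuclideanSpace ℂ (Fin 2)) (n : ℤ) : ℂ :=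
  (l1 : ℂ) * ((fS t l2 (θ + ((n : ℝ) - 1) * Φ) : ℂ) * ψ (n - 1) 0
      - gS t l2 (θ + ((n : ℝ) - 1) * Φ) * ψ (n - 1) 1)
    - (sq1 l1 : ℂ) * ((starRingEnd ℂ) (gS t l2 (θ + (n : ℝ) * Φ)) * ψ n 0
      + (fS t l2 (θ + (n : ℝ) * Φ) : ℂ) * ψ n 1)

/-- The `−` component of `W ψ = S_{λ₁} Q ψ` at site `n`. -/
def wMinus (t l1 l2 Φ θ : ℝ) (ψ : ℤ → EuclideanSpace ℂ (Fin 2)) (n : ℤ) : ℂ :=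
  (l1 : ℂ) * ((starRingEnd ℂ) (gS t l2 (θ + ((n : ℝ) + 1) * Φ)) * ψ (n + 1) 0
      + (fS t l2 (θ + ((n : ℝ) + 1) * Φ) : ℂ) * ψ (n + 1) 1)
    + (sq1 l1 : ℂ) * ((fS t l2 (θ + (n : ℝ) * Φ) : ℂ) * ψ n 0
      - gS t l2 (θ + (n : ℝ) * Φ) * ψ n 1)

/-- `ψ` is a (generalized) eigenvector of `W_{λ₁,λ₂,Φ,θ}` with eigenvalue `z`. -/
def IsEigen (t l1 l2 Φ θ : ℝ) (z : ℂ) (ψ : ℤ → EuclideanSpace ℂ (Fin 2)) : Prop :=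
  ∀ n : ℤ, wPlus t l1 l2 Φ θ ψ n = z * ψ n 0 ∧ wMinus t l1 l2 Φ θ ψ n = z * ψ n 1


/-- `p(w) = (1/k)(t²λ₂e^{2πiw} − λ₂e^{−2πiw} − 2tλ₂′)`. -/
def pS (t l2 : ℝ) (w : ℂ) : ℂ :=
  (1 / (-(1 + (t : ℂ) ^ 2))) *
    ((t : ℂ) ^ 2 * (l2 : ℂ) * Complex.exp (2 * Real.pi * Complex.I * w)
      - (l2 : ℂ) * Complex.exp (-(2 * Real.pi * Complex.I * w))
      - 2 * (t : ℂ) * (sq1 l2 : ℂ))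

/-- `q(w) = (1/k)(t²λ₂e^{−2πiw} − λ₂e^{2πiw} − 2tλ₂′)`. -/
def qS (t l2 : ℝ) (w : ℂ) : ℂ :=
  (1 / (-(1 + (t : ℂ) ^ 2))) *
    ((t : ℂ) ^ 2 * (l2 : ℂ) * Complex.exp (-(2 * Real.pi * Complex.I * w))
      - (l2 : ℂ) * Complex.exp (2 * Real.pi * Complex.I * w)
      - 2 * (t : ℂ) * (sq1 l2 : ℂ))

/-- The matrix `D_z(w)`. -/
def Dz (t l1 l2 : ℝ) (z w : ℂ) : Matrix (Fin 2) (Fin 2) ℂ :=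
  !![z ^ 2 - (sq1 l1 : ℂ) * z * pS t l2 w, qS t l2 w * z - (sq1 l1 : ℂ);
     -(sq1 l1 : ℂ) * z ^ 2 + pS t l2 w * z, -(sq1 l1 : ℂ) * z * qS t l2 w + 1]

/-- The two-step Szegő cocycle map `S_z⁺(x) = (z⁻¹/(λ₁|f(x)|)) D_z(x)`. -/
def SzP (t l1 l2 : ℝ) (z : ℂ) (x : ℝ) : Matrix (Fin 2) (Fin 2) ℂ :=
  (z⁻¹ / ((l1 : ℂ) * ((|fS t l2 x| : ℝ) : ℂ))) • Dz t l1 l2 z (x : ℂ)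

/-- `n`-step cocycle product `Mⁿ(x) = M(x+(n−1)Φ) ⋯ M(x+Φ) M(x)`. -/
def coc (Φ : ℝ) (M : ℝ → Matrix (Fin 2) (Fin 2) ℂ) : ℕ → ℝ → Matrix (Fin 2) (Fin 2) ℂ
  | 0, _ => 1
  | n + 1, x => M (x + (n : ℝ) * Φ) * coc Φ M n x

attribute [local instance] Matrix.frobeniusNormedAddCommGroup

/-- The Lyapunov exponent of the cocycle `(Φ, M)` exists and equals `c`. -/
def HasLyap (Φ : ℝ) (M : ℝ → Matrix (Fin 2) (Fin 2) ℂ) (c : ℝ) : Prop :=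
  Filter.Tendsto
    (fun n : ℕ => (1 / (n : ℝ)) * ∫ x in (0:ℝ)..1, Real.log ‖coc Φ M n x‖)
    Filter.atTop (nhds c)

attribute [local instance] Matrix.frobeniusNormedSpace

/-- Complex `2 × 2` matrices. -/
abbrev Mat2 := Matrix (Fin 2) (Fin 2) ℂ

/-- Complex column vectors of length two, carrying the Euclidean (Frobenius) norm. -/
abbrev Col2 := Matrix (Fin 2) (Fin 1) ℂ

lemma mat2_norm_sq (A : Mat2) :
    ‖A‖ ^ 2 = ‖A 0 0‖ ^ 2 + ‖A 0 1‖ ^ 2 + ‖A 1 0‖ ^ 2 + ‖A 1 1‖ ^ 2 := by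
  rw [Matrix.frobenius_norm_def, ← Real.sqrt_eq_rpow, Real.sq_sqrt (by positivity)]
  simp [Fin.sum_univ_two]; ring

lemma col2_norm_sq (v : Col2) : ‖v‖ ^ 2 = ‖v 0 0‖ ^ 2 + ‖v 1 0‖ ^ 2 := by
  rw [Matrix.frobenius_norm_def, ← Real.sqrt_eq_rpow, Real.sq_sqrt (by positivity)]
  simp [Fin.sum_univ_two]

lemma mat2_norm_mul_le (A B : Mat2) : ‖A * B‖ ≤ ‖A‖ * ‖B‖ := Matrix.frobenius_norm_mul A B

lemma mat2_norm_mulCol_le (A : Mat2) (v : Col2) : ‖A * v‖ ≤ ‖A‖ * ‖v‖ :=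
  Matrix.frobenius_norm_mul A v

lemma mat2_norm_smul (c : ℂ) (A : Mat2) : ‖c • A‖ = ‖c‖ * ‖A‖ := by
  rw [← sq_eq_sq₀ (norm_nonneg _) (by positivity), mul_pow, mat2_norm_sq, mat2_norm_sq]
  simp [mul_pow]; ring

lemma col2_norm_smul (c : ℂ) (v : Col2) : ‖c • v‖ = ‖c‖ * ‖v‖ := by
  rw [← sq_eq_sq₀ (norm_nonneg _) (by positivity), mul_pow, col2_norm_sq, col2_norm_sq]
  simp [mul_pow]; ring

lemma mat2_entry_le (A : Mat2) (i j : Fin 2) : ‖A i j‖ ≤ ‖A‖ := by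
  rw [← sq_le_sq₀ (norm_nonneg _) (norm_nonneg _), mat2_norm_sq]
  fin_cases i <;> fin_cases j <;> simp <;>
    linarith [sq_nonneg ‖A 0 0‖, sq_nonneg ‖A 0 1‖, sq_nonneg ‖A 1 0‖, sq_nonneg ‖A 1 1‖]

lemma mat2_exists_entry (A : Mat2) : ∃ i j, ‖A‖ ≤ 2 * ‖A i j‖ := by
  by_contra! h
  have h00 := h 0 0
  have h01 := h 0 1
  have h10 := h 1 0
  have h11 := h 1 1
  have e := mat2_norm_sq A
  have k00 := norm_nonneg (A 0 0)
  have k01 := norm_nonneg (A 0 1)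
  have k10 := norm_nonneg (A 1 0)
  have k11 := norm_nonneg (A 1 1)
  nlinarith [mul_self_lt_mul_self (mul_nonneg zero_le_two k00) h00,
    mul_self_lt_mul_self (mul_nonneg zero_le_two k01) h01,
    mul_self_lt_mul_self (mul_nonneg zero_le_two k10) h10,
    mul_self_lt_mul_self (mul_nonneg zero_le_two k11) h11]

lemma mat2_norm_one_le : ‖(1 : Mat2)‖ ≤ 2 := by
  rw [← sq_le_sq₀ (norm_nonneg _) (by norm_num), mat2_norm_sq]
  simp; norm_num

lemma mat2_norm_adjugate (A : Mat2) : ‖A.adjugate‖ = ‖A‖ := by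
  rw [← sq_eq_sq₀ (norm_nonneg _) (norm_nonneg _), mat2_norm_sq, mat2_norm_sq,
    Matrix.adjugate_fin_two]
  simp; ring

lemma mat2_det_le (A : Mat2) : 2 * ‖A.det‖ ≤ ‖A‖ ^ 2 := by
  rw [Matrix.det_fin_two, mat2_norm_sq]
  have := norm_sub_le (A 0 0 * A 1 1) (A 0 1 * A 1 0)
  rw [norm_mul, norm_mul] at this
  nlinarith [sq_nonneg (‖A 0 0‖ - ‖A 1 1‖), sq_nonneg (‖A 0 1‖ - ‖A 1 0‖)]

lemma mat2_trace_le (A : Mat2) : ‖A.trace‖ ≤ 2 * ‖A‖ := by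
  rw [Matrix.trace_fin_two]
  linarith [norm_add_le (A 0 0) (A 1 1), mat2_entry_le A 0 0, mat2_entry_le A 1 1]

/-- If a matrix product `P * N` is large while its factors are moderate, then a vector in the
range of `N` must be moved substantially by `P` or by the inverse of `N`. -/
lemma mat2_key_ineq (P N : Mat2) (u : Col2) :
    ‖N * u‖ * ‖P * N‖ ≤ ‖P * (N * u)‖ * ‖N‖ + ‖P‖ * ‖N.det‖ * ‖u‖ := by
  by_cases hv : N * u = 0
  · rw [hv]; simp; positivity
  set v := N * u with hvdef
  have hpos : 0 < ‖v‖ := norm_pos_iff.2 hv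
  let w : Col2 := !![-(starRingEnd ℂ) (v 1 0); (starRingEnd ℂ) (v 0 0)]
  let w' : Matrix (Fin 1) (Fin 2) ℂ := !![-u 1 0, u 0 0]
  have hw : ‖w‖ = ‖v‖ := by
    rw [← sq_eq_sq₀ (norm_nonneg _) (norm_nonneg _), col2_norm_sq, col2_norm_sq]
    simp [w]; ring
  have hw' : ‖w'‖ = ‖u‖ := by
    rw [← sq_eq_sq₀ (norm_nonneg _) (norm_nonneg _), col2_norm_sq,
      Matrix.frobenius_norm_def, ← Real.sqrt_eq_rpow, Real.sq_sqrt (by positivity)]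
    simp [w']; ring
  have hvv : ((‖v‖ ^ 2 : ℝ) : ℂ) = v 0 0 * (starRingEnd ℂ) (v 0 0)
      + v 1 0 * (starRingEnd ℂ) (v 1 0) := by
    rw [col2_norm_sq, Complex.mul_conj, Complex.mul_conj, Complex.normSq_eq_norm_sq,
      Complex.normSq_eq_norm_sq]
    push_cast; ring
  have v0 : v 0 0 = N 0 0 * u 0 0 + N 0 1 * u 1 0 := by
    simp [hvdef, Matrix.mul_apply, Fin.sum_univ_two]
  have v1 : v 1 0 = N 1 0 * u 0 0 + N 1 1 * u 1 0 := by
    simp [hvdef, Matrix.mul_apply, Fin.sum_univ_two]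
  have key : ((‖v‖ ^ 2 : ℝ) : ℂ) • (P * N)
      = (P * v) * (v.conjTranspose * N) + (N.det • (P * w)) * w' := by
    have h : ((‖v‖ ^ 2 : ℝ) : ℂ) • N = v * (v.conjTranspose * N) + (N.det • w) * w' := by
      rw [hvv]
      ext i j
      fin_cases i <;> fin_cases j <;>
        simp [Matrix.mul_apply, Fin.sum_univ_two, w, w', Matrix.det_fin_two,
          Matrix.conjTranspose_apply] <;> rw [v0, v1] <;> simp <;> ring
    rw [← Matrix.mul_smul, h, Matrix.mul_add, Matrix.mul_assoc P v,
      ← Matrix.mul_assoc P (N.det • w), Matrix.mul_smul]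
  have hn := congrArg norm key
  rw [mat2_norm_smul, Complex.norm_real, Real.norm_of_nonneg (by positivity)] at hn
  have h1 : ‖(P * v) * (v.conjTranspose * N)‖ ≤ ‖P * v‖ * (‖v‖ * ‖N‖) := by
    refine (Matrix.frobenius_norm_mul _ _).trans ?_
    refine mul_le_mul_of_nonneg_left ((Matrix.frobenius_norm_mul _ _).trans ?_) (norm_nonneg _)
    rw [Matrix.frobenius_norm_conjTranspose]
  have h2 : ‖(N.det • (P * w)) * w'‖ ≤ ‖N.det‖ * (‖P‖ * ‖v‖) * ‖u‖ := by
    refine (Matrix.frobenius_norm_mul _ _).trans ?_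
    rw [hw', col2_norm_smul]
    gcongr
    exact hw ▸ mat2_norm_mulCol_le P w
  have h3 := norm_add_le ((P * v) * (v.conjTranspose * N)) ((N.det • (P * w)) * w')
  rw [← hn] at h3
  have h4 : ‖v‖ * (‖v‖ * ‖P * N‖) ≤ ‖v‖ * (‖P * v‖ * ‖N‖ + ‖P‖ * ‖N.det‖ * ‖u‖) := by
    nlinarith
  exact le_of_mul_le_mul_left h4 hpos

/-- Iterated Schwarz lemma: an entire function with `J` zeros near the centre of a disc is
small at the centre. -/
lemma norm_center_le_of_zeros (J : ℕ) : ∀ (g : ℂ → ℂ) (M : ℝ) (w₀ : ℂ) (R : ℝ) (y : ℕ → ℂ),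
    Differentiable ℂ g → 0 < R → (∀ w, ‖w - w₀‖ ≤ R → ‖g w‖ ≤ M) →
    (∀ i < J, ‖y i - w₀‖ ≤ R / 4) → (∀ i < J, ∀ k < J, i ≠ k → y i ≠ y k) →
    (∀ i < J, g (y i) = 0) → ‖g w₀‖ ≤ M * (1 / 3) ^ J := by
  induction J with
  | zero =>
    intro g M w₀ R y _ hR hM _ _ _
    simpa using hM w₀ (by simpa using hR.le)
  | succ J ih =>
    intro g M w₀ R y hg hR hM hy hne h0
    have hyJ := hy J J.lt_succ_self
    set h := dslope g (y J) with hh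
    have hfac : ∀ w, g w = (w - y J) * h w := by
      intro w
      have := sub_smul_dslope g (y J) w
      rw [h0 J J.lt_succ_self, sub_zero, smul_eq_mul] at this
      exact this.symm
    have hdiff : Differentiable ℂ h := by
      rw [← differentiableOn_univ]
      exact (Complex.differentiableOn_dslope Filter.univ_mem).2 hg.differentiableOn
    have hM0 : 0 ≤ M := (norm_nonneg _).trans (hM w₀ (by simpa using hR.le))
    have hbd : ∀ w, ‖w - w₀‖ ≤ R → ‖h w‖ ≤ 4 * M / (3 * R) := by
      intro w hw
      refine Complex.norm_le_of_forall_mem_frontier_norm_le (U := Metric.ball w₀ R)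
        Metric.isBounded_ball hdiff.diffContOnCl ?_ ?_
      · intro x hx
        rw [frontier_ball w₀ hR.ne', mem_sphere_iff_norm] at hx
        have h1 := hM x hx.le
        rw [hfac x, norm_mul] at h1
        have h2 : 3 * R / 4 ≤ ‖x - y J‖ := by
          have := norm_sub_le_norm_sub_add_norm_sub x (y J) w₀
          linarith
        rw [le_div_iff₀ (by positivity)]
        nlinarith [mul_le_mul_of_nonneg_right h2 (norm_nonneg (h x))]
      · rw [closure_ball w₀ hR.ne', mem_closedBall_iff_norm]
        exact hw
    have key := ih h (4 * M / (3 * R)) w₀ R y hdiff hR hbd (fun i hi => hy i (by omega))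
      (fun i hi k hk => hne i (by omega) k (by omega)) (by
        intro i hi
        have h1 := h0 i (by omega)
        rw [hfac, mul_eq_zero, sub_eq_zero] at h1
        exact h1.resolve_left (hne i (by omega) J J.lt_succ_self (by omega)))
    rw [hfac w₀, norm_mul, norm_sub_rev]
    calc ‖y J - w₀‖ * ‖h w₀‖ ≤ R / 4 * (4 * M / (3 * R) * (1 / 3) ^ J) :=
          mul_le_mul hyJ key (norm_nonneg _) (by positivity)
      _ = M * (1 / 3) ^ (J + 1) := by rw [pow_succ]; field_simp

lemma prod_erase_dist (J i : ℕ) (hi : i < J) :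
    ∏ k ∈ (Finset.range J).erase i, |(i : ℝ) - k|
      = (i.factorial : ℝ) * ((J - 1 - i).factorial : ℝ) := by
  have hs : (Finset.range J).erase i = Finset.range i ∪ Finset.Ico (i + 1) J := by
    ext k; simp; omega
  have hd : Disjoint (Finset.range i) (Finset.Ico (i + 1) J) := by
    rw [Finset.disjoint_left]; intro k; simp; omega
  rw [hs, Finset.prod_union hd]
  congr 1
  · rw [← Finset.prod_range_reflect, ← Finset.prod_range_add_one_eq_factorial, Nat.cast_prod]
    refine Finset.prod_congr rfl fun k hk => ?_
    have hk := Finset.mem_range.1 hk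
    rw [Nat.sub_sub, Nat.cast_sub (by omega)]
    push_cast
    rw [abs_of_nonneg] <;> [ring; linarith [Nat.cast_nonneg (α := ℝ) k]]
  · rw [Finset.prod_Ico_eq_prod_range, ← Finset.prod_range_add_one_eq_factorial, Nat.cast_prod,
      show J - (i + 1) = J - 1 - i by omega]
    refine Finset.prod_congr rfl fun k _ => ?_
    push_cast
    rw [abs_of_nonpos] <;> [ring; linarith [Nat.cast_nonneg (α := ℝ) k]]

/-- An entire function that is small at many well separated points near the centre of a disc
is small at the centre. -/
lemma norm_center_le_of_small (F : ℂ → ℂ) (hF : Differentiable ℂ F) (w₀ : ℂ) (M m R : ℝ)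
    (hR : 0 < R) (hR1 : R ≤ 1) (hm0 : 0 ≤ m) (hM : ∀ w, ‖w - w₀‖ ≤ R → ‖F w‖ ≤ M)
    (J q : ℕ) (hJ : 0 < J) (hq : 0 < q) (y : ℕ → ℂ) (hy : ∀ i < J, ‖y i - w₀‖ ≤ R / 4)
    (hsep : ∀ i < J, ∀ k < J, |(i : ℝ) - k| / q ≤ ‖y i - y k‖)
    (hm : ∀ i < J, ‖F (y i)‖ ≤ m) :
    ‖F w₀‖ ≤ m * Real.exp (4 * q) + (M + m * Real.exp (4 * q)) * (1 / 3) ^ J := by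
  have hq' : (0 : ℝ) < q := by exact_mod_cast hq
  have hne : ∀ i < J, ∀ k < J, i ≠ k → y i ≠ y k := by
    intro i hi k hk hik h
    have := hsep i hi k hk
    rw [h, sub_self, norm_zero] at this
    have h2 : 0 < |(i : ℝ) - k| / q :=
      div_pos (abs_pos.2 (sub_ne_zero.2 (by exact_mod_cast hik))) hq'
    linarith
  let l : ℂ → ℂ := fun w => ∑ i ∈ Finset.range J,
    F (y i) * ∏ k ∈ (Finset.range J).erase i, (w - y k) / (y i - y k)
  have hl : Differentiable ℂ l := by
    refine Differentiable.fun_sum fun i _ => Differentiable.const_mul ?_ _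
    refine Differentiable.fun_finsetProd fun k _ => ?_
    fun_prop
  have hly : ∀ i < J, l (y i) = F (y i) := by
    intro i hi
    have hi' := Finset.mem_range.2 hi
    simp only [l]
    rw [Finset.sum_eq_single_of_mem i hi']
    · rw [Finset.prod_eq_one, mul_one]
      intro k hk
      obtain ⟨hk1, hk2⟩ := Finset.mem_erase.1 hk
      exact div_self (sub_ne_zero.2 (hne i hi k (Finset.mem_range.1 hk2) (Ne.symm hk1)))
    · intro k hk hki
      rw [Finset.prod_eq_zero (Finset.mem_erase.2 ⟨Ne.symm hki, hi'⟩) (by simp), mul_zero]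
  have hlb : ∀ w, ‖w - w₀‖ ≤ R → ‖l w‖ ≤ m * Real.exp (4 * q) := by
    intro w hw
    have hterm : ∀ i ∈ Finset.range J,
        ‖F (y i) * ∏ k ∈ (Finset.range J).erase i, (w - y k) / (y i - y k)‖
          ≤ m * (((5 / 4 * q) ^ (J - 1)) / ((J - 1).factorial) * ((J - 1).choose i)) := by
      intro i hi
      have hi' := Finset.mem_range.1 hi
      rw [norm_mul]
      refine mul_le_mul (hm i hi') ?_ (norm_nonneg _) hm0
      rw [norm_prod]
      have h1 : ∏ k ∈ (Finset.range J).erase i, ‖(w - y k) / (y i - y k)‖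
          ≤ ∏ k ∈ (Finset.range J).erase i, (5 / 4 * q) / |(i : ℝ) - k| := by
        refine Finset.prod_le_prod (fun _ _ => norm_nonneg _) fun k hk => ?_
        obtain ⟨hk1, hk2⟩ := Finset.mem_erase.1 hk
        have hk2 := Finset.mem_range.1 hk2
        have h3 := hsep i hi' k hk2
        have h4 : 0 < |(i : ℝ) - k| :=
          abs_pos.2 (sub_ne_zero.2 (by exact_mod_cast Ne.symm hk1))
        rw [norm_div]
        have h5 : ‖w - y k‖ ≤ 5 / 4 := by
          have := norm_sub_le_norm_sub_add_norm_sub w w₀ (y k)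
          have h6 := hy k hk2
          rw [norm_sub_rev] at h6
          linarith
        calc ‖w - y k‖ / ‖y i - y k‖ ≤ (5 / 4) / (|(i : ℝ) - k| / q) :=
              div_le_div₀ (by norm_num) h5 (by positivity) h3
          _ = (5 / 4 * q) / |(i : ℝ) - k| := by field_simp
      refine h1.trans_eq ?_
      rw [Finset.prod_div_distrib, prod_erase_dist J i hi', Finset.prod_const,
        Finset.card_erase_of_mem hi, Finset.card_range]
      have h7 := Nat.choose_mul_factorial_mul_factorial (show i ≤ J - 1 by omega)
      have h8 : ((J - 1).choose i : ℝ) * i.factorial * (J - 1 - i).factorial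
          = (J - 1).factorial := by exact_mod_cast h7
      have h9 : (i.factorial : ℝ) ≠ 0 := by positivity
      have h10 : ((J - 1 - i).factorial : ℝ) ≠ 0 := by positivity
      have h11 : ((J - 1).factorial : ℝ) ≠ 0 := by positivity
      field_simp
      rw [← h8]; ring
    refine (norm_sum_le_of_le _ hterm).trans ?_
    rw [← Finset.mul_sum, ← Finset.mul_sum]
    refine mul_le_mul_of_nonneg_left ?_ hm0
    have h12 : ∑ i ∈ Finset.range J, ((J - 1).choose i : ℝ) = 2 ^ (J - 1) := by
      have := Nat.sum_range_choose (J - 1)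
      rw [show J - 1 + 1 = J by omega] at this
      exact_mod_cast this
    rw [h12]
    calc (5 / 4 * q : ℝ) ^ (J - 1) / (J - 1).factorial * 2 ^ (J - 1)
        = (5 / 2 * q : ℝ) ^ (J - 1) / (J - 1).factorial := by
          rw [div_mul_eq_mul_div, ← mul_pow]; congr 2; ring
      _ ≤ Real.exp (5 / 2 * q) := Real.pow_div_factorial_le_exp _ (by positivity) _
      _ ≤ Real.exp (4 * q) := Real.exp_le_exp.2 (by nlinarith)
  have hz := norm_center_le_of_zeros J (fun w => F w - l w) (M + m * Real.exp (4 * q)) w₀ R y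
    (hF.sub hl) hR (fun w hw => (norm_sub_le _ _).trans (add_le_add (hM w hw) (hlb w hw)))
    hy hne (fun i hi => by simp [hly i hi])
  have hl0 := hlb w₀ (by simpa using hR.le)
  have : ‖F w₀‖ ≤ ‖l w₀‖ + ‖F w₀ - l w₀‖ := by
    have := norm_add_le (l w₀) (F w₀ - l w₀)
    rwa [add_sub_cancel] at this
  linarith

/-- `p / q` is a reduced fraction approximating `Φ` to within `1 / q ^ 2`. -/
structure IsGoodApprox (Φ : ℝ) (p : ℤ) (q : ℕ) : Prop where
  pos : 0 < q
  coprime : IsCoprime p (q : ℤ)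
  close : |Φ - (p : ℝ) / q| ≤ 1 / (q : ℝ) ^ 2

lemma exists_isGoodApprox {Φ : ℝ} (hΦ : Irrational Φ) (N : ℕ) :
    ∃ p q, N ≤ q ∧ IsGoodApprox Φ p q := by
  have hinf := (Real.infinite_rat_abs_sub_lt_one_div_den_sq_iff_irrational Φ).2 hΦ
  by_contra! hcon
  refine hinf ?_
  obtain ⟨C, hC⟩ := exists_nat_ge (N * (|Φ| + 1))
  refine Set.Finite.subset (((Finset.Icc (-(C : ℤ)) C) ×ˢ (Finset.range N)).image
    fun a : ℤ × ℕ => (a.1 : ℚ) / (a.2 : ℚ)).finite_toSet ?_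
  intro r hr
  have hr : |Φ - r| < 1 / (r.den : ℝ) ^ 2 := hr
  have hden : (1 : ℝ) ≤ r.den := by exact_mod_cast r.den_pos
  have hrr : (r : ℝ) = (r.num : ℝ) / (r.den : ℝ) := by exact_mod_cast (Rat.num_div_den r).symm
  have hlt : r.den < N := by
    by_contra! hN
    refine hcon r.num r.den hN ⟨r.den_pos, ?_, ?_⟩
    · rw [Int.isCoprime_iff_gcd_eq_one]; exact r.reduced
    · rw [← hrr]; exact hr.le
  rw [Finset.mem_coe, Finset.mem_image]
  refine ⟨(r.num, r.den), ?_, by simp [Rat.num_div_den]⟩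
  rw [Finset.mem_product, Finset.mem_range, Finset.mem_Icc]
  refine ⟨?_, hlt⟩
  have h1 : |(r : ℝ)| ≤ |Φ| + 1 := by
    have h2 : 1 / (r.den : ℝ) ^ 2 ≤ 1 := by
      rw [div_le_one (by positivity)]; nlinarith
    have h3 := abs_sub_abs_le_abs_sub (r : ℝ) Φ
    rw [abs_sub_comm] at h3
    linarith
  have h2 : |(r.num : ℝ)| ≤ C := by
    have h3 : (r.num : ℝ) = r * r.den := by rw [hrr]; field_simp
    rw [h3, abs_mul, abs_of_nonneg (by linarith : (0 : ℝ) ≤ r.den)]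
    have h4 : (r.den : ℝ) ≤ N := by exact_mod_cast hlt.le
    nlinarith [abs_nonneg (r : ℝ), abs_nonneg Φ]
  have h3 : |r.num| ≤ (C : ℤ) := by exact_mod_cast h2
  exact abs_le.1 h3

/-- Residues along a coprime rotation. -/
lemma exists_mul_eq_add {p : ℤ} {q : ℕ} (hq : 0 < q) (hpq : IsCoprime p (q : ℤ)) (h : ℤ) :
    ∃ j : ℕ, j < q ∧ ∃ l : ℤ, (j : ℤ) * p = h + q * l := by
  obtain ⟨a, b, hab⟩ := hpq
  have hq' : (q : ℤ) ≠ 0 := by exact_mod_cast hq.ne'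
  have h0 := Int.emod_nonneg (a * h) hq'
  refine ⟨((a * h) % q).toNat, ?_, -h * b - (a * h) / q * p, ?_⟩
  · have := Int.emod_lt_of_pos (a * h) (by exact_mod_cast hq : (0 : ℤ) < q)
    omega
  · rw [Int.toNat_of_nonneg h0]
    have h1 := Int.emod_add_mul_ediv (a * h) q
    have h2 : (a * h) % q = a * h - q * ((a * h) / q) := by linarith
    rw [h2]
    linear_combination h * hab

lemma int_periodic {E : Type*} {h : ℝ → E} (hp : ∀ x, h (x + 1) = h x) (x : ℝ) (n : ℤ) :
    h (x + n) = h x := by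
  have hP : Function.Periodic h 1 := hp
  simpa using hP.int_mul n x

lemma sum_rotation_eq_sum_grid {h : ℝ → ℝ} (hp : ∀ x, h (x + 1) = h x) {p : ℤ} {q : ℕ}
    (hq : 0 < q) (hpq : IsCoprime p (q : ℤ)) (x : ℝ) :
    ∑ j ∈ Finset.range q, h (x + j * (p / q : ℝ)) = ∑ k ∈ Finset.range q, h (x + k / q) := by
  have hq' : (q : ℤ) ≠ 0 := by exact_mod_cast hq.ne'
  have hqr : (q : ℝ) ≠ 0 := by exact_mod_cast hq.ne'
  let e : ℕ → ℕ := fun j => (((j : ℤ) * p) % q).toNat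
  have he : ∀ j, ((e j : ℕ) : ℤ) = ((j : ℤ) * p) % q := fun j =>
    Int.toNat_of_nonneg (Int.emod_nonneg _ hq')
  have hmaps : ∀ j ∈ Finset.range q, e j ∈ Finset.range q := by
    intro j _
    have := Int.emod_lt_of_pos ((j : ℤ) * p) (by exact_mod_cast hq : (0 : ℤ) < q)
    have h2 := he j
    rw [Finset.mem_range]; omega
  have hinj : Set.InjOn e (Finset.range q : Set ℕ) := by
    intro i hi j hj hij
    have hi := Finset.mem_range.1 (Finset.mem_coe.1 hi)
    have hj := Finset.mem_range.1 (Finset.mem_coe.1 hj)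
    have h1 : ((i : ℤ) * p) % q = ((j : ℤ) * p) % q := by rw [← he, ← he, hij]
    have h2 : (q : ℤ) ∣ ((j : ℤ) - i) * p := by
      have h3 := (Int.emod_eq_emod_iff_emod_sub_eq_zero).1 h1.symm
      rw [sub_mul]; exact Int.dvd_of_emod_eq_zero h3
    have h3 := hpq.symm.dvd_of_dvd_mul_right h2
    have h4 : ((j : ℤ) - i) = 0 := Int.eq_zero_of_abs_lt_dvd h3 (by rw [abs_lt]; omega)
    omega
  have hsurj : (Finset.range q).image e = Finset.range q := by
    refine Finset.eq_of_subset_of_card_le (Finset.image_subset_iff.2 hmaps) ?_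
    rw [Finset.card_image_of_injOn hinj]
  have hsum := Finset.sum_image (f := fun k : ℕ => h (x + k / q)) hinj
  rw [hsurj] at hsum
  rw [hsum]
  refine Finset.sum_congr rfl fun j _ => ?_
  have h1 := Int.emod_add_mul_ediv ((j : ℤ) * p) q
  rw [← he] at h1
  have h2 : (e j : ℝ) + q * (((j : ℤ) * p / q : ℤ) : ℝ) = j * p := by exact_mod_cast h1
  rw [← int_periodic hp (x + (e j : ℝ) / q) ((j : ℤ) * p / q)]
  congr 1
  field_simp
  linarith

lemma periodic_unif {E : Type*} [PseudoMetricSpace E] {h : ℝ → E} (hp : ∀ x, h (x + 1) = h x)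
    (hc : Continuous h) {δ : ℝ} (hδ : 0 < δ) :
    ∃ η > 0, ∀ x y, |x - y| ≤ η → dist (h x) (h y) ≤ δ := by
  have hu : UniformContinuousOn h (Set.Icc (-1) 2) :=
    isCompact_Icc.uniformContinuousOn_of_continuous hc.continuousOn
  obtain ⟨η, hη, H⟩ := Metric.uniformContinuousOn_iff.1 hu δ hδ
  refine ⟨min (η / 2) 1, by positivity, fun x y hxy => ?_⟩
  have h1 := Int.floor_le x
  have h2 := Int.lt_floor_add_one x
  have h3 := hxy.trans (min_le_left _ _)
  have h4 := abs_le.1 (hxy.trans (min_le_right _ _))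
  rw [← int_periodic hp x (-⌊x⌋), ← int_periodic hp y (-⌊x⌋)]
  push_cast
  refine (H _ ⟨by linarith, by linarith⟩ _ ⟨by linarith, by linarith⟩ ?_).le
  rw [Real.dist_eq, add_sub_add_right_eq_sub]
  linarith

/-- Equidistribution of rational rotations, uniformly in the base point and under perturbations
of the order of the mesh. -/
lemma sum_rotation_close {h : ℝ → ℝ} (hp : ∀ x, h (x + 1) = h x) (hc : Continuous h) {δ : ℝ}
    (hδ : 0 < δ) : ∃ q₀ : ℕ, ∀ (p : ℤ) (q : ℕ), q₀ ≤ q → 0 < q → IsCoprime p (q : ℤ) →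
      ∀ (x : ℝ) (y : ℕ → ℝ), (∀ j < q, |y j - (x + j * (p / q : ℝ))| ≤ 1 / q) →
      |∑ j ∈ Finset.range q, h (y j) - q * ∫ u in (0 : ℝ)..1, h u| ≤ δ * q := by
  obtain ⟨η, hη, H⟩ := periodic_unif hp hc (half_pos hδ)
  obtain ⟨q₀, hq₀⟩ := exists_nat_ge (1 / η)
  refine ⟨q₀, fun p q hq hqpos hpq x y hy => ?_⟩
  have hqr : (0 : ℝ) < q := by exact_mod_cast hqpos
  have hqη : 1 / (q : ℝ) ≤ η := by
    rw [div_le_iff₀ hqr]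
    rw [div_le_iff₀ hη] at hq₀
    have : (q₀ : ℝ) ≤ q := by exact_mod_cast hq
    nlinarith
  have h1 : |∑ j ∈ Finset.range q, h (y j) - ∑ j ∈ Finset.range q, h (x + j * (p / q : ℝ))|
      ≤ q * (δ / 2) := by
    rw [← Finset.sum_sub_distrib]
    refine (Finset.abs_sum_le_sum_abs _ _).trans ?_
    refine (Finset.sum_le_card_nsmul _ _ (δ / 2) fun j hj => ?_).trans_eq (by simp)
    exact H _ _ ((hy j (Finset.mem_range.1 hj)).trans hqη)
  rw [sum_rotation_eq_sum_grid hp hqpos hpq] at h1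
  have hinteg : ∫ u in (0 : ℝ)..1, h u
      = ∑ k ∈ Finset.range q, ∫ u in (x + k / q)..(x + (k + 1 : ℕ) / q), h u := by
    rw [intervalIntegral.sum_integral_adjacent_intervals
      (a := fun k : ℕ => x + (k : ℝ) / q) (fun k _ => hc.intervalIntegrable _ _)]
    have hP : Function.Periodic h 1 := hp
    have := hP.intervalIntegral_add_eq 0 x
    simp only [zero_add] at this
    rw [this]; congr 1
    · simp
    · rw [div_self hqr.ne']
  have h2 : |∑ k ∈ Finset.range q, h (x + k / q) - q * ∫ u in (0 : ℝ)..1, h u|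
      ≤ q * (δ / 2) := by
    rw [hinteg, Finset.mul_sum, ← Finset.sum_sub_distrib]
    refine (Finset.abs_sum_le_sum_abs _ _).trans ?_
    refine (Finset.sum_le_card_nsmul _ _ (δ / 2) fun k _ => ?_).trans_eq (by simp)
    have hlen : x + ((k + 1 : ℕ) : ℝ) / q - (x + k / q) = 1 / q := by
      push_cast; field_simp; ring
    have h3 : h (x + k / q) - q * ∫ u in (x + k / q)..(x + (k + 1 : ℕ) / q), h u
        = q * ∫ u in (x + k / q)..(x + (k + 1 : ℕ) / q), (h (x + k / q) - h u) := by
      rw [intervalIntegral.integral_sub (by simp) (hc.intervalIntegrable _ _),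
        intervalIntegral.integral_const, hlen, smul_eq_mul]
      field_simp
    rw [h3, abs_mul, abs_of_pos hqr]
    have hle : x + (k : ℝ) / q ≤ x + ((k + 1 : ℕ) : ℝ) / q := by
      have : (0 : ℝ) < 1 / q := by positivity
      linarith
    have h4 : ‖∫ u in (x + k / q)..(x + (k + 1 : ℕ) / q), (h (x + k / q) - h u)‖
        ≤ δ / 2 * |x + ((k + 1 : ℕ) : ℝ) / q - (x + k / q)| := by
      refine intervalIntegral.norm_integral_le_of_norm_le_const fun u hu => ?_
      rw [Set.uIoc_of_le hle] at hu
      refine H _ _ ?_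
      rw [abs_le]
      constructor <;> linarith [hu.1, hu.2]
    rw [hlen, abs_of_pos (by positivity), Real.norm_eq_abs] at h4
    calc (q : ℝ) * _ ≤ q * (δ / 2 * (1 / q)) := mul_le_mul_of_nonneg_left h4 hqr.le
      _ = δ / 2 := by field_simp
  have h3 := abs_add_le (∑ j ∈ Finset.range q, h (y j) - ∑ k ∈ Finset.range q, h (x + k / q))
    (∑ k ∈ Finset.range q, h (x + k / q) - q * ∫ u in (0 : ℝ)..1, h u)
  rw [sub_add_sub_cancel] at h3
  linarith

lemma IsGoodApprox.abs_sub_le {Φ : ℝ} {p : ℤ} {q : ℕ} (hg : IsGoodApprox Φ p q) (x : ℝ) (j : ℕ)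
    (hj : j < q) : |x + j * Φ - (x + j * (p / q : ℝ))| ≤ 1 / q := by
  have hqr : (0 : ℝ) < q := by exact_mod_cast hg.pos
  have h1 : x + j * Φ - (x + j * (p / q : ℝ)) = j * (Φ - p / q) := by ring
  rw [h1, abs_mul, Nat.abs_cast]
  have hj' : (j : ℝ) ≤ q := by exact_mod_cast hj.le
  calc (j : ℝ) * |Φ - p / q| ≤ q * (1 / (q : ℝ) ^ 2) :=
        mul_le_mul hj' hg.close (abs_nonneg _) hqr.le
    _ = 1 / q := by field_simp

/-- Products of a matrix function along the rotation by `Φ`, with complex base point. -/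
def cprod (D : ℂ → Mat2) (Φ : ℝ) : ℕ → ℂ → Mat2
  | 0, _ => 1
  | n + 1, w => D (w + n * Φ) * cprod D Φ n w

/-- Entire `1`-periodic matrix functions that are invertible on the real line and symmetric
under reflection in it. -/
structure IsReflCocycle (D : ℂ → Mat2) : Prop where
  diff : ∀ i j, Differentiable ℂ fun w => D w i j
  per : ∀ w, D (w + 1) = D w
  refl : ∃ c : ℂ, ‖c‖ = 1 ∧ ∀ w,
    D ((starRingEnd ℂ) w) = c • (!![0, 1; 1, 0] * (D w).map (starRingEnd ℂ) * !![0, 1; 1, 0])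
  det_ne : ∀ x : ℝ, (D x).det ≠ 0

lemma cprod_add (D : ℂ → Mat2) (Φ : ℝ) (m n : ℕ) (w : ℂ) :
    cprod D Φ (m + n) w = cprod D Φ m (w + n * Φ) * cprod D Φ n w := by
  induction m with
  | zero => simp [cprod]
  | succ m ih =>
    rw [Nat.succ_add, cprod, ih, cprod, Matrix.mul_assoc]
    congr 2; push_cast; ring

lemma cprod_one (D : ℂ → Mat2) (Φ : ℝ) (w : ℂ) : cprod D Φ 1 w = D w := by simp [cprod]

lemma cprod_det (D : ℂ → Mat2) (Φ : ℝ) (n : ℕ) (w : ℂ) :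
    (cprod D Φ n w).det = ∏ j ∈ Finset.range n, (D (w + j * Φ)).det := by
  induction n with
  | zero => simp [cprod]
  | succ n ih => rw [cprod, Matrix.det_mul, ih, Finset.prod_range_succ, mul_comm]

lemma mat2_norm_swap (A : Mat2) :
    ‖(!![0, 1; 1, 0] : Mat2) * A.map (starRingEnd ℂ) * (!![0, 1; 1, 0] : Mat2)‖ = ‖A‖ := by
  rw [← sq_eq_sq₀ (norm_nonneg _) (norm_nonneg _), mat2_norm_sq, mat2_norm_sq]
  simp only [Matrix.mul_apply, Fin.sum_univ_two, Matrix.map_apply, Matrix.of_apply,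
    Matrix.cons_val', Matrix.cons_val_zero, Matrix.cons_val_one, Matrix.cons_val_fin_one,
    zero_mul, one_mul, mul_zero, mul_one, zero_add, add_zero, RCLike.norm_conj]
  ring

lemma mat2_differentiable {A : ℂ → Mat2} (h : ∀ i j, Differentiable ℂ fun w => A w i j) :
    Differentiable ℂ A := by
  have : A = fun w => ∑ i, ∑ j, A w i j • Matrix.single i j (1 : ℂ) := by
    funext w
    conv_lhs => rw [Matrix.matrix_eq_sum_single (A w)]
    simp
  rw [this]
  exact Differentiable.fun_sum fun i _ => Differentiable.fun_sum fun j _ => (h i j).smul_const _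

namespace IsReflCocycle

variable {D : ℂ → Mat2}

lemma entry_diff (hD : IsReflCocycle D) (Φ : ℝ) (n : ℕ) (i j : Fin 2) :
    Differentiable ℂ fun w => cprod D Φ n w i j := by
  induction n generalizing i j with
  | zero => simp only [cprod]; exact differentiable_const _
  | succ n ih =>
    simp only [cprod, Matrix.mul_apply, Fin.sum_univ_two]
    have h : ∀ i j, Differentiable ℂ fun w : ℂ => D (w + n * Φ) i j := fun i j =>
      (hD.diff i j).comp (by fun_prop : Differentiable ℂ fun w : ℂ => w + n * Φ)
    exact ((h _ _).mul (ih _ _)).add ((h _ _).mul (ih _ _))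

lemma differentiable (hD : IsReflCocycle D) (Φ : ℝ) (n : ℕ) :
    Differentiable ℂ (cprod D Φ n) :=
  mat2_differentiable (hD.entry_diff Φ n)

lemma continuous (hD : IsReflCocycle D) : Continuous D := by
  have := (hD.differentiable 0 1).continuous
  simpa [cprod] using this

lemma continuous_cprod (hD : IsReflCocycle D) (n : ℕ) :
    Continuous fun a : ℝ × ℂ => cprod D a.1 n a.2 := by
  induction n with
  | zero => simp only [cprod]; exact continuous_const
  | succ n ih =>
    simp only [cprod]
    refine Continuous.mul (hD.continuous.comp ?_) ih
    fun_prop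

lemma cprod_per (hD : IsReflCocycle D) (Φ : ℝ) (n : ℕ) (w : ℂ) :
    cprod D Φ n (w + 1) = cprod D Φ n w := by
  induction n with
  | zero => rfl
  | succ n ih => rw [cprod, cprod, ih, add_right_comm, hD.per]

lemma per_int (hD : IsReflCocycle D) (w : ℂ) (k : ℤ) : D (w + k) = D w := by
  have h : Function.Periodic D 1 := hD.per
  simpa using h.int_mul k w

lemma cprod_per_int (hD : IsReflCocycle D) (Φ : ℝ) (n : ℕ) (w : ℂ) (k : ℤ) :
    cprod D Φ n (w + k) = cprod D Φ n w := by
  have h : Function.Periodic (cprod D Φ n) 1 := hD.cprod_per Φ n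
  simpa using h.int_mul k w

lemma norm_cprod_conj (hD : IsReflCocycle D) (Φ : ℝ) (n : ℕ) (w : ℂ) :
    ‖cprod D Φ n ((starRingEnd ℂ) w)‖ = ‖cprod D Φ n w‖ := by
  obtain ⟨c, hc, h⟩ := hD.refl
  have key : cprod D Φ n ((starRingEnd ℂ) w)
      = c ^ n • (!![0, 1; 1, 0] * (cprod D Φ n w).map (starRingEnd ℂ) * !![0, 1; 1, 0]) := by
    induction n with
    | zero => ext i j; fin_cases i <;> fin_cases j <;> simp [cprod]
    | succ n ih =>
      have h1 : (starRingEnd ℂ) w + n * Φ = (starRingEnd ℂ) (w + n * Φ) := by simp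
      have hσ : (!![0, 1; 1, 0] : Mat2) * !![0, 1; 1, 0] = 1 := by
        ext i j; fin_cases i <;> fin_cases j <;> simp
      rw [cprod, cprod, ih, h1, h, Matrix.map_mul, pow_succ', Matrix.smul_mul, Matrix.mul_smul,
        smul_smul]
      congr 1
      simp only [Matrix.mul_assoc]
      rw [← Matrix.mul_assoc (!![0, 1; 1, 0] : Mat2) (!![0, 1; 1, 0] : Mat2), hσ, Matrix.one_mul]
  rw [key, mat2_norm_smul, norm_pow, hc, one_pow, one_mul,
    mat2_norm_swap]

lemma exists_fract (w : ℂ) : ∃ k : ℤ, ∃ x ∈ Set.Icc (0 : ℝ) 1, w = (x + w.im * Complex.I) + k := by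
  refine ⟨⌊w.re⌋, Int.fract w.re, ⟨Int.fract_nonneg _, (Int.fract_lt_one _).le⟩, ?_⟩
  apply Complex.ext <;> simp

/-- An open periodic set containing a horizontal line contains a strip around it. -/
lemma exists_strip_subset {U : Set ℂ} (hU : IsOpen U) (hper : ∀ w (k : ℤ), w ∈ U → w + k ∈ U)
    (ε : ℝ) (hl : ∀ x : ℝ, (x + ε * Complex.I : ℂ) ∈ U) :
    ∃ η > 0, ∀ w : ℂ, |w.im - ε| ≤ η → w ∈ U := by
  have hK : IsCompact ((fun x : ℝ => (x + ε * Complex.I : ℂ)) '' Set.Icc 0 1) :=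
    isCompact_Icc.image (by fun_prop)
  obtain ⟨η, hη, H⟩ := hK.exists_thickening_subset_open hU
    (by rintro _ ⟨x, _, rfl⟩; exact hl x)
  refine ⟨η / 2, by positivity, fun w hw => ?_⟩
  obtain ⟨k, x, hx, hwx⟩ := exists_fract w
  rw [hwx]
  refine hper _ _ (H ?_)
  rw [Metric.mem_thickening_iff]
  refine ⟨_, ⟨x, hx, rfl⟩, ?_⟩
  have : (x + w.im * Complex.I : ℂ) - (x + ε * Complex.I) = ((w.im - ε : ℝ) : ℂ) * Complex.I := by
    push_cast; ring
  rw [dist_eq_norm, this, norm_mul, Complex.norm_real, Complex.norm_I, mul_one, Real.norm_eq_abs]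
  linarith

lemma exists_bound (hD : IsReflCocycle D) (Φ : ℝ) (n : ℕ) (a b : ℝ) :
    ∃ C, ∀ w : ℂ, w.im ∈ Set.Icc a b → ‖cprod D Φ n w‖ ≤ C := by
  have hK : IsCompact ((fun p : ℝ × ℝ => (p.1 + p.2 * Complex.I : ℂ)) ''
      (Set.Icc 0 1 ×ˢ Set.Icc a b)) :=
    (isCompact_Icc.prod isCompact_Icc).image (by fun_prop)
  obtain ⟨C, hC⟩ := hK.exists_bound_of_continuousOn (hD.differentiable Φ n).continuous.continuousOn
  refine ⟨C, fun w hw => ?_⟩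
  obtain ⟨k, x, hx, hwx⟩ := exists_fract w
  rw [hwx, hD.cprod_per_int]
  exact hC _ ⟨(x, w.im), ⟨hx, hw⟩, rfl⟩

end IsReflCocycle

/-- The supremum of the norm of the `n`-step product over the line `Im w = ε`. -/
def supN (D : ℂ → Mat2) (Φ : ℝ) (n : ℕ) (ε : ℝ) : ℝ :=
  ⨆ x : ℝ, ‖cprod D Φ n (x + ε * Complex.I)‖

/-- The uniform exponential growth rate on the line `Im w = ε`. -/
def growth (D : ℂ → Mat2) (Φ : ℝ) (ε : ℝ) : ℝ :=
  sInf ((fun n : ℕ => Real.log (supN D Φ n ε) / n) '' Set.Ici 1)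

/-- Bounded entire functions on a closed horizontal strip satisfy the maximum principle. -/
lemma norm_le_of_strip {E : Type*} [NormedAddCommGroup E] [NormedSpace ℂ E] {F : ℂ → E}
    (hF : Differentiable ℂ F) {a b B C : ℝ} (hab : a < b)
    (hB : ∀ w : ℂ, w.im ∈ Set.Icc a b → ‖F w‖ ≤ B)
    (ha : ∀ w : ℂ, w.im = a → ‖F w‖ ≤ C) (hb : ∀ w : ℂ, w.im = b → ‖F w‖ ≤ C)
    (w : ℂ) (hw : w.im ∈ Set.Icc a b) : ‖F w‖ ≤ C := by
  refine PhragmenLindelof.horizontal_strip hF.diffContOnCl ⟨0, by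
    have := sub_pos.2 hab; positivity, 0, ?_⟩ ha hb hw.1 hw.2
  simp only [zero_mul, Real.exp_zero]
  refine Asymptotics.IsBigO.of_bound B ?_
  rw [Filter.eventually_inf_principal]
  refine Filter.Eventually.of_forall fun w hw => ?_
  simpa using hB w ⟨hw.1.le, hw.2.le⟩

namespace IsReflCocycle

variable {D : ℂ → Mat2}

lemma bddAbove (hD : IsReflCocycle D) (Φ : ℝ) (n : ℕ) (ε : ℝ) :
    BddAbove (Set.range fun x : ℝ => ‖cprod D Φ n (x + ε * Complex.I)‖) := by
  obtain ⟨C, hC⟩ := hD.exists_bound Φ n ε ε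
  refine ⟨C, ?_⟩
  rintro _ ⟨x, rfl⟩
  exact hC _ (by simp)

lemma norm_le_supN (hD : IsReflCocycle D) (Φ : ℝ) (n : ℕ) (ε x : ℝ) :
    ‖cprod D Φ n (x + ε * Complex.I)‖ ≤ supN D Φ n ε :=
  le_ciSup (hD.bddAbove Φ n ε) x

lemma norm_le_supN' (hD : IsReflCocycle D) (Φ : ℝ) (n : ℕ) (w : ℂ) :
    ‖cprod D Φ n w‖ ≤ supN D Φ n w.im := by
  simpa using hD.norm_le_supN Φ n w.im w.re

lemma exists_supN_le (hD : IsReflCocycle D) (Φ : ℝ) (n : ℕ) (ε : ℝ) :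
    ∃ x : ℝ, supN D Φ n ε ≤ ‖cprod D Φ n (x + ε * Complex.I)‖ := by
  have hc : Continuous fun x : ℝ => ‖cprod D Φ n (x + ε * Complex.I)‖ :=
    ((hD.differentiable Φ n).continuous.comp (by fun_prop)).norm
  obtain ⟨x, -, hx⟩ := isCompact_Icc.exists_isMaxOn (Set.nonempty_Icc.2 zero_le_one)
    (hc.continuousOn (s := Set.Icc 0 1))
  refine ⟨x, ciSup_le fun y => ?_⟩
  have h := int_periodic (h := fun x : ℝ => ‖cprod D Φ n (x + ε * Complex.I)‖)
    (fun x => by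
      have := hD.cprod_per Φ n (x + ε * Complex.I)
      push_cast
      rw [add_right_comm, this]) (Int.fract y) ⌊y⌋
  rw [Int.fract_add_floor] at h
  rw [h]
  exact hx ⟨Int.fract_nonneg _, (Int.fract_lt_one _).le⟩

lemma supN_neg (hD : IsReflCocycle D) (Φ : ℝ) (n : ℕ) (ε : ℝ) :
    supN D Φ n (-ε) = supN D Φ n ε := by
  unfold supN
  congr 1; funext x
  rw [← hD.norm_cprod_conj]
  congr 2; simp

lemma supN_mono (hD : IsReflCocycle D) (Φ : ℝ) (n : ℕ) {ε ε' : ℝ} (h0 : 0 ≤ ε) (h : ε ≤ ε') :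
    supN D Φ n ε ≤ supN D Φ n ε' := by
  rcases h.eq_or_lt with rfl | h
  · exact le_rfl
  obtain ⟨B, hB⟩ := hD.exists_bound Φ n (-ε') ε'
  refine ciSup_le fun x => norm_le_of_strip (hD.differentiable Φ n) (by linarith) hB ?_ ?_ _ ?_
  · intro w hw; rw [← hD.supN_neg, ← hw]; exact hD.norm_le_supN' Φ n w
  · intro w hw; rw [← hw]; exact hD.norm_le_supN' Φ n w
  · simp; constructor <;> linarith

lemma supN_zero_le (hD : IsReflCocycle D) (Φ : ℝ) (n : ℕ) (ε : ℝ) :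
    supN D Φ n 0 ≤ supN D Φ n ε := by
  rcases le_total 0 ε with h | h
  · exact hD.supN_mono Φ n le_rfl h
  · rw [← hD.supN_neg Φ n ε]; exact hD.supN_mono Φ n le_rfl (by linarith)

lemma supN_add_le (hD : IsReflCocycle D) (Φ : ℝ) (m n : ℕ) (ε : ℝ) :
    supN D Φ (m + n) ε ≤ supN D Φ m ε * supN D Φ n ε := by
  refine ciSup_le fun x => ?_
  rw [cprod_add]
  refine (mat2_norm_mul_le _ _).trans ?_
  refine mul_le_mul ?_ (hD.norm_le_supN Φ n ε x) (norm_nonneg _) ((norm_nonneg _).trans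
    (hD.norm_le_supN Φ m ε 0))
  have := hD.norm_le_supN Φ m ε (x + n * Φ)
  push_cast at this
  rwa [add_right_comm] at this

lemma exists_det_lower (hD : IsReflCocycle D) : ∃ C : ℝ, ∀ x : ℝ, Real.exp (-C) ≤ ‖(D x).det‖ := by
  have hc : Continuous fun x : ℝ => ‖(D x).det‖ := by
    have : Continuous fun x : ℝ => D x := hD.continuous.comp (by fun_prop)
    exact this.matrix_det.norm
  obtain ⟨x, -, hx⟩ := isCompact_Icc.exists_isMinOn (Set.nonempty_Icc.2 zero_le_one)
    (hc.continuousOn (s := Set.Icc 0 1))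
  refine ⟨-Real.log ‖(D x).det‖, fun y => ?_⟩
  rw [neg_neg, Real.exp_log (norm_pos_iff.2 (hD.det_ne x))]
  have h := int_periodic (h := fun x : ℝ => ‖(D x).det‖)
    (fun x => by push_cast; rw [hD.per]) (Int.fract y) ⌊y⌋
  rw [Int.fract_add_floor] at h
  rw [h]
  exact hx ⟨Int.fract_nonneg _, (Int.fract_lt_one _).le⟩

lemma exists_supN_lower (hD : IsReflCocycle D) : ∃ C : ℝ, ∀ (Φ : ℝ) (n : ℕ) (ε : ℝ),
    Real.exp (-(C * n)) ≤ supN D Φ n ε := by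
  obtain ⟨C, hC⟩ := hD.exists_det_lower
  refine ⟨C / 2, fun Φ n ε => le_trans ?_ (hD.supN_zero_le Φ n ε)⟩
  refine le_trans ?_ (hD.norm_le_supN Φ n 0 0)
  rw [← sq_le_sq₀ (Real.exp_nonneg _) (norm_nonneg _)]
  refine le_trans ?_ (mat2_det_le _)
  rw [cprod_det, norm_prod, ← Real.exp_nat_mul]
  have h1 : ∏ j ∈ Finset.range n, Real.exp (-C)
      ≤ ∏ j ∈ Finset.range n, ‖(D (((0 : ℝ) : ℂ) + ((0 : ℝ) : ℂ) * Complex.I + j * Φ)).det‖ := by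
    refine Finset.prod_le_prod (fun _ _ => (Real.exp_nonneg _)) fun j _ => ?_
    have := hC (j * Φ)
    push_cast at this
    simpa using this
  rw [Finset.prod_const, Finset.card_range, ← Real.exp_nat_mul] at h1
  have h2 : ((2 : ℕ) : ℝ) * -(C / 2 * n) = n * -C := by push_cast; ring
  rw [h2]
  have := Real.exp_nonneg (n * -C)
  linarith

lemma supN_pos (hD : IsReflCocycle D) (Φ : ℝ) (n : ℕ) (ε : ℝ) : 0 < supN D Φ n ε := by
  obtain ⟨C, hC⟩ := hD.exists_supN_lower
  exact (Real.exp_pos _).trans_le (hC Φ n ε)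

lemma subadditive (hD : IsReflCocycle D) (Φ ε : ℝ) :
    Subadditive fun n => Real.log (supN D Φ n ε) := by
  intro m n
  rw [← Real.log_mul (hD.supN_pos Φ m ε).ne' (hD.supN_pos Φ n ε).ne']
  exact Real.log_le_log (hD.supN_pos Φ _ ε) (hD.supN_add_le Φ m n ε)

lemma bddBelow (hD : IsReflCocycle D) (Φ ε : ℝ) :
    BddBelow (Set.range fun n : ℕ => Real.log (supN D Φ n ε) / n) := by
  obtain ⟨C, hC⟩ := hD.exists_supN_lower
  refine ⟨-|C|, ?_⟩
  rintro _ ⟨n, rfl⟩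
  rcases Nat.eq_zero_or_pos n with rfl | hn
  · simp
  have hn' : (0 : ℝ) < n := by exact_mod_cast hn
  rw [le_div_iff₀ hn']
  have h := (Real.le_log_iff_exp_le (hD.supN_pos Φ n ε)).2 (hC Φ n ε)
  nlinarith [le_abs_self C]

lemma growth_eq_lim (hD : IsReflCocycle D) (Φ ε : ℝ) :
    growth D Φ ε = (hD.subadditive Φ ε).lim := by
  rw [Subadditive.lim]; rfl

lemma tendsto_growth (hD : IsReflCocycle D) (Φ ε : ℝ) :
    Filter.Tendsto (fun n : ℕ => Real.log (supN D Φ n ε) / n) Filter.atTop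
      (nhds (growth D Φ ε)) :=
  hD.growth_eq_lim Φ ε ▸ (hD.subadditive Φ ε).tendsto_lim (hD.bddBelow Φ ε)

lemma exp_growth_le (hD : IsReflCocycle D) (Φ ε : ℝ) {n : ℕ} (hn : 0 < n) :
    Real.exp (n * growth D Φ ε) ≤ supN D Φ n ε := by
  have h := (hD.subadditive Φ ε).lim_le_div (hD.bddBelow Φ ε) hn.ne'
  have hn' : (0 : ℝ) < n := by exact_mod_cast hn
  rw [← hD.growth_eq_lim, le_div_iff₀ hn'] at h
  rw [← Real.le_log_iff_exp_le (hD.supN_pos Φ n ε), mul_comm]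
  exact h

lemma eventually_supN_le (hD : IsReflCocycle D) (Φ ε : ℝ) {δ : ℝ} (hδ : 0 < δ) :
    ∃ n₀ : ℕ, ∀ n ≥ n₀, supN D Φ n ε ≤ Real.exp (n * (growth D Φ ε + δ)) := by
  have h := (hD.tendsto_growth Φ ε).eventually (gt_mem_nhds (show growth D Φ ε
    < growth D Φ ε + δ by linarith))
  obtain ⟨n₀, hn₀⟩ := Filter.eventually_atTop.1 h
  refine ⟨n₀ + 1, fun n hn => ?_⟩
  have h1 := hn₀ n (by omega)
  have hn' : (0 : ℝ) < n := by exact_mod_cast (by omega : 0 < n)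
  rw [div_lt_iff₀ hn'] at h1
  rw [← Real.log_le_iff_le_exp (hD.supN_pos Φ n ε)]
  linarith

lemma growth_neg (hD : IsReflCocycle D) (Φ ε : ℝ) : growth D Φ (-ε) = growth D Φ ε := by
  unfold growth; simp only [hD.supN_neg]

lemma growth_mono (hD : IsReflCocycle D) (Φ : ℝ) : MonotoneOn (growth D Φ) (Set.Ici 0) := by
  intro ε h0 ε' _ h
  refine le_of_tendsto_of_tendsto' (hD.tendsto_growth Φ ε) (hD.tendsto_growth Φ ε') fun n => ?_
  gcongr
  · exact hD.supN_pos Φ n ε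
  · exact hD.supN_mono Φ n h0 h

end IsReflCocycle

namespace IsReflCocycle

variable {D : ℂ → Mat2}

lemma norm_cprod_le_exp {Φ C ε : ℝ} (hC : ∀ x : ℝ, ‖D (x + ε * Complex.I)‖ ≤ Real.exp C)
    (n : ℕ) (x : ℝ) : ‖cprod D Φ n (x + ε * Complex.I)‖ ≤ 2 * Real.exp (C * n) := by
  induction n with
  | zero => simpa [cprod] using mat2_norm_one_le
  | succ n ih =>
    rw [cprod]
    refine (mat2_norm_mul_le _ _).trans ?_
    have h := hC (x + n * Φ)
    push_cast at h
    rw [add_right_comm] at h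
    refine (mul_le_mul h ih (norm_nonneg _) (Real.exp_nonneg _)).trans_eq ?_
    push_cast
    rw [mul_add, Real.exp_add, mul_one]; ring

lemma exp_le_norm_det_cprod {Φ C ε : ℝ}
    (hC : ∀ x : ℝ, Real.exp (-C) ≤ ‖(D (x + ε * Complex.I)).det‖)
    (n : ℕ) (x : ℝ) : Real.exp (-(C * n)) ≤ ‖(cprod D Φ n (x + ε * Complex.I)).det‖ := by
  rw [cprod_det, norm_prod]
  have : Real.exp (-(C * n)) = ∏ j ∈ Finset.range n, Real.exp (-C) := by
    rw [Finset.prod_const, Finset.card_range, ← Real.exp_nat_mul]; congr 1; ring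
  rw [this]
  refine Finset.prod_le_prod (fun _ _ => Real.exp_nonneg _) fun j _ => ?_
  have h := hC (x + j * Φ)
  push_cast at h
  rwa [add_right_comm] at h

/-- Smallness of an `n`-step product is inherited along short pieces of the orbit. -/
lemma norm_cprod_shift_le {Φ C ε : ℝ} (hC0 : 0 ≤ C)
    (hC : ∀ x : ℝ, ‖D (x + ε * Complex.I)‖ ≤ Real.exp C)
    (hC' : ∀ x : ℝ, Real.exp (-C) ≤ ‖(D (x + ε * Complex.I)).det‖) (n j q : ℕ) (hj : j ≤ q)
    (x : ℝ) : ‖cprod D Φ n (((x + j * Φ : ℝ) : ℂ) + ε * Complex.I)‖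
      ≤ 4 * Real.exp (3 * C * q) * ‖cprod D Φ n (x + ε * Complex.I)‖ := by
  set w : ℂ := x + ε * Complex.I with hw
  have e1 : cprod D Φ n (w + j * Φ) * cprod D Φ j w = cprod D Φ j (w + n * Φ) * cprod D Φ n w := by
    rw [← cprod_add, ← cprod_add, add_comm]
  have e2 : (cprod D Φ j w).det • cprod D Φ n (w + j * Φ)
      = cprod D Φ j (w + n * Φ) * cprod D Φ n w * (cprod D Φ j w).adjugate := by
    rw [← e1, Matrix.mul_assoc, Matrix.mul_adjugate, Matrix.mul_smul, Matrix.mul_one]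
  have e3 := congrArg norm e2
  rw [mat2_norm_smul] at e3
  have h1 := exp_le_norm_det_cprod (Φ := Φ) hC' j x
  have h2 : ‖cprod D Φ j (w + n * Φ)‖ ≤ 2 * Real.exp (C * j) := by
    have := norm_cprod_le_exp (Φ := Φ) hC j (x + n * Φ)
    push_cast at this
    rwa [add_right_comm] at this
  have h3 := norm_cprod_le_exp (Φ := Φ) hC j x
  rw [← hw] at h1 h3
  have h4 : ‖cprod D Φ j (w + n * Φ) * cprod D Φ n w * (cprod D Φ j w).adjugate‖
      ≤ 2 * Real.exp (C * j) * ‖cprod D Φ n w‖ * (2 * Real.exp (C * j)) := by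
    refine (mat2_norm_mul_le _ _).trans ?_
    rw [mat2_norm_adjugate]
    refine mul_le_mul ((mat2_norm_mul_le _ _).trans ?_) h3 (norm_nonneg _) (by positivity)
    exact mul_le_mul_of_nonneg_right h2 (norm_nonneg _)
  have h5 : ((x + j * Φ : ℝ) : ℂ) + ε * Complex.I = w + j * Φ := by rw [hw]; push_cast; ring
  rw [h5]
  have h6 : Real.exp (-(C * j)) * ‖cprod D Φ n (w + j * Φ)‖
      ≤ 4 * Real.exp (2 * C * j) * ‖cprod D Φ n w‖ := by
    refine (mul_le_mul_of_nonneg_right h1 (norm_nonneg _)).trans (e3.le.trans (h4.trans_eq ?_))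
    have : Real.exp (2 * C * j) = Real.exp (C * j) * Real.exp (C * j) := by
      rw [← Real.exp_add]; congr 1; ring
    rw [this]; ring
  have h7 : ‖cprod D Φ n (w + j * Φ)‖ ≤ 4 * Real.exp (3 * C * j) * ‖cprod D Φ n w‖ := by
    have := mul_le_mul_of_nonneg_left h6 (Real.exp_nonneg (C * j))
    rw [← mul_assoc, ← Real.exp_add, add_neg_cancel, Real.exp_zero, one_mul] at this
    refine this.trans_eq ?_
    have : Real.exp (3 * C * j) = Real.exp (C * j) * Real.exp (2 * C * j) := by
      rw [← Real.exp_add]; congr 1; ring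
    rw [this]; ring
  refine h7.trans ?_
  gcongr

end IsReflCocycle

/-- Orbit points, reduced modulo one, that approach a prescribed point while staying separated. -/
lemma exists_separated_orbit {Φ : ℝ} {p : ℤ} {q : ℕ} (hg : IsGoodApprox Φ p q) (x x₀ : ℝ) :
    ∃ (j : ℕ → ℕ) (l : ℕ → ℤ), (∀ i, j i < q) ∧
      (∀ i, |x + j i * Φ - l i - x₀| ≤ (2 * i + 2) / q) ∧
      ∀ i k : ℕ, |(i : ℝ) - k| / q ≤ |(x + j i * Φ - l i) - (x + j k * Φ - l k)| := by
  have hqr : (0 : ℝ) < q := by exact_mod_cast hg.pos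
  set h₀ : ℤ := ⌈(x₀ - x) * q⌉ with hh₀
  choose j hj l hl using fun i : ℕ => exists_mul_eq_add hg.pos hg.coprime (h₀ + 2 * i)
  have hy : ∀ i, x + j i * Φ - l i = x + (h₀ + 2 * i) / q + j i * (Φ - p / q) := by
    intro i
    have : (j i : ℝ) * p = h₀ + 2 * i + q * l i := by exact_mod_cast hl i
    field_simp
    linear_combination this
  have hsmall : ∀ a : ℝ, |a| ≤ q → |a * (Φ - p / q)| ≤ 1 / q := by
    intro a ha
    rw [abs_mul]
    calc |a| * |Φ - p / q| ≤ q * (1 / (q : ℝ) ^ 2) :=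
          mul_le_mul ha hg.close (abs_nonneg _) hqr.le
      _ = 1 / q := by field_simp
  have hjq : ∀ i, (j i : ℝ) ≤ q := fun i => by exact_mod_cast (hj i).le
  refine ⟨j, l, hj, fun i => ?_, fun i k => ?_⟩
  · rw [hy]
    have h1 := hsmall (j i) (by rw [Nat.abs_cast]; exact hjq i)
    have h2 := Int.le_ceil ((x₀ - x) * q)
    have h3 := Int.ceil_lt_add_one ((x₀ - x) * q)
    rw [← hh₀] at h2 h3
    have h4 : |x + h₀ / q - x₀| ≤ 1 / q := by
      have : x + h₀ / q - x₀ = (h₀ - (x₀ - x) * q) / q := by field_simp; ring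
      rw [this, abs_div, abs_of_pos hqr, abs_of_nonneg (by linarith)]
      gcongr; linarith
    have h5 : x + (h₀ + 2 * i) / q + j i * (Φ - p / q) - x₀
        = (x + h₀ / q - x₀) + j i * (Φ - p / q) + 2 * i / q := by ring
    rw [h5]
    refine (abs_add_le _ _).trans ?_
    have h6 := abs_add_le (x + h₀ / q - x₀) (j i * (Φ - p / q))
    rw [abs_of_nonneg (by positivity : (0 : ℝ) ≤ 2 * i / q)]
    have : (2 * (i : ℝ) + 2) / q = 2 * i / q + 1 / q + 1 / q := by ring
    linarith
  · rcases eq_or_ne i k with rfl | hik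
    · simp
    rw [hy, hy]
    have h1 := hsmall ((j i : ℝ) - j k) (by
      rw [abs_le]
      constructor <;> linarith [hjq i, hjq k, Nat.cast_nonneg (α := ℝ) (j i),
        Nat.cast_nonneg (α := ℝ) (j k)])
    have h2 : (x + (h₀ + 2 * i) / q + j i * (Φ - p / q)) -
        (x + (h₀ + 2 * k) / q + j k * (Φ - p / q))
        = 2 * ((i : ℝ) - k) / q - -(((j i : ℝ) - j k) * (Φ - p / q)) := by ring
    rw [h2]
    have h3 := abs_sub_abs_le_abs_sub (2 * ((i : ℝ) - k) / q)
      (-(((j i : ℝ) - j k) * (Φ - p / q)))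
    rw [abs_neg] at h3
    have h4 : |2 * ((i : ℝ) - k) / q| = 2 * (|(i : ℝ) - k| / q) := by
      rw [abs_div, abs_mul, abs_of_pos hqr, abs_two]; ring
    have h5 : (1 : ℝ) ≤ |(i : ℝ) - k| := by
      have : (1 : ℤ) ≤ |(i : ℤ) - k| := Int.one_le_abs (by omega)
      exact_mod_cast this
    have h6 : 1 / (q : ℝ) ≤ |(i : ℝ) - k| / q := by gcongr
    linarith

namespace IsReflCocycle

variable {D : ℂ → Mat2}

set_option maxHeartbeats 2000000 in
/-- At a level where the growth rate is differentiable, the products along good denominators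
are uniformly large on the whole line. -/
theorem exp_le_norm_cprod (hD : IsReflCocycle D) {Φ ε₀ C ω : ℝ}
    (hC : ∀ x : ℝ, ‖D (x + ε₀ * Complex.I)‖ ≤ Real.exp C)
    (hC' : ∀ x : ℝ, Real.exp (-C) ≤ ‖(D (x + ε₀ * Complex.I)).det‖)
    (hder : HasDerivAt (growth D Φ) ω ε₀) {δ : ℝ} (hδ : 0 < δ) :
    ∃ K : ℕ, 0 < K ∧ ∃ q₀ : ℕ, ∀ (p : ℤ) (q : ℕ), q₀ ≤ q → IsGoodApprox Φ p q → ∀ x : ℝ,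
      Real.exp ((2 * (K * q) : ℕ) * (growth D Φ ε₀ - δ))
        ≤ ‖cprod D Φ (2 * (K * q)) (x + ε₀ * Complex.I)‖ := by
  wlog hC0 : 0 ≤ C generalizing C
  · exact this (C := |C|)
      (fun x => (hC x).trans (Real.exp_le_exp.2 (le_abs_self C)))
      (fun x => (Real.exp_le_exp.2 (by linarith [le_abs_self C])).trans (hC' x)) (abs_nonneg C)
  obtain ⟨K, hK⟩ := exists_nat_ge ((3 * C + 5) / δ)
  rw [div_le_iff₀ hδ] at hK
  have hKpos : 0 < K := by
    rcases Nat.eq_zero_or_pos K with rfl | h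
    · exfalso; simp only [Nat.cast_zero, zero_mul] at hK; linarith
    · exact h
  have hKr : (1 : ℝ) ≤ K := by exact_mod_cast hKpos
  refine ⟨K, hKpos, ?_⟩
  set η : ℝ := 1 / (64 * K) with hη
  have hηpos : 0 < η := by positivity
  obtain ⟨r, hr, hrb⟩ : ∃ r > 0, ∀ h : ℝ, |h| < r →
      |growth D Φ (ε₀ + h) - growth D Φ ε₀ - h * ω| ≤ η * |h| := by
    have h1 := (hasDerivAt_iff_isLittleO_nhds_zero.1 hder).def hηpos
    obtain ⟨r, hr, H⟩ := Metric.eventually_nhds_iff.1 h1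
    refine ⟨r, hr, fun h hh => ?_⟩
    have := H (y := h) (by simpa using hh)
    simpa using this
  set R : ℝ := min (r / 2) 1 with hR
  have hRpos : 0 < R := by positivity
  have hR1 : R ≤ 1 := min_le_right _ _
  have hRr : R < r := (min_le_left _ _).trans_lt (by linarith)
  have hup := (abs_le.1 (hrb R (by rwa [abs_of_pos hRpos]))).2
  have hdn := (abs_le.1 (hrb (-R) (by rwa [abs_neg, abs_of_pos hRpos]))).2
  rw [abs_of_pos hRpos] at hup
  rw [abs_neg, abs_of_pos hRpos] at hdn
  obtain ⟨n₁, hn₁⟩ := hD.eventually_supN_le Φ (ε₀ + R) (mul_pos hηpos hRpos)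
  obtain ⟨n₂, hn₂⟩ := hD.eventually_supN_le Φ (ε₀ + -R) (mul_pos hηpos hRpos)
  obtain ⟨n₃, hn₃⟩ := exists_nat_ge (160 / R)
  refine ⟨max n₁ (max n₂ n₃), fun p q hq hg x => ?_⟩
  have hqpos := hg.pos
  have hqr : (1 : ℝ) ≤ q := by exact_mod_cast hqpos
  have hnq : q ≤ 2 * (K * q) := by nlinarith
  set n := 2 * (K * q) with hn
  have hnr : (n : ℝ) = 2 * (K * q) := by rw [hn]; push_cast; ring
  have hq160 : 160 ≤ R * q := by
    rw [div_le_iff₀ hRpos] at hn₃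
    have : (n₃ : ℝ) ≤ q := by
      exact_mod_cast ((le_max_right n₂ n₃).trans (le_max_right _ _)).trans hq
    nlinarith
  set Λ := growth D Φ ε₀ with hΛ
  by_contra! hcon
  obtain ⟨x₀, hx₀⟩ := hD.exists_supN_le Φ n ε₀
  have hbig := (hD.exp_growth_le Φ ε₀ (hqpos.trans_le hnq)).trans hx₀
  set w₀ : ℂ := x₀ + ε₀ * Complex.I with hw₀
  obtain ⟨a, b, hab⟩ := mat2_exists_entry (cprod D Φ n w₀)
  let F : ℂ → ℂ := fun w => cprod D Φ n w a b *
    (Complex.exp (Complex.I * (ω * n) * (w - w₀)) * (Real.exp (-(n * Λ)) : ℝ))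
  have hFd : Differentiable ℂ F := by
    refine (hD.entry_diff Φ n a b).mul ?_
    fun_prop
  have hFn : ∀ w : ℂ, ‖F w‖ = ‖cprod D Φ n w a b‖ * Real.exp (-(n * (Λ + ω * (w.im - ε₀)))) := by
    intro w
    simp only [F]
    rw [norm_mul, norm_mul, Complex.norm_exp, Complex.norm_real,
      Real.norm_of_nonneg (Real.exp_nonneg _), ← Real.exp_add]
    congr 2
    simp [hw₀]; ring
  have hFle : ∀ w : ℂ, ‖F w‖ ≤ ‖cprod D Φ n w‖ * Real.exp (-(n * (Λ + ω * (w.im - ε₀)))) := by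
    intro w
    rw [hFn]
    exact mul_le_mul_of_nonneg_right (mat2_entry_le _ _ _) (Real.exp_nonneg _)
  have hF0 : 1 / 2 ≤ ‖F w₀‖ := by
    have h1 : w₀.im = ε₀ := by simp [hw₀]
    rw [hFn, h1, sub_self, mul_zero, add_zero]
    have h2 : 1 ≤ ‖cprod D Φ n w₀‖ * Real.exp (-(n * Λ)) := by
      have := mul_le_mul_of_nonneg_right hbig (Real.exp_nonneg (-(n * Λ)))
      rwa [← Real.exp_add, add_neg_cancel, Real.exp_zero] at this
    nlinarith [mul_le_mul_of_nonneg_right hab (Real.exp_nonneg (-(n * Λ)))]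
  set M : ℝ := Real.exp (R * q / 16) with hM
  have hηn : n * (η * R + η * R) = R * q / 16 := by
    rw [hnr, hη]; field_simp; ring
  have hedge : ∀ s : ℝ, growth D Φ (ε₀ + s) - Λ - s * ω ≤ η * R →
      supN D Φ n (ε₀ + s) ≤ Real.exp (n * (growth D Φ (ε₀ + s) + η * R)) →
      ∀ w : ℂ, w.im = ε₀ + s → ‖F w‖ ≤ M := by
    intro s h1 h2 w hw
    refine (hFle w).trans ?_
    have h3 := hD.norm_le_supN' Φ n w
    rw [hw] at h3 ⊢
    calc _ ≤ Real.exp (n * (growth D Φ (ε₀ + s) + η * R)) *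
          Real.exp (-(n * (Λ + ω * (ε₀ + s - ε₀)))) :=
          mul_le_mul_of_nonneg_right (h3.trans h2) (Real.exp_nonneg _)
      _ ≤ M := by
          rw [← Real.exp_add, hM, ← hηn]
          refine Real.exp_le_exp.2 ?_
          nlinarith [Nat.cast_nonneg (α := ℝ) n]
  have hstrip : ∀ w : ℂ, ‖w - w₀‖ ≤ R → ‖F w‖ ≤ M := by
    obtain ⟨B, hB⟩ := hD.exists_bound Φ n (ε₀ + -R) (ε₀ + R)
    intro w hw
    refine norm_le_of_strip hFd (a := ε₀ + -R) (b := ε₀ + R)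
      (B := B * Real.exp (n * (|Λ| + |ω| * R))) (by linarith) ?_ ?_ ?_ w ?_
    · intro w hw
      refine (hFle w).trans ?_
      refine mul_le_mul (hB w hw) (Real.exp_le_exp.2 ?_) (Real.exp_nonneg _)
        ((norm_nonneg _).trans (hB w hw))
      rw [← mul_neg]
      refine mul_le_mul_of_nonneg_left ?_ (Nat.cast_nonneg _)
      have h1 : |w.im - ε₀| ≤ R := abs_le.2 ⟨by linarith [hw.1], by linarith [hw.2]⟩
      have h2 : |ω * (w.im - ε₀)| ≤ |ω| * R := by
        rw [abs_mul]; exact mul_le_mul_of_nonneg_left h1 (abs_nonneg _)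
      linarith [neg_abs_le Λ, neg_abs_le (ω * (w.im - ε₀))]
    · exact hedge (-R) hdn (hn₂ n (((le_max_left n₂ n₃).trans (le_max_right _ _)).trans
        (hq.trans hnq)))
    · exact hedge R hup (hn₁ n ((le_max_left _ _).trans (hq.trans hnq)))
    · have h1 := (Complex.abs_im_le_norm (w - w₀)).trans hw
      have h2 : (w - w₀).im = w.im - ε₀ := by simp [hw₀]
      rw [h2, abs_le] at h1
      constructor <;> linarith [h1.1, h1.2]
  obtain ⟨j, l, hj, hclose, hsep⟩ := exists_separated_orbit hg x x₀
  set J := ⌊R * q / 8⌋₊ with hJ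
  have hJle : (J : ℝ) ≤ R * q / 8 := Nat.floor_le (by positivity)
  have hJlt : R * q / 8 < J + 1 := Nat.lt_floor_add_one _
  have hJpos : 0 < J := by
    have : (0 : ℝ) < J := by linarith
    exact_mod_cast this
  let y : ℕ → ℂ := fun i => ((x + j i * Φ - l i : ℝ) : ℂ) + ε₀ * Complex.I
  have hsmall : ∀ i, ‖F (y i)‖ ≤ Real.exp (-(K * q * δ)) := by
    intro i
    refine (hFle _).trans ?_
    have h1 : (y i).im = ε₀ := by simp [y]
    rw [h1, sub_self, mul_zero, add_zero]
    have h2 : y i = ((x + j i * Φ : ℝ) : ℂ) + ε₀ * Complex.I + ((-l i : ℤ) : ℂ) := by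
      simp only [y]; push_cast; ring
    rw [h2, hD.cprod_per_int]
    have h3 := norm_cprod_shift_le (Φ := Φ) hC0 hC hC' n (j i) q (hj i).le x
    calc _ ≤ 4 * Real.exp (3 * C * q) * Real.exp (n * (Λ - δ)) * Real.exp (-(n * Λ)) := by
          refine mul_le_mul_of_nonneg_right (h3.trans ?_) (Real.exp_nonneg _)
          exact mul_le_mul_of_nonneg_left hcon.le (by positivity)
      _ ≤ Real.exp (2 * q) * Real.exp (3 * C * q) * Real.exp (n * (Λ - δ)) *
            Real.exp (-(n * Λ)) := by
          gcongr
          have h4 := Real.add_one_le_exp (1 : ℝ)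
          have h5 : Real.exp 2 = Real.exp 1 * Real.exp 1 := by rw [← Real.exp_add]; norm_num
          have h6 : Real.exp 2 ≤ Real.exp (2 * q) := Real.exp_le_exp.2 (by linarith)
          nlinarith
      _ ≤ Real.exp (-(K * q * δ)) := by
          rw [← Real.exp_add, ← Real.exp_add, ← Real.exp_add, hnr]
          refine Real.exp_le_exp.2 ?_
          nlinarith
  have hmain := norm_center_le_of_small F hFd w₀ M (Real.exp (-(K * q * δ))) R hRpos hR1
    (Real.exp_nonneg _) hstrip J q hJpos hqpos y ?_ ?_ (fun i _ => hsmall i)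
  · have h1 : Real.exp (-(K * q * δ)) * Real.exp (4 * q) ≤ Real.exp (-(R * q / 16)) := by
      rw [← Real.exp_add]
      refine Real.exp_le_exp.2 ?_
      nlinarith
    have h2 : Real.exp (-(R * q / 16)) < 1 / 10 := by
      rw [Real.exp_neg, inv_lt_comm₀ (Real.exp_pos _) (by norm_num)]
      have := Real.add_one_le_exp (R * q / 16)
      norm_num; linarith
    have h3 : (1 / 3 : ℝ) ^ J ≤ 3 * Real.exp (-(R * q / 8)) := by
      have h4 : (1 / 3 : ℝ) ≤ Real.exp (-1) := by
        rw [Real.exp_neg, one_div]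
        exact inv_anti₀ (Real.exp_pos _) Real.exp_one_lt_three.le
      have h5 : (1 / 3 : ℝ) ^ J ≤ Real.exp (-J) := by
        refine (pow_le_pow_left₀ (by norm_num) h4 J).trans_eq ?_
        rw [← Real.exp_nat_mul]; congr 1; ring
      refine h5.trans ?_
      calc Real.exp (-J) ≤ Real.exp (1 + -(R * q / 8)) := Real.exp_le_exp.2 (by linarith)
        _ = Real.exp 1 * Real.exp (-(R * q / 8)) := Real.exp_add _ _
        _ ≤ _ := mul_le_mul_of_nonneg_right Real.exp_one_lt_three.le (Real.exp_nonneg _)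
    have h6 : (1 / 3 : ℝ) ^ J ≤ 1 := pow_le_one₀ (by norm_num) (by norm_num)
    have h7 : M * (1 / 3) ^ J ≤ 3 * Real.exp (-(R * q / 16)) := by
      calc M * (1 / 3) ^ J ≤ M * (3 * Real.exp (-(R * q / 8))) :=
            mul_le_mul_of_nonneg_left h3 (Real.exp_nonneg _)
        _ = 3 * Real.exp (-(R * q / 16)) := by
            rw [hM, mul_left_comm, ← Real.exp_add]; congr 2; ring
    have h8 : 0 ≤ Real.exp (-(K * q * δ)) * Real.exp (4 * q) := by positivity
    nlinarith [mul_le_mul_of_nonneg_left h6 h8]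
  · intro i hi
    have h1 : y i - w₀ = ((x + j i * Φ - l i - x₀ : ℝ) : ℂ) := by
      simp only [y, hw₀]; push_cast; ring
    rw [h1, Complex.norm_real, Real.norm_eq_abs]
    refine (hclose i).trans ?_
    rw [div_le_iff₀ (by linarith)]
    have h2 : (i : ℝ) + 1 ≤ J := by exact_mod_cast hi
    linarith
  · intro i _ k _
    have h1 : y i - y k = (((x + j i * Φ - l i) - (x + j k * Φ - l k) : ℝ) : ℂ) := by
      simp only [y]; push_cast; ring
    rw [h1, Complex.norm_real, Real.norm_eq_abs]
    exact hsep i k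

end IsReflCocycle

/-- The character `w ↦ e^{2πiw}`. -/
def ee (w : ℂ) : ℂ := Complex.exp (2 * Real.pi * Complex.I * w)

lemma ee_add (v w : ℂ) : ee (v + w) = ee v * ee w := by
  rw [ee, mul_add, Complex.exp_add, ee, ee]

lemma ee_nat_mul (n : ℕ) (w : ℂ) : ee (n * w) = ee w ^ n := by
  rw [ee, ee, ← Complex.exp_nat_mul]; ring_nf

lemma ee_neg (w : ℂ) : ee (-w) = (ee w)⁻¹ := by
  rw [ee, ee, ← Complex.exp_neg]; ring_nf

lemma ee_one : ee 1 = 1 := by rw [ee, mul_one, Complex.exp_two_pi_mul_I]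

lemma norm_ee (w : ℂ) : ‖ee w‖ = Real.exp (-(2 * Real.pi * w.im)) := by
  rw [ee, Complex.norm_exp]
  simp

lemma ee_isPrimitiveRoot {p : ℤ} {q : ℕ} (hq : 0 < q) (hpq : IsCoprime p (q : ℤ)) :
    IsPrimitiveRoot (ee ((p / q : ℝ) : ℂ)) q := by
  have hq' : (q : ℂ) ≠ 0 := by exact_mod_cast hq.ne'
  have h1 : IsPrimitiveRoot (Complex.exp (2 * Real.pi * Complex.I / q)) q :=
    Complex.isPrimitiveRoot_exp q hq.ne'
  have h2 : ee ((p / q : ℝ) : ℂ) = Complex.exp (2 * Real.pi * Complex.I / q) ^ p := by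
    rw [ee, ← Complex.exp_int_mul]
    push_cast
    congr 1
    field_simp
  rw [h2]
  exact h1.zpow_of_gcd_eq_one p (Int.isCoprime_iff_gcd_eq_one.1 hpq)

/-- Evaluation of a matrix of polynomials. -/
def evalM (ζ : ℂ) : Matrix (Fin 2) (Fin 2) (Polynomial ℂ) →+* Mat2 :=
  (Polynomial.evalRingHom ζ).mapMatrix

lemma evalM_trace (ζ : ℂ) (A : Matrix (Fin 2) (Fin 2) (Polynomial ℂ)) :
    (evalM ζ A).trace = A.trace.eval ζ := by
  simp [evalM, Matrix.trace_fin_two]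

/-- The product of the matrix polynomials `ζ ↦ T(ρⁱζ)`, `i < n`. -/
def polyProd (T : Matrix (Fin 2) (Fin 2) (Polynomial ℂ)) (ρ : ℂ) :
    ℕ → Matrix (Fin 2) (Fin 2) (Polynomial ℂ)
  | 0 => 1
  | n + 1 => T.map (fun P => P.comp (Polynomial.C (ρ ^ n) * Polynomial.X)) * polyProd T ρ n

section PolynomialCocycle

variable {T : Matrix (Fin 2) (Fin 2) (Polynomial ℂ)}

lemma evalM_polyProd_succ (ρ : ℂ) (n : ℕ) (ζ : ℂ) :
    evalM ζ (polyProd T ρ (n + 1)) = evalM (ρ ^ n * ζ) T * evalM ζ (polyProd T ρ n) := by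
  rw [polyProd, map_mul]
  congr 1
  ext i j
  simp [evalM]

lemma evalM_polyProd_succ' (ρ : ℂ) (n : ℕ) (ζ : ℂ) :
    evalM ζ (polyProd T ρ (n + 1)) = evalM (ρ * ζ) (polyProd T ρ n) * evalM ζ T := by
  induction n with
  | zero => rw [evalM_polyProd_succ]; simp [polyProd]
  | succ n ih => rw [evalM_polyProd_succ, ih, evalM_polyProd_succ, Matrix.mul_assoc]; ring_nf

lemma evalM_polyProd_zero (ρ : ℂ) (n : ℕ) :
    evalM 0 (polyProd T ρ n) = evalM 0 T ^ n := by
  induction n with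
  | zero => simp [polyProd]
  | succ n ih => rw [evalM_polyProd_succ, ih, mul_zero, pow_succ']

lemma cprod_eq_smul_polyProd {D : ℂ → Mat2} (hT : ∀ w, D w = (ee w)⁻¹ • evalM (ee w) T) (Φ : ℝ)
    (n : ℕ) (w : ℂ) :
    ∃ u : ℂ, ‖u‖ = Real.exp (2 * Real.pi * n * w.im) ∧
      cprod D Φ n w = u • evalM (ee w) (polyProd T (ee Φ) n) := by
  induction n with
  | zero => exact ⟨1, by simp, by simp [cprod, polyProd]⟩
  | succ n ih =>
    obtain ⟨u, hu, h⟩ := ih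
    refine ⟨(ee (w + n * Φ))⁻¹ * u, ?_, ?_⟩
    · rw [norm_mul, norm_inv, norm_ee, hu, ← Real.exp_neg, ← Real.exp_add]
      congr 1
      simp
      ring
    · rw [cprod, h, evalM_polyProd_succ, hT, ← ee_nat_mul, ← ee_add, add_comm w]
      rw [Matrix.smul_mul, Matrix.mul_smul, smul_smul]

lemma trace_polyProd_rotate {ρ : ℂ} {q : ℕ} (hq : 0 < q) (hρ : ρ ^ q = 1) (ζ : ℂ) :
    (polyProd T ρ q).trace.eval (ρ * ζ) = (polyProd T ρ q).trace.eval ζ := by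
  obtain ⟨n, rfl⟩ : ∃ n, q = n + 1 := ⟨q - 1, by omega⟩
  rw [← evalM_trace, ← evalM_trace, evalM_polyProd_succ, evalM_polyProd_succ',
    Matrix.trace_mul_comm, ← mul_assoc, ← pow_succ, hρ, one_mul]

lemma exists_trace_polyProd_eq {ρ : ℂ} {q : ℕ} (hq : 0 < q) (hρ : IsPrimitiveRoot ρ q) :
    ∃ R : Polynomial ℂ, (polyProd T ρ q).trace =
      Polynomial.C ((polyProd T ρ q).trace.eval 0) + Polynomial.X ^ q * R := by
  set Q := (polyProd T ρ q).trace with hQ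
  have h1 : Q.comp (Polynomial.C ρ * Polynomial.X) = Q := by
    refine Polynomial.funext fun ζ => ?_
    simp only [Polynomial.eval_comp, Polynomial.eval_mul, Polynomial.eval_C, Polynomial.eval_X]
    exact trace_polyProd_rotate hq hρ.pow_eq_one ζ
  have h2 : Polynomial.X ^ q ∣ Q - Polynomial.C (Q.eval 0) := by
    rw [Polynomial.X_pow_dvd_iff]
    intro d hd
    rcases Nat.eq_zero_or_pos d with rfl | hd0
    · simp [Polynomial.coeff_zero_eq_eval_zero]
    · have h3 : Q.coeff d * ρ ^ d = Q.coeff d := by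
        conv_rhs => rw [← h1]
        rw [Polynomial.comp_C_mul_X_coeff]
      have h4 : ρ ^ d ≠ 1 := hρ.pow_ne_one_of_pos_of_lt hd0.ne' hd
      have h5 : Q.coeff d = 0 := by
        have : Q.coeff d * (ρ ^ d - 1) = 0 := by rw [mul_sub, h3]; ring
        exact (mul_eq_zero.1 this).resolve_right (sub_ne_zero.2 h4)
      simp [h5, Polynomial.coeff_C, hd0.ne']
  obtain ⟨R, hR⟩ := h2
  exact ⟨R, by rw [← hR]; ring⟩

lemma polynomial_norm_le (R : Polynomial ℂ) {C : ℝ} (h : ∀ x : ℝ, ‖R.eval (ee x)‖ ≤ C) {ζ : ℂ}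
    (hζ : ‖ζ‖ ≤ 1) : ‖R.eval ζ‖ ≤ C := by
  refine Complex.norm_le_of_forall_mem_frontier_norm_le (f := fun ζ => R.eval ζ)
    (Metric.isBounded_ball (x := (0 : ℂ)) (r := 1)) R.differentiable.diffContOnCl
    (fun w hw => ?_) ?_
  · rw [frontier_ball _ one_ne_zero, mem_sphere_zero_iff_norm] at hw
    have : w = ee ((w.arg / (2 * Real.pi) : ℝ) : ℂ) := by
      conv_lhs => rw [← Complex.norm_mul_exp_arg_mul_I w, hw]
      rw [ee]
      have := Complex.ofReal_ne_zero.2 Real.pi_ne_zero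
      push_cast
      rw [one_mul]
      congr 1
      field_simp
    rw [this]
    exact h _
  · rw [closure_ball _ one_ne_zero]
    simpa using hζ

/-- For a rational frequency, the trace over a period grows in the imaginary direction at most
through its lowest Laurent coefficient. -/
lemma IsReflCocycle.norm_trace_le {D : ℂ → Mat2} (hD : IsReflCocycle D)
    (hT : ∀ w, D w = (ee w)⁻¹ • evalM (ee w) T)
    {p : ℤ} {q : ℕ} (hq : 0 < q) (hpq : IsCoprime p (q : ℤ)) {ε : ℝ} (hε : 0 ≤ ε) :
    ‖(cprod D (p / q) q (ε * Complex.I)).trace‖ ≤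
      2 * supN D (p / q) q 0 + ‖(evalM 0 T ^ q).trace‖ +
        ‖(evalM 0 T ^ q).trace‖ * Real.exp (2 * Real.pi * q * ε) := by
  have hρ := ee_isPrimitiveRoot hq hpq
  set ρ := ee ((p / q : ℝ) : ℂ)
  obtain ⟨R, hR⟩ := exists_trace_polyProd_eq (T := T) hq hρ
  rw [← evalM_trace 0, evalM_polyProd_zero] at hR
  set c := (evalM 0 T ^ q).trace
  have hev : ∀ ζ, ((polyProd T ρ q).trace).eval ζ = c + ζ ^ q * R.eval ζ := by
    intro ζ; rw [hR]; simp
  have htr : ∀ w : ℂ, ‖(cprod D (p / q) q w).trace‖ =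
      Real.exp (2 * Real.pi * q * w.im) * ‖c + (ee w) ^ q * R.eval (ee w)‖ := by
    intro w
    obtain ⟨u, hu, h⟩ := cprod_eq_smul_polyProd hT (p / q) q w
    rw [h, Matrix.trace_smul, evalM_trace, hev, norm_smul, hu]
  have hb : ∀ x : ℝ, ‖R.eval (ee x)‖ ≤ 2 * supN D (p / q) q 0 + ‖c‖ := by
    intro x
    have h1 := htr x
    have h2 := hD.norm_le_supN (p / q) q 0 x
    have h3 := mat2_trace_le (cprod D (p / q) q x)
    have hn : ‖ee (x : ℂ)‖ = 1 := by simp [norm_ee]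
    simp only [Complex.ofReal_im, mul_zero, Real.exp_zero, one_mul] at h1
    simp only [Complex.ofReal_zero, zero_mul, add_zero] at h2
    have h4 : ‖R.eval (ee x)‖ = ‖ee (x : ℂ) ^ q * R.eval (ee x)‖ := by
      rw [norm_mul, norm_pow, hn, one_pow, one_mul]
    have h5 := norm_sub_le (c + ee (x : ℂ) ^ q * R.eval (ee x)) c
    rw [add_sub_cancel_left, ← h4] at h5
    linarith
  have hz : ‖ee (ε * Complex.I)‖ = Real.exp (-(2 * Real.pi * ε)) := by simp [norm_ee]
  have hz1 : ‖ee (ε * Complex.I)‖ ≤ 1 := by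
    rw [hz, Real.exp_le_one_iff]
    have := Real.pi_pos
    have : 0 ≤ 2 * Real.pi * ε := by positivity
    linarith
  have h6 := polynomial_norm_le R hb hz1
  rw [htr]
  have h7 : Real.exp (2 * Real.pi * q * ((ε : ℂ) * Complex.I).im) *
      ‖ee (ε * Complex.I)‖ ^ q = 1 := by
    rw [hz, ← Real.exp_nat_mul, ← Real.exp_add, Real.exp_eq_one_iff]
    simp
    ring
  have h8 : ((ε : ℂ) * Complex.I).im = ε := by simp
  rw [h8] at h7 ⊢
  calc _ ≤ Real.exp (2 * Real.pi * q * ε) *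
          (‖c‖ + ‖ee (ε * Complex.I)‖ ^ q * ‖R.eval (ee (ε * Complex.I))‖) := by
        gcongr
        refine (norm_add_le _ _).trans ?_
        rw [norm_mul, norm_pow]
    _ = ‖R.eval (ee (ε * Complex.I))‖ + ‖c‖ * Real.exp (2 * Real.pi * q * ε) := by
        rw [mul_add, ← mul_assoc, h7]; ring
    _ ≤ _ := by gcongr

lemma log_norm_eval_le_integral (Q : Polynomial ℂ) (h0 : Q.eval 0 ≠ 0) :
    IntervalIntegrable (fun x : ℝ => Real.log ‖Q.eval (ee x)‖) volume 0 1 ∧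
      Real.log ‖Q.eval 0‖ ≤ ∫ x in (0 : ℝ)..1, Real.log ‖Q.eval (ee x)‖ := by
  have han : ∀ s, AnalyticOnNhd ℂ (fun ζ => Q.eval ζ) s := fun s =>
    (Differentiable.differentiableOn Q.differentiable).analyticOnNhd isOpen_univ
      |>.mono (Set.subset_univ s)
  have hinteg : CircleIntegrable (fun ζ => Real.log ‖Q.eval ζ‖) 0 1 :=
    (han _).meromorphicOn.circleIntegrable_log_norm
  have hpi : 2 * Real.pi ≠ 0 := by positivity
  have hcm : ∀ x : ℝ, circleMap 0 1 (2 * Real.pi * x) = ee x := by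
    intro x; simp [circleMap, ee]; ring_nf
  constructor
  · have h1 : IntervalIntegrable (fun θ => Real.log ‖Q.eval (circleMap 0 1 θ)‖) volume 0
        (2 * Real.pi) := hinteg
    have h2 := h1.comp_mul_left (c := 2 * Real.pi)
    simp only [hcm, zero_div, div_self hpi] at h2
    exact h2
  · have h1 := (han (Metric.closedBall 0 |1|)).circleAverage_log_norm one_ne_zero h0
    have h2 : Real.circleAverage (fun ζ => Real.log ‖Q.eval ζ‖) 0 1 =
        ∫ x in (0 : ℝ)..1, Real.log ‖Q.eval (ee x)‖ := by
      have h3 := intervalIntegral.integral_comp_mul_left (a := 0) (b := 1)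
        (fun θ => Real.log ‖Q.eval (circleMap 0 1 θ)‖) hpi
      simp only [hcm] at h3
      rw [h3, Real.circleAverage]
      simp
    rw [← h2, h1]
    have h4 : 0 ≤ ∑ᶠ u,
        (MeromorphicOn.divisor (fun ζ => Q.eval ζ) (Metric.closedBall 0 |1|) u : ℝ) *
          Real.log (1 * ‖0 - u‖⁻¹) := by
      refine finsum_nonneg fun u => ?_
      by_cases hu : u ∈ Metric.closedBall (0 : ℂ) |1|
      · refine mul_nonneg ?_ ?_
        · exact_mod_cast (MeromorphicOn.AnalyticOnNhd.divisor_nonneg (han _)) u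
        · rw [one_mul, zero_sub, norm_neg]
          rcases eq_or_ne u 0 with rfl | hu0
          · simp
          refine Real.log_nonneg ?_
          rw [one_le_inv₀ (norm_pos_iff.2 hu0)]
          simpa using hu
      · rw [Function.locallyFinsuppWithin.apply_eq_zero_of_notMem _ hu]
        simp
    linarith

end PolynomialCocycle

namespace IsReflCocycle

variable {D : ℂ → Mat2}

lemma log_det_strip (hD : IsReflCocycle D) {δ : ℝ} (hδ : 0 < δ) :
    ∃ η > 0, ∀ ε : ℝ, |ε| ≤ η → ∀ x : ℝ, (D (x + ε * Complex.I)).det ≠ 0 ∧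
      |Real.log ‖(D (x + ε * Complex.I)).det‖ - Real.log ‖(D x).det‖| ≤ δ := by
  have hc : Continuous fun w : ℂ => ‖(D w).det‖ := hD.continuous.matrix_det.norm
  have hc' : Continuous fun w : ℂ => ‖(D (w.re : ℂ)).det‖ :=
    hc.comp (by fun_prop : Continuous fun w : ℂ => (w.re : ℂ))
  set U : Set ℂ := {w | Real.exp (-δ) * ‖(D (w.re : ℂ)).det‖ < ‖(D w).det‖ ∧
    ‖(D w).det‖ < Real.exp δ * ‖(D (w.re : ℂ)).det‖} with hU
  have hUo : IsOpen U :=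
    (isOpen_lt (continuous_const.mul hc') hc).inter (isOpen_lt hc (continuous_const.mul hc'))
  obtain ⟨η, hη, H⟩ := exists_strip_subset hUo (fun w k hw => by
      simpa [hU, hD.per_int] using hw) 0 (fun x => by
      have h0 : 0 < ‖(D x).det‖ := norm_pos_iff.2 (hD.det_ne x)
      simp only [hU, Set.mem_ofPred_eq, Complex.ofReal_zero, zero_mul, add_zero, Complex.ofReal_re]
      constructor
      · have : Real.exp (-δ) < 1 := Real.exp_lt_one_iff.2 (by linarith)
        nlinarith
      · have : 1 < Real.exp δ := Real.one_lt_exp_iff.2 hδ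
        nlinarith)
  refine ⟨η, hη, fun ε hε x => ?_⟩
  have h0 : 0 < ‖(D x).det‖ := norm_pos_iff.2 (hD.det_ne x)
  obtain ⟨h1, h2⟩ := H (x + ε * Complex.I) (by simpa using hε)
  have hre : ((x : ℂ) + ε * Complex.I).re = x := by simp
  rw [hre] at h1 h2
  have hpos : 0 < ‖(D (x + ε * Complex.I)).det‖ := lt_trans (by positivity) h1
  refine ⟨norm_pos_iff.1 hpos, abs_le.2 ⟨?_, ?_⟩⟩
  · have := Real.log_le_log (by positivity) h1.le
    rw [Real.log_mul (Real.exp_pos _).ne' h0.ne', Real.log_exp] at this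
    linarith
  · have := Real.log_le_log hpos h2.le
    rw [Real.log_mul (Real.exp_pos _).ne' h0.ne', Real.log_exp] at this
    linarith

/-- Determinants of long products near the real line grow at the rate of their mean. -/
lemma norm_det_cprod_close (hD : IsReflCocycle D) {c : ℝ}
    (hc : ∫ x in (0 : ℝ)..1, Real.log ‖(D x).det‖ = 2 * c) {δ : ℝ} (hδ : 0 < δ) :
    ∃ η > 0, ∃ q₀ : ℕ, ∀ (p : ℤ) (q : ℕ), q₀ ≤ q → 0 < q → IsCoprime p (q : ℤ) → ∀ Ψ : ℝ,
      (∀ x : ℝ, ∀ j < q, |x + j * Ψ - (x + j * (p / q : ℝ))| ≤ 1 / q) →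
      ∀ ε : ℝ, |ε| ≤ η → ∀ (K : ℕ) (x : ℝ),
        Real.exp ((K * q : ℕ) * (2 * c - δ)) ≤ ‖(cprod D Ψ (K * q) (x + ε * Complex.I)).det‖ ∧
        ‖(cprod D Ψ (K * q) (x + ε * Complex.I)).det‖ ≤ Real.exp ((K * q : ℕ) * (2 * c + δ)) := by
  obtain ⟨η, hη, H⟩ := hD.log_det_strip (half_pos hδ)
  have hcont : Continuous fun x : ℝ => Real.log ‖(D x).det‖ := by
    have : Continuous fun x : ℝ => D x := hD.continuous.comp (by fun_prop)
    exact this.matrix_det.norm.log fun x => norm_ne_zero_iff.2 (hD.det_ne x)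
  obtain ⟨q₀, hq₀⟩ := sum_rotation_close (h := fun x : ℝ => Real.log ‖(D x).det‖)
    (fun x => by push_cast; rw [hD.per]) hcont (half_pos hδ)
  refine ⟨η, hη, q₀, fun p q hq hq0 hpq Ψ hΨ ε hε K => ?_⟩
  have hblock : ∀ x : ℝ, |Real.log ‖(cprod D Ψ q (x + ε * Complex.I)).det‖ - q * (2 * c)| ≤ q * δ ∧
      0 < ‖(cprod D Ψ q (x + ε * Complex.I)).det‖ := by
    intro x
    have h1 := hq₀ p q hq hq0 hpq x (fun j => x + j * Ψ) (fun j hj => hΨ x j hj)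
    rw [hc] at h1
    have hsh : ∀ j : ℕ, ((x : ℂ) + ε * Complex.I + j * Ψ) =
        ((x + j * Ψ : ℝ) : ℂ) + ε * Complex.I := by
      intro j; push_cast; ring
    have hne : ∀ j ∈ Finset.range q, ‖(D (x + ε * Complex.I + j * Ψ)).det‖ ≠ 0 := by
      intro j _
      rw [hsh]
      exact norm_ne_zero_iff.2 (H ε hε _).1
    rw [cprod_det, norm_prod]
    refine ⟨?_, Finset.prod_pos fun j hj => lt_of_le_of_ne (norm_nonneg _) (hne j hj).symm⟩
    rw [Real.log_prod hne]
    have h2 : |∑ j ∈ Finset.range q, (Real.log ‖(D (x + ε * Complex.I + j * Ψ)).det‖ -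
        Real.log ‖(D ((x + j * Ψ : ℝ) : ℂ)).det‖)| ≤ q * (δ / 2) := by
      refine (Finset.abs_sum_le_sum_abs _ _).trans ?_
      refine (Finset.sum_le_card_nsmul _ _ (δ / 2) fun j _ => ?_).trans_eq (by simp)
      rw [hsh]
      exact (H ε hε _).2
    rw [Finset.sum_sub_distrib] at h2
    rw [abs_le] at h1 h2 ⊢
    constructor <;> linarith [h1.1, h1.2, h2.1, h2.2]
  induction K with
  | zero => intro x; simp [cprod]
  | succ K ih =>
    intro x
    have h1 := ih x
    have h2 := hblock (x + (K * q : ℕ) * Ψ)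
    have hsh : ((x + (K * q : ℕ) * Ψ : ℝ) : ℂ) + ε * Complex.I =
        (x + ε * Complex.I) + (K * q : ℕ) * Ψ := by push_cast; ring
    rw [hsh] at h2
    rw [show (K + 1) * q = q + K * q by ring, cprod_add, Matrix.det_mul, norm_mul]
    obtain ⟨h3, h4⟩ := h2
    rw [abs_le] at h3
    have e1 : ∀ a : ℝ, Real.exp ((q + K * q : ℕ) * a) =
        Real.exp (q * a) * Real.exp ((K * q : ℕ) * a) := by
      intro a; rw [← Real.exp_add]; push_cast; ring_nf
    rw [e1, e1]
    have h5 := (Real.le_log_iff_exp_le h4).1 (show q * (2 * c - δ) ≤ _ by linarith [h3.1])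
    have h6 := (Real.log_le_iff_le_exp h4).1 (show _ ≤ q * (2 * c + δ) by linarith [h3.2])
    exact ⟨mul_le_mul h5 h1.1 (Real.exp_nonneg _) (norm_nonneg _),
      mul_le_mul h6 h1.2 (norm_nonneg _) (Real.exp_nonneg _)⟩

/-- Open conditions on a line persist under small changes of the frequency. -/
lemma eventually_forall_line {U : Set (ℝ × ℂ)} (hU : IsOpen U)
    (hper : ∀ Ψ w (k : ℤ), (Ψ, w) ∈ U → (Ψ, w + k) ∈ U) {Φ ε : ℝ}
    (h : ∀ x : ℝ, (Φ, (x + ε * Complex.I : ℂ)) ∈ U) :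
    ∀ᶠ Ψ in nhds Φ, ∀ x : ℝ, (Ψ, (x + ε * Complex.I : ℂ)) ∈ U := by
  have hK : IsCompact (Set.Icc (0 : ℝ) 1) := isCompact_Icc
  have h1 : ∀ x ∈ Set.Icc (0 : ℝ) 1, ∀ᶠ a : ℝ × ℝ in nhds Φ ×ˢ nhds x,
      (a.1, (a.2 + ε * Complex.I : ℂ)) ∈ U := by
    intro x _
    have hc : Continuous fun a : ℝ × ℝ => (a.1, (a.2 + ε * Complex.I : ℂ)) := by fun_prop
    rw [← nhds_prod_eq]
    exact hc.continuousAt.eventually_mem (hU.mem_nhds (h x))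
  have h2 := hK.eventually_forall_of_forall_eventually (x₀ := Φ)
    (P := fun Ψ x => (Ψ, (x + ε * Complex.I : ℂ)) ∈ U) (fun x hx => by
      have := h1 x hx
      rwa [← nhds_prod_eq] at this)
  filter_upwards [h2] with Ψ hΨ x
  have h3 := hper Ψ _ ⌊x⌋ (hΨ (Int.fract x) ⟨Int.fract_nonneg _, (Int.fract_lt_one _).le⟩)
  convert h3 using 2
  have : (x : ℂ) = ((Int.fract x : ℝ) : ℂ) + (⌊x⌋ : ℤ) := by
    conv_lhs => rw [← Int.fract_add_floor x]
    push_cast; rfl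
  rw [this]
  ring

lemma eventually_le_norm_cprod (hD : IsReflCocycle D) {Φ ε a b : ℝ} {n : ℕ} (hab : b < a)
    (h : ∀ x : ℝ, a ≤ ‖cprod D Φ n (x + ε * Complex.I)‖) :
    ∀ᶠ Ψ in nhds Φ, ∀ x : ℝ, b ≤ ‖cprod D Ψ n (x + ε * Complex.I)‖ := by
  have := eventually_forall_line (U := {a : ℝ × ℂ | b < ‖cprod D a.1 n a.2‖})
    (isOpen_lt continuous_const (hD.continuous_cprod n).norm)
    (fun Ψ w k hw => by simpa [hD.cprod_per_int] using hw) (fun x => hab.trans_le (h x))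
  exact this.mono fun Ψ hΨ x => (hΨ x).le

lemma eventually_norm_cprod_le (hD : IsReflCocycle D) {Φ ε a b : ℝ} {n : ℕ} (hab : a < b)
    (h : ∀ x : ℝ, ‖cprod D Φ n (x + ε * Complex.I)‖ ≤ a) :
    ∀ᶠ Ψ in nhds Φ, ∀ x : ℝ, ‖cprod D Ψ n (x + ε * Complex.I)‖ ≤ b := by
  have := eventually_forall_line (U := {a : ℝ × ℂ | ‖cprod D a.1 n a.2‖ < b})
    (isOpen_lt (hD.continuous_cprod n).norm continuous_const)
    (fun Ψ w k hw => by simpa [hD.cprod_per_int] using hw) (fun x => (h x).trans_lt hab)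
  exact this.mono fun Ψ hΨ x => (hΨ x).le

lemma eventually_norm_det_cprod_le (hD : IsReflCocycle D) {Φ ε a b : ℝ} {n : ℕ} (hab : a < b)
    (h : ∀ x : ℝ, ‖(cprod D Φ n (x + ε * Complex.I)).det‖ ≤ a) :
    ∀ᶠ Ψ in nhds Φ, ∀ x : ℝ, ‖(cprod D Ψ n (x + ε * Complex.I)).det‖ ≤ b := by
  have := eventually_forall_line (U := {a : ℝ × ℂ | ‖(cprod D a.1 n a.2).det‖ < b})
    (isOpen_lt (hD.continuous_cprod n).matrix_det.norm continuous_const)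
    (fun Ψ w k hw => by simpa [hD.cprod_per_int] using hw) (fun x => (h x).trans_lt hab)
  exact this.mono fun Ψ hΨ x => (hΨ x).le

/-- Upper semicontinuity of the growth rate in the frequency. -/
lemma eventually_supN_le_freq (hD : IsReflCocycle D) (Φ : ℝ) {δ : ℝ} (hδ : 0 < δ) :
    ∃ C > 0, ∀ᶠ Ψ in nhds Φ, ∀ n : ℕ,
      supN D Ψ n 0 ≤ C * Real.exp (n * (growth D Φ 0 + δ)) := by
  set L := growth D Φ 0
  obtain ⟨n₀, hn₀⟩ := hD.eventually_supN_le Φ 0 (half_pos hδ)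
  set m := n₀ + 1
  have hm : supN D Φ m 0 ≤ Real.exp (m * (L + δ / 2)) := hn₀ m (by omega)
  have hmpos : (0 : ℝ) < m := by positivity
  obtain ⟨B₀, hB₀⟩ := hD.exists_bound 0 1 0 0
  set B := max B₀ 1
  have hB1 : 1 ≤ B := le_max_right _ _
  have hB : ∀ Ψ : ℝ, ∀ r : ℕ, supN D Ψ r 0 ≤ 2 * B ^ r := by
    intro Ψ r
    have h1 : supN D Ψ 1 0 ≤ B := by
      refine ciSup_le fun x => le_max_of_le_left ?_
      rw [cprod_one, ← cprod_one D 0]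
      exact hB₀ _ (by simp)
    induction r with
    | zero =>
      refine ciSup_le fun x => ?_
      simpa [cprod] using mat2_norm_one_le
    | succ r ih =>
      refine (hD.supN_add_le Ψ r 1 0).trans ?_
      rw [pow_succ, ← mul_assoc]
      exact mul_le_mul ih h1 (hD.supN_pos _ _ _).le (by positivity)
  refine ⟨2 * B ^ m * Real.exp (m * |L + δ|), by positivity, ?_⟩
  have hev := hD.eventually_norm_cprod_le (Φ := Φ) (ε := 0) (n := m)
    (Real.exp_lt_exp.2 (show (m : ℝ) * (L + δ / 2) < m * (L + δ) by nlinarith))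
    (fun x => (hD.norm_le_supN Φ m 0 x).trans hm)
  filter_upwards [hev] with Ψ hΨ n
  have h2 : supN D Ψ m 0 ≤ Real.exp (m * (L + δ)) := ciSup_le hΨ
  have h3 : ∀ a r : ℕ, supN D Ψ (a * m + r) 0 ≤ Real.exp (m * (L + δ)) ^ a * (2 * B ^ r) := by
    intro a r
    induction a with
    | zero => simpa using hB Ψ r
    | succ a ih =>
      rw [show (a + 1) * m + r = m + (a * m + r) by ring, pow_succ', mul_assoc]
      exact (hD.supN_add_le Ψ _ _ 0).trans
        (mul_le_mul h2 ih (hD.supN_pos _ _ _).le (Real.exp_nonneg _))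
  have h4 := h3 (n / m) (n % m)
  rw [Nat.div_add_mod'] at h4
  refine h4.trans ?_
  have hmod : n % m ≤ m := (Nat.mod_lt _ (by omega)).le
  have hn : (n : ℝ) = (n / m : ℕ) * m + (n % m : ℕ) := by
    exact_mod_cast (Nat.div_add_mod' n m).symm
  have h5 : B ^ (n % m) ≤ B ^ m := pow_le_pow_right₀ hB1 hmod
  have h6 : Real.exp (m * (L + δ)) ^ (n / m) ≤
      Real.exp (m * |L + δ|) * Real.exp (n * (L + δ)) := by
    rw [← Real.exp_nat_mul, ← Real.exp_add, Real.exp_le_exp, hn]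
    have h7 : -((n % m : ℕ) * (L + δ)) ≤ m * |L + δ| := by
      have : ((n % m : ℕ) : ℝ) ≤ m := by exact_mod_cast hmod
      calc -((n % m : ℕ) * (L + δ)) ≤ |((n % m : ℕ) * (L + δ))| := neg_le_abs _
        _ = (n % m : ℕ) * |L + δ| := by rw [abs_mul, Nat.abs_cast]
        _ ≤ _ := by gcongr
    linarith
  calc _ ≤ (Real.exp (m * |L + δ|) * Real.exp (n * (L + δ))) * (2 * B ^ m) := by gcongr
    _ = _ := by ring

end IsReflCocycle

lemma mat2_exists_eigen (A : Mat2) : ∃ (μ ν : ℂ) (v : Col2), μ + ν = A.trace ∧ μ * ν = A.det ∧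
    ‖ν‖ ≤ ‖μ‖ ∧ v ≠ 0 ∧ A * v = μ • v := by
  have key : ∀ μ ν : ℂ, μ + ν = A.trace → μ * ν = A.det → ∃ v : Col2, v ≠ 0 ∧ A * v = μ • v := by
    intro μ ν h1 h2
    have h3 : (A - Matrix.scalar (Fin 2) μ).det = 0 := by
      rw [Matrix.trace_fin_two] at h1
      rw [Matrix.det_fin_two] at h2 ⊢
      simp only [Matrix.sub_apply, Matrix.scalar_apply, Matrix.diagonal_apply_eq, ne_eq,
        zero_ne_one, not_false_eq_true, Matrix.diagonal_apply_ne, one_ne_zero]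
      linear_combination -h2 + μ * h1
    obtain ⟨v, hv, h⟩ := Matrix.exists_mulVec_eq_zero_iff.2 h3
    refine ⟨Matrix.of fun i _ => v i, ?_, ?_⟩
    · intro h0
      refine hv (funext fun i => ?_)
      simpa using congrFun (congrFun h0 i) 0
    · ext i j
      have := congrFun h i
      simp only [Matrix.sub_mulVec, Matrix.scalar_apply, Pi.sub_apply, Matrix.mulVec_diagonal,
        Pi.zero_apply, sub_eq_zero] at this
      simpa [Matrix.mul_apply, Matrix.mulVec, dotProduct] using this
  obtain ⟨s, hs⟩ := IsAlgClosed.exists_pow_nat_eq (A.trace ^ 2 - 4 * A.det) (n := 2) (by norm_num)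
  have e1 : (A.trace + s) / 2 + (A.trace - s) / 2 = A.trace := by ring
  have e2 : (A.trace + s) / 2 * ((A.trace - s) / 2) = A.det := by linear_combination -hs / 4
  rcases le_total ‖(A.trace - s) / 2‖ ‖(A.trace + s) / 2‖ with h | h
  · obtain ⟨v, hv, hv'⟩ := key _ _ e1 e2
    exact ⟨_, _, v, e1, e2, h, hv, hv'⟩
  · rw [add_comm] at e1
    rw [mul_comm] at e2
    obtain ⟨v, hv, hv'⟩ := key _ _ e1 e2
    exact ⟨_, _, v, e1, e2, h, hv, hv'⟩

namespace IsReflCocycle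

variable {D : ℂ → Mat2}

/-- The growth of a Bloch eigenvector over a rational frequency controls the norms of finite
products. -/
lemma bloch_growth (hD : IsReflCocycle D) {p : ℤ} {q N : ℕ} (hq : 0 < q) {ε a b d s : ℝ}
    (ha : ∀ x : ℝ, a ≤ ‖cprod D (p / q) (N + N) (x + ε * Complex.I)‖)
    (hb : ∀ x : ℝ, ‖cprod D (p / q) N (x + ε * Complex.I)‖ ≤ b)
    (hd : ∀ x : ℝ, ‖(cprod D (p / q) N (x + ε * Complex.I)).det‖ ≤ d)
    (hdet : ∀ x : ℝ, (D (x + ε * Complex.I)).det ≠ 0)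
    {μ : ℂ} {v : Col2} (hv : v ≠ 0) (hμ : cprod D (p / q) q (ε * Complex.I) * v = μ • v)
    (hs : 0 < s) (hsq : s ^ q = ‖μ‖) : a * s ^ N ≤ b * (s ^ N * s ^ N) + b * d := by
  have hb0 : 0 ≤ b := (norm_nonneg _).trans (hb 0)
  have hqc : (q : ℂ) ≠ 0 := by exact_mod_cast hq.ne'
  set w : ℂ := ε * Complex.I
  have hline : ∀ j : ℕ, w + j * ((p / q : ℝ) : ℂ) = ((j * (p / q) : ℝ) : ℂ) + ε * Complex.I := by
    intro j; push_cast; ring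
  set V : ℕ → Col2 := fun j => cprod D (p / q) j w * v with hV
  have hVadd : ∀ i k : ℕ, V (i + k) = cprod D (p / q) i (w + k * ((p / q : ℝ) : ℂ)) * V k := by
    intro i k
    simp only [hV]
    rw [cprod_add, Matrix.mul_assoc]
  have hVper : ∀ j, V (j + q) = μ • V j := by
    intro j
    rw [hVadd]
    have h1 : w + q * ((p / q : ℝ) : ℂ) = w + p := by push_cast; field_simp
    rw [h1, hD.cprod_per_int]
    simp only [hV]
    rw [hμ, Matrix.mul_smul]
  have hVne : ∀ j, 0 < ‖V j‖ := by
    intro j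
    rw [norm_pos_iff]
    intro h0
    have h1 : (cprod D (p / q) j w).det ≠ 0 := by
      rw [cprod_det]
      refine Finset.prod_ne_zero_iff.2 fun i _ => ?_
      rw [hline]
      exact hdet _
    have h2 : (cprod D (p / q) j w).adjugate * V j = 0 := by rw [h0, Matrix.mul_zero]
    simp only [hV] at h2
    rw [← Matrix.mul_assoc, Matrix.adjugate_mul, Matrix.smul_mul, Matrix.one_mul] at h2
    exact hv ((smul_eq_zero.1 h2).resolve_left h1)
  set r : ℕ → ℝ := fun j => ‖V j‖ / s ^ j with hr
  have hrper : Function.Periodic r q := by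
    intro j
    simp only [hr]
    rw [hVper, col2_norm_smul, pow_add, hsq]
    have : ‖μ‖ ≠ 0 := by rw [← hsq]; positivity
    field_simp
  obtain ⟨j₀, -, hmax⟩ := Finset.exists_max_image (Finset.range q) r ⟨0, Finset.mem_range.2 hq⟩
  have hmax' : ∀ j, r j ≤ r j₀ := by
    intro j
    rw [← hrper.map_mod_nat j]
    exact hmax _ (Finset.mem_range.2 (Nat.mod_lt _ hq))
  obtain ⟨k, hk⟩ : ∃ k, j₀ + N * q = N + k :=
    ⟨j₀ + N * q - N, by have := Nat.le_mul_of_pos_right N hq; omega⟩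
  have hrk : r (N + k) = r j₀ := by rw [← hk]; exact hrper.nat_mul N j₀
  have hle : ∀ j, ‖V j‖ ≤ r j₀ * s ^ j := fun j => (div_le_iff₀ (by positivity)).1 (hmax' j)
  have hr0 : 0 < r j₀ := div_pos (hVne _) (by positivity)
  have heq : ‖V (N + k)‖ = r j₀ * s ^ (N + k) := by rw [← hrk]; simp only [hr]; field_simp
  have hkey := mat2_key_ineq (cprod D (p / q) N (w + (N + k : ℕ) * ((p / q : ℝ) : ℂ)))
    (cprod D (p / q) N (w + k * ((p / q : ℝ) : ℂ))) (V k)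
  have hsplit : cprod D (p / q) N (w + (N + k : ℕ) * ((p / q : ℝ) : ℂ)) *
      cprod D (p / q) N (w + k * ((p / q : ℝ) : ℂ)) =
      cprod D (p / q) (N + N) (w + k * ((p / q : ℝ) : ℂ)) := by
    rw [cprod_add]; congr 2; push_cast; ring
  rw [← hVadd, hsplit, ← hVadd, heq] at hkey
  rw [hline, hline] at hkey
  have h1 : r j₀ * s ^ (N + k) * a ≤ (r j₀ * s ^ (N + (N + k))) * b + b * d * (r j₀ * s ^ k) := by
    refine (mul_le_mul_of_nonneg_left (ha _) (by positivity)).trans (hkey.trans ?_)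
    have h2 := hd (k * (p / q))
    have hd0 : 0 ≤ d := (norm_nonneg _).trans h2
    refine add_le_add (mul_le_mul (hle _) (hb _) (norm_nonneg _) (by positivity)) ?_
    exact mul_le_mul (mul_le_mul (hb _) h2 (norm_nonneg _) hb0) (hle _) (norm_nonneg _)
      (by positivity)
  have hpos : 0 < r j₀ * s ^ k := by positivity
  refine le_of_mul_le_mul_left ?_ hpos
  calc _ = r j₀ * s ^ (N + k) * a := by ring
    _ ≤ _ := h1
    _ = _ := by ring

variable {T : Matrix (Fin 2) (Fin 2) (Polynomial ℂ)}

lemma exp_neg_one_le_half : Real.exp (-1) ≤ 1 / 2 := by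
  have := Real.add_one_le_exp (1 : ℝ)
  rw [Real.exp_neg, ← one_div]
  exact one_div_le_one_div_of_le two_pos (by linarith)

lemma exponent_lower {N L c σ δ κ : ℝ} (hN : 0 < N) (hNδ : 1 ≤ N * δ)
    (h : 2 * c + 2 * κ + 8 * δ ≤ L + σ)
    (hb : Real.exp (2 * N * (L - 2 * δ) + N * σ) ≤ Real.exp (N * (L + 2 * δ) + (N * σ + N * σ)) +
      Real.exp (N * (L + 2 * δ) + N * (2 * c + 2 * κ))) : L - 7 * δ ≤ σ := by
  by_contra! hcon
  set E := Real.exp (2 * N * (L - 2 * δ) + N * σ) with hE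
  have e1 : Real.exp (N * (L + 2 * δ) + (N * σ + N * σ)) ≤ Real.exp (-1) * E := by
    rw [hE, ← Real.exp_add, Real.exp_le_exp]
    have : N * (L - σ) ≥ N * (7 * δ) := mul_le_mul_of_nonneg_left (by linarith) hN.le
    linarith
  have e2 : Real.exp (N * (L + 2 * δ) + N * (2 * c + 2 * κ)) ≤
      Real.exp (-1) * (Real.exp (-1) * E) := by
    rw [hE, ← Real.exp_add, ← Real.exp_add, Real.exp_le_exp]
    have : N * (L + σ - 2 * c - 2 * κ - 6 * δ) ≥ N * (2 * δ) :=
      mul_le_mul_of_nonneg_left (by linarith) hN.le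
    linarith
  have e3 : Real.exp (-1) * E ≤ 1 / 2 * E :=
    mul_le_mul_of_nonneg_right exp_neg_one_le_half (Real.exp_nonneg _)
  have e4 : Real.exp (-1) * (Real.exp (-1) * E) ≤ 1 / 2 * (Real.exp (-1) * E) :=
    mul_le_mul_of_nonneg_right exp_neg_one_le_half (by positivity)
  have e5 : 0 < E := Real.exp_pos _
  linarith

set_option maxHeartbeats 1000000 in
/-- At a point of differentiability in a small strip the growth rate is at most its value on the
real line, provided the latter exceeds the rates of the lowest Laurent coefficient and of the
determinant. -/
lemma growth_le_growth_zero (hD : IsReflCocycle D)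
    (hT : ∀ w, D w = (ee w)⁻¹ • evalM (ee w) T) {Φ : ℝ} (hΦ : Irrational Φ) {m c κ ε ω C : ℝ}
    (hm0 : 0 < m) (hm : ∀ n, ‖(evalM 0 T ^ n).trace‖ ≤ 2 * m ^ n) (hε : 0 ≤ ε)
    (hmε : Real.log m + 2 * Real.pi * ε ≤ growth D Φ 0) (hκ : 0 < κ)
    (hc : c + 20 * κ ≤ growth D Φ 0)
    (hC : ∀ x : ℝ, Real.exp (-C) ≤ ‖(D (x + ε * Complex.I)).det‖)
    (hdet : ∃ q₀ : ℕ, ∀ (p : ℤ) (q : ℕ), q₀ ≤ q → 0 < q → IsCoprime p (q : ℤ) → ∀ Ψ : ℝ,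
      (∀ x : ℝ, ∀ j < q, |x + j * Ψ - (x + j * (p / q : ℝ))| ≤ 1 / q) → ∀ (K : ℕ) (x : ℝ),
        Real.exp ((K * q : ℕ) * (2 * c - κ)) ≤ ‖(cprod D Ψ (K * q) (x + ε * Complex.I)).det‖ ∧
        ‖(cprod D Ψ (K * q) (x + ε * Complex.I)).det‖ ≤ Real.exp ((K * q : ℕ) * (2 * c + κ)))
    (hder : HasDerivAt (growth D Φ) ω ε) : growth D Φ ε ≤ growth D Φ 0 := by
  set L := growth D Φ 0
  set L₂ := growth D Φ ε
  have hL : L ≤ L₂ := hD.growth_mono Φ (Set.mem_Ici.2 le_rfl) hε hε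
  by_contra! hlt
  obtain ⟨δ, hδ, hδκ, hδL⟩ : ∃ δ > 0, δ ≤ κ ∧ 9 * δ < L₂ - L := by
    refine ⟨min κ ((L₂ - L) / 10), lt_min hκ (by linarith), min_le_left _ _, ?_⟩
    have := min_le_right κ ((L₂ - L) / 10)
    linarith
  obtain ⟨q₀, hq₀⟩ := hdet
  obtain ⟨B, hB⟩ := hD.exists_bound Φ 1 ε ε
  obtain ⟨K, hK, q₁, hq₁⟩ := hD.exp_le_norm_cprod (C := max C (Real.log (max B 1)))
    (fun x => by
      have h1 := hB (x + ε * Complex.I) (by simp)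
      rw [cprod_one] at h1
      have hpos : 0 < max B 1 := lt_max_of_lt_right one_pos
      calc _ ≤ max B 1 := h1.trans (le_max_left _ _)
        _ = Real.exp (Real.log (max B 1)) := (Real.exp_log hpos).symm
        _ ≤ _ := Real.exp_le_exp.2 (le_max_right _ _))
    (fun x => (Real.exp_le_exp.2 (neg_le_neg (le_max_left _ _))).trans (hC x)) hder hδ
  obtain ⟨n₀, hn₀⟩ := hD.eventually_supN_le Φ ε hδ
  obtain ⟨n₁, hn₁⟩ := exists_nat_ge (1 / δ)
  obtain ⟨p', q', hq', hg'⟩ := exists_isGoodApprox hΦ (max (max q₀ q₁) (max n₀ n₁))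
  simp only [max_le_iff] at hq'
  set N := K * q' with hN
  have hNq : q' ≤ N := Nat.le_mul_of_pos_left _ hK
  have hq'0 := hg'.pos
  have hNpos : (0 : ℝ) < N := by exact_mod_cast (by omega : 0 < N)
  have hNδ : 1 ≤ N * δ := by
    have h1 : (n₁ : ℝ) ≤ N := by exact_mod_cast (by omega : n₁ ≤ N)
    rw [← div_le_iff₀ hδ]; linarith
  have hA : ∀ᶠ Ψ in nhds Φ, ∀ x : ℝ,
      Real.exp (2 * N * (L₂ - 2 * δ)) ≤ ‖cprod D Ψ (N + N) (x + ε * Complex.I)‖ := by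
    refine hD.eventually_le_norm_cprod (a := Real.exp ((2 * N : ℕ) * (L₂ - δ))) ?_ fun x => ?_
    · rw [Real.exp_lt_exp]; push_cast; nlinarith
    · rw [← two_mul]; exact hq₁ p' q' (by omega) hg' x
  have hBb : ∀ᶠ Ψ in nhds Φ, ∀ x : ℝ,
      ‖cprod D Ψ N (x + ε * Complex.I)‖ ≤ Real.exp (N * (L₂ + 2 * δ)) := by
    refine hD.eventually_norm_cprod_le (a := Real.exp (N * (L₂ + δ))) ?_ fun x =>
      (hD.norm_le_supN Φ N ε x).trans (hn₀ N (by omega))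
    rw [Real.exp_lt_exp]; nlinarith
  have hDd : ∀ᶠ Ψ in nhds Φ, ∀ x : ℝ,
      ‖(cprod D Ψ N (x + ε * Complex.I)).det‖ ≤ Real.exp (N * (2 * c + 2 * κ)) := by
    refine hD.eventually_norm_det_cprod_le (a := Real.exp (N * (2 * c + κ))) ?_ fun x =>
      (hq₀ p' q' (by omega) hq'0 hg'.coprime Φ (fun x j hj => hg'.abs_sub_le x j hj) K x).2
    rw [Real.exp_lt_exp]; nlinarith
  obtain ⟨S, hS, hSev⟩ := hD.eventually_supN_le_freq Φ hδ
  obtain ⟨τ, hτ, Hτ⟩ := Metric.eventually_nhds_iff.1 (hA.and (hBb.and (hDd.and hSev)))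
  obtain ⟨n₂, hn₂⟩ := exists_nat_ge (Real.log (2 * (2 * S + 4)) / δ)
  obtain ⟨n₃, hn₃⟩ := exists_nat_gt (1 / τ)
  obtain ⟨p, q, hq, hg⟩ := exists_isGoodApprox hΦ (max (max q₀ n₁) (max n₂ n₃))
  simp only [max_le_iff] at hq
  have hqpos := hg.pos
  have hqr : (0 : ℝ) < q := by exact_mod_cast hqpos
  have hq1 : (1 : ℝ) ≤ q := by exact_mod_cast hqpos
  have hclose : dist ((p / q : ℝ)) Φ < τ := by
    rw [dist_comm, Real.dist_eq]
    have h1 : (n₃ : ℝ) ≤ q := by exact_mod_cast (by omega : n₃ ≤ q)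
    have h2 : 1 / τ < q := hn₃.trans_le h1
    rw [div_lt_iff₀ hτ] at h2
    refine hg.close.trans_lt ?_
    rw [div_lt_iff₀ (by positivity)]
    nlinarith
  obtain ⟨h1, h2, h3, h4⟩ := Hτ hclose
  have hqδ : 1 ≤ q * δ := by
    have h1 : (n₁ : ℝ) ≤ q := by exact_mod_cast (by omega : n₁ ≤ q)
    rw [← div_le_iff₀ hδ]; linarith
  have hqS : 2 * (2 * S + 4) ≤ Real.exp (q * δ) := by
    rw [← Real.log_le_iff_le_exp (by positivity), ← div_le_iff₀ hδ]
    exact hn₂.trans (by exact_mod_cast (by omega : n₂ ≤ q))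
  have h5 := hq₀ p q (by omega) hqpos hg.coprime (p / q) (fun x j _ => by simp) 1 0
  rw [one_mul, Complex.ofReal_zero, zero_add] at h5
  obtain ⟨μ, ν, v, htr, hdt, hνμ, hv, hμv⟩ := mat2_exists_eigen (cprod D (p / q) q (ε * Complex.I))
  rw [← hdt, norm_mul] at h5
  have hμ0 : 0 < ‖μ‖ := by
    rcases (norm_nonneg μ).eq_or_lt with h | h
    · rw [← h, zero_mul] at h5
      exact absurd h5.1 (not_le.2 (Real.exp_pos _))
    · exact h
  set σ := Real.log ‖μ‖ / q with hσ
  have hμσ : ‖μ‖ = Real.exp (q * σ) := by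
    rw [hσ, mul_div_cancel₀ _ hqr.ne', Real.exp_log hμ0]
  have hσc : 2 * c - κ ≤ 2 * σ := by
    have h6 : Real.exp (q * (2 * c - κ)) ≤ Real.exp (q * (2 * σ)) := by
      refine h5.1.trans ?_
      calc ‖μ‖ * ‖ν‖ ≤ ‖μ‖ * ‖μ‖ := by gcongr
        _ = _ := by rw [hμσ, ← Real.exp_add]; ring_nf
    exact le_of_mul_le_mul_left (Real.exp_le_exp.1 h6) hqr
  have hbl := hD.bloch_growth hqpos h1 h2 h3
    (fun x => norm_pos_iff.1 ((Real.exp_pos _).trans_le (hC x)))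
    hv hμv (Real.exp_pos σ) (by rw [hμσ, Real.exp_nat_mul])
  simp only [← Real.exp_nat_mul, ← Real.exp_add] at hbl
  have hσL : L₂ - 7 * δ ≤ σ := by
    exact exponent_lower hNpos hNδ (by linarith) hbl
  have hν : ‖ν‖ ≤ 1 / 2 * ‖μ‖ := by
    have h6 : ‖ν‖ ≤ Real.exp (q * (2 * c + κ) - q * σ) := by
      rw [Real.exp_sub, ← hμσ, le_div_iff₀ hμ0, mul_comm]
      exact h5.2
    refine h6.trans ?_
    have h7 : Real.exp (q * (2 * c + κ) - q * σ) ≤ Real.exp (-1) * Real.exp (q * σ) := by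
      rw [← Real.exp_add, Real.exp_le_exp]
      have : (q : ℝ) * (2 * σ - 2 * c - κ) ≥ q * δ := by
        refine mul_le_mul_of_nonneg_left ?_ hqr.le
        linarith
      nlinarith
    rw [hμσ]
    refine h7.trans ?_
    gcongr
    exact exp_neg_one_le_half
  have htrl : 1 / 2 * Real.exp (q * (L₂ - 7 * δ)) ≤
        ‖(cprod D (p / q) q (ε * Complex.I)).trace‖ := by
    rw [← htr]
    have h6 := norm_sub_le (μ + ν) ν
    rw [add_sub_cancel_right] at h6
    have h7 : Real.exp (q * (L₂ - 7 * δ)) ≤ ‖μ‖ := by rw [hμσ]; gcongr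
    linarith
  have hch := hD.norm_trace_le hT hqpos hg.coprime hε
  have hmq : m ^ q = Real.exp (q * Real.log m) := by rw [Real.exp_nat_mul, Real.exp_log hm0]
  have hpie : 0 ≤ 2 * Real.pi * ε := by positivity
  have hm1 : ‖(evalM 0 T ^ q).trace‖ ≤ 2 * Real.exp (q * (L + δ)) := by
    refine (hm q).trans ?_
    rw [hmq]
    gcongr
    linarith
  have hm2 : ‖(evalM 0 T ^ q).trace‖ * Real.exp (2 * Real.pi * q * ε) ≤
      2 * Real.exp (q * (L + δ)) := by
    refine (mul_le_mul_of_nonneg_right (hm q) (Real.exp_nonneg _)).trans ?_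
    rw [hmq, mul_assoc, ← Real.exp_add]
    gcongr
    nlinarith
  have hfin : Real.exp (q * (L₂ - 7 * δ)) ≤ Real.exp (q * δ) * Real.exp (q * (L + δ)) := by
    calc _ ≤ 2 * (2 * S + 4) * Real.exp (q * (L + δ)) := by
          have := h4 q
          linarith
      _ ≤ _ := by gcongr
  rw [← Real.exp_add, Real.exp_le_exp] at hfin
  nlinarith

end IsReflCocycle

lemma coc_smul_eq (D : ℂ → Mat2) (s : ℝ → ℂ) (Φ : ℝ) (n : ℕ) (x : ℝ) :
    coc Φ (fun x => (s x)⁻¹ • D x) n x =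
      (∏ j ∈ Finset.range n, s (x + j * Φ))⁻¹ • cprod D Φ n x := by
  induction n with
  | zero => simp [coc, cprod]
  | succ n ih =>
    rw [coc, ih, cprod, Finset.prod_range_succ, mul_inv, Matrix.smul_mul, Matrix.mul_smul,
      smul_smul, mul_comm]
    push_cast
    rfl

lemma norm_prod_sq_eq_det {D : ℂ → Mat2} {s : ℝ → ℂ} (hs : ∀ x : ℝ, ‖s x‖ ^ 2 = ‖(D x).det‖)
    (Φ : ℝ) (n : ℕ) (x : ℝ) :
    ‖∏ j ∈ Finset.range n, s (x + j * Φ)‖ ^ 2 = ‖(cprod D Φ n x).det‖ := by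
  rw [cprod_det, norm_prod, norm_prod, ← Finset.prod_pow]
  refine Finset.prod_congr rfl fun j _ => ?_
  rw [hs]
  push_cast
  rfl

namespace IsReflCocycle

variable {D : ℂ → Mat2} {T : Matrix (Fin 2) (Fin 2) (Polynomial ℂ)}

/-- If the growth rate on the real line exceeds the rates of the lowest Laurent coefficient and of
the determinant, then it is locally constant in the imaginary direction. -/
lemma hasDerivAt_growth_zero (hD : IsReflCocycle D)
    (hT : ∀ w, D w = (ee w)⁻¹ • evalM (ee w) T) {Φ : ℝ} (hΦ : Irrational Φ) {m c : ℝ}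
    (hm0 : 0 < m) (hm : ∀ n, ‖(evalM 0 T ^ n).trace‖ ≤ 2 * m ^ n)
    (hc : ∫ x in (0 : ℝ)..1, Real.log ‖(D x).det‖ = 2 * c)
    (hmL : Real.log m < growth D Φ 0) (hcL : c < growth D Φ 0) :
    HasDerivAt (growth D Φ) 0 0 := by
  set L := growth D Φ 0 with hLdef
  have hκ : 0 < (L - c) / 20 := by linarith
  obtain ⟨η₁, hη₁, hdet⟩ := hD.norm_det_cprod_close hc hκ
  obtain ⟨η₂, hη₂, hstrip⟩ := hD.log_det_strip one_pos
  obtain ⟨C, hC⟩ := hD.exists_det_lower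
  have hpi := Real.pi_pos
  set η := min (min η₁ η₂) ((L - Real.log m) / (2 * Real.pi)) with hη
  have hη0 : 0 < η := lt_min (lt_min hη₁ hη₂) (div_pos (by linarith) (by positivity))
  have hae := (hD.growth_mono Φ).ae_differentiableWithinAt_of_mem
  obtain ⟨ε, hε, hεd⟩ := (Measure.dense_of_ae hae).exists_mem_open isOpen_Ioo
    (Set.nonempty_Ioo.2 hη0)
  have hdiff : DifferentiableAt ℝ (growth D Φ) ε :=
    (hε (Set.mem_Ici.2 hεd.1.le)).differentiableAt (Ici_mem_nhds hεd.1)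
  have habs : |ε| = ε := abs_of_pos hεd.1
  have hεη₁ : |ε| ≤ η₁ := by
    rw [habs]; exact hεd.2.le.trans ((min_le_left _ _).trans (min_le_left _ _))
  have hεη₂ : |ε| ≤ η₂ := by
    rw [habs]; exact hεd.2.le.trans ((min_le_left _ _).trans (min_le_right _ _))
  have hεm : ε * (2 * Real.pi) ≤ L - Real.log m := by
    rw [← le_div_iff₀ (by positivity)]; exact hεd.2.le.trans (min_le_right _ _)
  have hle := hD.growth_le_growth_zero hT hΦ hm0 hm hεd.1.le (by linarith) hκ
    (C := C + 1) (c := c) (by rw [← hLdef]; linarith)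
    (fun x => by
      obtain ⟨h1, h2⟩ := hstrip ε hεη₂ x
      rw [← Real.le_log_iff_exp_le (norm_pos_iff.2 h1)]
      have h3 := (Real.le_log_iff_exp_le (norm_pos_iff.2 (hD.det_ne x))).2 (hC x)
      linarith [(abs_le.1 h2).1])
    (by
      obtain ⟨q₀, hq₀⟩ := hdet
      exact ⟨q₀, fun p q hq hq0 hpq Ψ hΨ K x => hq₀ p q hq hq0 hpq Ψ hΨ ε hεη₁ K x⟩)
    hdiff.hasDerivAt
  have hconst : growth D Φ =ᶠ[nhds 0] fun _ => L := by
    filter_upwards [Ioo_mem_nhds (neg_neg_of_pos hεd.1) hεd.1] with x hx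
    have hx' : growth D Φ x = growth D Φ |x| := by
      rcases abs_choice x with h | h
      · rw [h]
      · rw [h, hD.growth_neg]
    rw [hx']
    have h1 : |x| ≤ ε := (abs_lt.2 hx).le
    refine le_antisymm ?_ ?_
    · exact (hD.growth_mono Φ (Set.mem_Ici.2 (abs_nonneg x)) (Set.mem_Ici.2 hεd.1.le) h1).trans hle
    · exact hD.growth_mono Φ (Set.mem_Ici.2 le_rfl) (Set.mem_Ici.2 (abs_nonneg x)) (abs_nonneg x)
  exact (hasDerivAt_const (0 : ℝ) L).congr_of_eventuallyEq hconst

/-- Uniform expansion of the normalized cocycle over the real line. -/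
theorem exists_uniform_expansion (hD : IsReflCocycle D)
    (hT : ∀ w, D w = (ee w)⁻¹ • evalM (ee w) T) {Φ : ℝ} (hΦ : Irrational Φ) {m c : ℝ}
    (hm0 : 0 < m) (hm : ∀ n, ‖(evalM 0 T ^ n).trace‖ ≤ 2 * m ^ n)
    (hc : ∫ x in (0 : ℝ)..1, Real.log ‖(D x).det‖ = 2 * c)
    (hmL : Real.log m < growth D Φ 0) (hcL : c < growth D Φ 0)
    {s : ℝ → ℂ} (hs : ∀ x : ℝ, ‖s x‖ ^ 2 = ‖(D x).det‖) :
    ∃ N : ℕ, ∀ (x : ℝ) (u : Col2),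
      4 * ‖coc Φ (fun x => (s x)⁻¹ • D x) N x * u‖ ≤
        ‖coc Φ (fun x => (s x)⁻¹ • D x) N (x + N * Φ) *
          (coc Φ (fun x => (s x)⁻¹ • D x) N x * u)‖ + ‖u‖ := by
  have hder := hD.hasDerivAt_growth_zero hT hΦ hm0 hm hc hmL hcL
  set L := growth D Φ 0 with hLdef
  set δ := (L - c) / 5 with hδdef
  have hδ : 0 < δ := by rw [hδdef]; linarith
  obtain ⟨C, hC⟩ := hD.exists_det_lower
  obtain ⟨B, hB⟩ := hD.exists_bound Φ 1 0 0
  obtain ⟨K, hK, q₁, hq₁⟩ := hD.exp_le_norm_cprod (C := max C (Real.log (max B 1))) (ε₀ := 0)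
    (fun x => by
      have h1 := hB (x + (0 : ℝ) * Complex.I) (by simp)
      rw [cprod_one] at h1
      have hpos : 0 < max B 1 := lt_max_of_lt_right one_pos
      calc _ ≤ max B 1 := h1.trans (le_max_left _ _)
        _ = Real.exp (Real.log (max B 1)) := (Real.exp_log hpos).symm
        _ ≤ _ := Real.exp_le_exp.2 (le_max_right _ _))
    (fun x => by
      rw [Complex.ofReal_zero, zero_mul, add_zero]
      exact (Real.exp_le_exp.2 (neg_le_neg (le_max_left _ _))).trans (hC x)) hder hδ
  obtain ⟨η, hη, q₀, hq₀⟩ := hD.norm_det_cprod_close hc (show 0 < 2 * δ by positivity)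
  obtain ⟨n₀, hn₀⟩ := hD.eventually_supN_le Φ 0 hδ
  obtain ⟨n₁, hn₁⟩ := exists_nat_ge (2 / δ)
  obtain ⟨p, q, hq, hg⟩ := exists_isGoodApprox hΦ (max (max q₀ q₁) (max n₀ n₁))
  simp only [max_le_iff] at hq
  have hNq : q ≤ K * q := Nat.le_mul_of_pos_left _ hK
  set N := K * q with hN
  have hNδ : 2 ≤ N * δ := by
    have h1 : (n₁ : ℝ) ≤ N := by exact_mod_cast (by omega : n₁ ≤ N)
    rw [← div_le_iff₀ hδ]; linarith
  have hlow : ∀ x : ℝ, Real.exp (2 * N * (L - δ)) ≤ ‖cprod D Φ (N + N) x‖ := by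
    intro x
    have := hq₁ p q (by omega) hg x
    rw [Complex.ofReal_zero, zero_mul, add_zero] at this
    rw [← two_mul]
    have e : 2 * (N : ℝ) * (L - δ) = ((2 * (K * q) : ℕ) : ℝ) * (L - δ) := by
      rw [hN]; push_cast; ring
    rw [e]
    exact this
  have hup : ∀ x : ℝ, ‖cprod D Φ N x‖ ≤ Real.exp (N * (L + δ)) := by
    intro x
    have := (hD.norm_le_supN Φ N 0 x).trans (hn₀ N (by omega))
    rwa [Complex.ofReal_zero, zero_mul, add_zero] at this
  set d : ℝ → ℂ := fun x => ∏ j ∈ Finset.range N, s (x + j * Φ) with hd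
  have hdsq : ∀ x, ‖d x‖ ^ 2 = ‖(cprod D Φ N x).det‖ := norm_prod_sq_eq_det hs Φ N
  have hdet : ∀ x : ℝ, 0 < ‖(cprod D Φ N x).det‖ ∧
      ‖(cprod D Φ N x).det‖ ≤ Real.exp (N * (2 * c + 2 * δ)) := by
    intro x
    have := hq₀ p q (by omega) hg.pos hg.coprime Φ (fun x j hj => hg.abs_sub_le x j hj) 0
      (by simpa using hη.le) K x
    rw [Complex.ofReal_zero, zero_mul, add_zero] at this
    exact ⟨(Real.exp_pos _).trans_le this.1, this.2⟩
  have hdup : ∀ x, ‖d x‖ ≤ Real.exp (N * (c + δ)) := by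
    intro x
    rw [← sq_le_sq₀ (norm_nonneg _) (Real.exp_nonneg _), hdsq, ← Real.exp_nat_mul]
    refine (hdet x).2.trans_eq ?_
    congr 1; push_cast; ring
  have hd0 : ∀ x, 0 < ‖d x‖ := by
    intro x
    have h1 := (hdet x).1
    rw [← hdsq] at h1
    exact (norm_nonneg _).lt_of_ne fun h => by rw [← h] at h1; norm_num at h1
  refine ⟨N, fun x u => ?_⟩
  have hkey := mat2_key_ineq (cprod D Φ N (x + N * Φ)) (cprod D Φ N x) u
  rw [← cprod_add, ← hdsq] at hkey
  have hcast : ((x + N * Φ : ℝ) : ℂ) = x + N * Φ := by push_cast; rfl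
  rw [coc_smul_eq, coc_smul_eq, hcast]
  change 4 * ‖((d x)⁻¹ • cprod D Φ N x) * u‖ ≤
    ‖((d (x + N * Φ))⁻¹ • cprod D Φ N (x + N * Φ)) * (((d x)⁻¹ • cprod D Φ N x) * u)‖ + ‖u‖
  rw [Matrix.smul_mul, Matrix.smul_mul, Matrix.mul_smul, col2_norm_smul, col2_norm_smul,
    col2_norm_smul, norm_inv, norm_inv]
  set a := ‖cprod D Φ N x * u‖
  set b := ‖cprod D Φ N (x + N * Φ) * (cprod D Φ N x * u)‖
  have h1 := hlow x
  have h2 := hup x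
  have h3 := hup (x + N * Φ)
  rw [hcast] at h3
  have hdx := hd0 x
  have hdx' := hd0 (x + N * Φ)
  set E := Real.exp (N * (L + δ))
  set G := Real.exp (N * (c + δ))
  have h4 : a * Real.exp (2 * N * (L - δ)) ≤ b * E + E * ‖d x‖ ^ 2 * ‖u‖ := by
    refine (mul_le_mul_of_nonneg_left h1 (norm_nonneg _)).trans (hkey.trans ?_)
    gcongr
  have h5 : 4 * (E * G) ≤ Real.exp (2 * N * (L - δ)) := by
    have h6 : (4 : ℝ) ≤ Real.exp 2 := by
      have := Real.add_one_le_exp (1 : ℝ)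
      have h7 : Real.exp 2 = Real.exp 1 * Real.exp 1 := by rw [← Real.exp_add]; norm_num
      rw [h7]; nlinarith
    calc 4 * (E * G) ≤ Real.exp 2 * (E * G) := by gcongr
      _ = Real.exp (2 + (N * (L + δ) + N * (c + δ))) := by rw [Real.exp_add, Real.exp_add]
      _ ≤ _ := by
        rw [Real.exp_le_exp]
        have h8 : c = L - 5 * δ := by rw [hδdef]; ring
        rw [h8]
        nlinarith
  have hE : 0 < E := Real.exp_pos _
  have hG : 0 < G := Real.exp_pos _
  have h6 : b * E ≤ E * G * ‖d x‖ * (‖d (x + N * Φ)‖⁻¹ * (‖d x‖⁻¹ * b)) := by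
    have h7 : E * G * ‖d x‖ * (‖d (x + N * Φ)‖⁻¹ * (‖d x‖⁻¹ * b)) =
        (b * E) * (G * ‖d (x + N * Φ)‖⁻¹) := by field_simp
    rw [h7]
    refine le_mul_of_one_le_right (by positivity) ?_
    rw [← div_eq_mul_inv, one_le_div hdx']
    exact hdup _
  have h7 : E * ‖d x‖ ^ 2 * ‖u‖ ≤ E * G * ‖d x‖ * ‖u‖ := by
    have := hdup x
    rw [pow_two, ← mul_assoc]
    gcongr
  have h8 : a * (4 * (E * G)) ≤ a * Real.exp (2 * N * (L - δ)) :=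
    mul_le_mul_of_nonneg_left h5 (norm_nonneg _)
  refine le_of_mul_le_mul_left ?_ (show 0 < E * G * ‖d x‖ by positivity)
  calc E * G * ‖d x‖ * (4 * (‖d x‖⁻¹ * a)) = a * (4 * (E * G)) := by field_simp
    _ ≤ _ := h8.trans (h4.trans (add_le_add h6 h7))
    _ = _ := by ring

end IsReflCocycle

/-- A normal operator that is bounded below is invertible. -/
lemma isUnit_of_isStarNormal_of_bounded_below {H : Type*} [NormedAddCommGroup H]
    [InnerProductSpace ℂ H] [CompleteSpace H] {A : H →L[ℂ] H} (hA : IsStarNormal A) {C : ℝ}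
    (hC : ∀ x, ‖x‖ ≤ C * ‖A x‖) : IsUnit A := by
  rw [ContinuousLinearMap.isUnit_iff_bijective,
    ContinuousLinearMap.bijective_iff_dense_range_and_antilipschitz]
  have hinj : A.ker = ⊥ := by
    refine (Submodule.eq_bot_iff _).2 fun x hx => ?_
    have h := hC x
    rw [show A x = 0 from hx, norm_zero, mul_zero] at h
    exact norm_le_zero_iff.1 h
  refine ⟨?_, C.toNNReal, ?_⟩
  · rw [Submodule.topologicalClosure_eq_top_iff,
      ContinuousLinearMap.IsStarNormal.orthogonal_range hA, hinj]
  · refine AddMonoidHomClass.antilipschitz_of_bound A fun x => (hC x).trans ?_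
    gcongr
    exact Real.le_coe_toNNReal C

lemma lp_hasSum_sq (ψ : H2) : HasSum (fun n => ‖ψ n‖ ^ 2) (‖ψ‖ ^ 2) := by
  have h := lp.hasSum_norm (p := 2) (by norm_num) ψ
  simpa using h

lemma norm_sq_fin_two (v : EuclideanSpace ℂ (Fin 2)) : ‖v‖ ^ 2 = ‖v 0‖ ^ 2 + ‖v 1‖ ^ 2 := by
  rw [EuclideanSpace.norm_sq_eq, Fin.sum_univ_two]

lemma H2_summable_coord (ψ : H2) (i : Fin 2) : Summable fun n => ‖ψ n i‖ ^ 2 := by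
  refine (lp_hasSum_sq ψ).summable.of_nonneg_of_le (fun n => by positivity) fun n => ?_
  rw [norm_sq_fin_two]
  fin_cases i
  · exact le_add_of_nonneg_right (by positivity)
  · exact le_add_of_nonneg_left (by positivity)

lemma H2_norm_sq (ψ : H2) : ‖ψ‖ ^ 2 = ∑' n, ‖ψ n 0‖ ^ 2 + ∑' n, ‖ψ n 1‖ ^ 2 := by
  rw [← (H2_summable_coord ψ 0).tsum_add (H2_summable_coord ψ 1), ← (lp_hasSum_sq ψ).tsum_eq]
  exact tsum_congr fun n => norm_sq_fin_two _

lemma H2_exists_of_summable {u v : ℤ → ℂ} (hu : Summable fun n => ‖u n‖ ^ 2)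
    (hv : Summable fun n => ‖v n‖ ^ 2) : ∃ ψ : H2, ∀ n, ψ n 0 = u n ∧ ψ n 1 = v n := by
  refine ⟨⟨fun n => !₂[u n, v n], memℓp_gen ?_⟩, fun n => ⟨rfl, rfl⟩⟩
  refine (hu.add hv).congr fun n => ?_
  have := norm_sq_fin_two !₂[u n, v n]
  simpa using this.symm

lemma norm_sq_rotation {f : ℝ} {g : ℂ} (h : f ^ 2 + ‖g‖ ^ 2 = 1) (u v : ℂ) :
    ‖(f : ℂ) * u - g * v‖ ^ 2 + ‖(starRingEnd ℂ) g * u + f * v‖ ^ 2 = ‖u‖ ^ 2 + ‖v‖ ^ 2 := by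
  have key : ∀ w : ℂ, ‖w‖ ^ 2 = w.re ^ 2 + w.im ^ 2 := fun w => by
    rw [Complex.sq_norm, Complex.normSq_apply]; ring
  simp only [key] at h ⊢
  simp only [Complex.add_re, Complex.add_im, Complex.sub_re, Complex.sub_im, Complex.mul_re,
    Complex.mul_im, Complex.ofReal_re, Complex.ofReal_im, Complex.conj_re, Complex.conj_im]
  linear_combination (u.re ^ 2 + u.im ^ 2 + v.re ^ 2 + v.im ^ 2) * h

/-- `W` is the split-step walk on `ℤ` with coins `[[f, -g], [conj g, f]]` and shift parameters
`l`, `a`. -/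
structure IsWalk (W : H2 →L[ℂ] H2) (l a : ℝ) (f : ℤ → ℝ) (g : ℤ → ℂ) : Prop where
  shift : l ^ 2 + a ^ 2 = 1
  coin : ∀ n, f n ^ 2 + ‖g n‖ ^ 2 = 1
  plus : ∀ (ψ : H2) (n : ℤ), W ψ n 0 =
    (l : ℂ) * ((f (n - 1) : ℂ) * ψ (n - 1) 0 - g (n - 1) * ψ (n - 1) 1)
      - (a : ℂ) * ((starRingEnd ℂ) (g n) * ψ n 0 + (f n : ℂ) * ψ n 1)
  minus : ∀ (ψ : H2) (n : ℤ), W ψ n 1 =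
    (l : ℂ) * ((starRingEnd ℂ) (g (n + 1)) * ψ (n + 1) 0 + (f (n + 1) : ℂ) * ψ (n + 1) 1)
      + (a : ℂ) * ((f n : ℂ) * ψ n 0 - g n * ψ n 1)

namespace IsWalk

variable {W : H2 →L[ℂ] H2} {l a : ℝ} {f : ℤ → ℝ} {g : ℤ → ℂ}

lemma norm_map (hW : IsWalk W l a f g) (ψ : H2) : ‖W ψ‖ = ‖ψ‖ := by
  set F : ℤ → ℂ := fun n => (f n : ℂ) * ψ n 0 - g n * ψ n 1 with hF
  set G : ℤ → ℂ := fun n => (starRingEnd ℂ) (g n) * ψ n 0 + (f n : ℂ) * ψ n 1 with hG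
  have hFG : ∀ n, ‖F n‖ ^ 2 + ‖G n‖ ^ 2 = ‖ψ n‖ ^ 2 := fun n => by
    rw [norm_sq_fin_two]; exact norm_sq_rotation (hW.coin n) _ _
  have hs := (lp_hasSum_sq ψ).summable
  have hsF : Summable fun n => ‖F n‖ ^ 2 :=
    hs.of_nonneg_of_le (fun n => by positivity) fun n => by
      rw [← hFG]; exact le_add_of_nonneg_right (by positivity)
  have hsG : Summable fun n => ‖G n‖ ^ 2 :=
    hs.of_nonneg_of_le (fun n => by positivity) fun n => by
      rw [← hFG]; exact le_add_of_nonneg_left (by positivity)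
  let e : ℤ ≃ ℤ := Equiv.subRight 1
  have hshift : ∀ u : ℤ → ℝ, ∑' n, u (n - 1) = ∑' n, u n := fun u => e.tsum_eq u
  have hsF' : Summable fun n => ‖F (n - 1)‖ ^ 2 := hsF.comp_injective e.injective
  have hs1' : Summable fun n => ‖W ψ (n - 1) 1‖ ^ 2 :=
    (H2_summable_coord (W ψ) 1).comp_injective e.injective
  have hpt : ∀ n, ‖W ψ n 0‖ ^ 2 + ‖W ψ (n - 1) 1‖ ^ 2 = ‖F (n - 1)‖ ^ 2 + ‖G n‖ ^ 2 := by
    intro n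
    have h := norm_sq_rotation (f := l) (g := a)
      (by rw [Complex.norm_real, Real.norm_eq_abs, sq_abs]; exact hW.shift) (F (n - 1)) (G n)
    rw [hW.plus, hW.minus, sub_add_cancel, ← h, Complex.conj_ofReal, add_comm ((a : ℂ) * F (n - 1))]
  have hsq : ‖W ψ‖ ^ 2 = ‖ψ‖ ^ 2 := by
    calc ‖W ψ‖ ^ 2 = ∑' n, ‖W ψ n 0‖ ^ 2 + ∑' n, ‖W ψ (n - 1) 1‖ ^ 2 := by
          rw [H2_norm_sq, hshift fun n => ‖W ψ n 1‖ ^ 2]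
      _ = ∑' n, ‖F (n - 1)‖ ^ 2 + ∑' n, ‖G n‖ ^ 2 := by
          rw [← (H2_summable_coord (W ψ) 0).tsum_add hs1', tsum_congr hpt, hsF'.tsum_add hsG]
      _ = ∑' n, ‖F n‖ ^ 2 + ∑' n, ‖G n‖ ^ 2 := by rw [hshift fun n => ‖F n‖ ^ 2]
      _ = ‖ψ‖ ^ 2 := by
          rw [← hsF.tsum_add hsG, ← (lp_hasSum_sq ψ).tsum_eq]
          exact tsum_congr hFG
  exact (sq_eq_sq₀ (norm_nonneg _) (norm_nonneg _)).1 hsq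

lemma surjective (hW : IsWalk W l a f g) : Function.Surjective W := by
  intro η
  set F : ℤ → ℂ := fun n => l * η (n + 1) 0 + a * η n 1 with hF
  set G : ℤ → ℂ := fun n => -a * η n 0 + l * η (n - 1) 1 with hG
  have hη0 := H2_summable_coord η 0
  have hη1 := H2_summable_coord η 1
  have hη0' : Summable fun n => ‖η (n + 1) 0‖ ^ 2 :=
    hη0.comp_injective (Equiv.addRight (1 : ℤ)).injective
  have hη1' : Summable fun n => ‖η (n - 1) 1‖ ^ 2 :=
    hη1.comp_injective (Equiv.subRight (1 : ℤ)).injective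
  have key : ∀ (b c : ℝ) (u v : ℂ), b ^ 2 + c ^ 2 = 1 →
      ‖b * u + c * v‖ ^ 2 ≤ ‖u‖ ^ 2 + ‖v‖ ^ 2 := by
    intro b c u v h
    have h := norm_sq_rotation (f := c) (g := b)
      (by rw [Complex.norm_real, Real.norm_eq_abs, sq_abs]; linarith) u v
    rw [← h, Complex.conj_ofReal]
    exact le_add_of_nonneg_left (by positivity)
  have hsF : Summable fun n => ‖F n‖ ^ 2 :=
    (hη0'.add hη1).of_nonneg_of_le (fun n => by positivity) fun n => key l a _ _ hW.shift
  have hsG : Summable fun n => ‖G n‖ ^ 2 :=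
    (hη0.add hη1').of_nonneg_of_le (fun n => by positivity) fun n => by
      have := key (-a) l (η n 0) (η (n - 1) 1) (by linarith [hW.shift])
      simpa [hG] using this
  have hrot : ∀ n, ‖(f n : ℂ) * F n + g n * G n‖ ^ 2
      + ‖-(starRingEnd ℂ) (g n) * F n + f n * G n‖ ^ 2 = ‖F n‖ ^ 2 + ‖G n‖ ^ 2 := by
    intro n
    have := norm_sq_rotation (f := f n) (g := -g n) (by rw [norm_neg]; exact hW.coin n) (F n) (G n)
    rwa [neg_mul, sub_neg_eq_add, map_neg] at this
  obtain ⟨ψ, hψ⟩ := H2_exists_of_summable (u := fun n => (f n : ℂ) * F n + g n * G n)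
    (v := fun n => -(starRingEnd ℂ) (g n) * F n + f n * G n)
    ((hsF.add hsG).of_nonneg_of_le (fun n => by positivity) fun n => by
      rw [← hrot]; exact le_add_of_nonneg_right (by positivity))
    ((hsF.add hsG).of_nonneg_of_le (fun n => by positivity) fun n => by
      rw [← hrot]; exact le_add_of_nonneg_left (by positivity))
  have hcoin : ∀ n, (f n : ℂ) ^ 2 + g n * (starRingEnd ℂ) (g n) = 1 := fun n => by
    rw [Complex.mul_conj, Complex.normSq_eq_norm_sq]
    exact_mod_cast hW.coin n
  have hFψ : ∀ n, (f n : ℂ) * ψ n 0 - g n * ψ n 1 = F n := fun n => by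
    rw [(hψ n).1, (hψ n).2]
    linear_combination F n * hcoin n
  have hGψ : ∀ n, (starRingEnd ℂ) (g n) * ψ n 0 + (f n : ℂ) * ψ n 1 = G n := fun n => by
    rw [(hψ n).1, (hψ n).2]
    linear_combination G n * hcoin n
  have hsh : (l : ℂ) ^ 2 + (a : ℂ) ^ 2 = 1 := by exact_mod_cast hW.shift
  refine ⟨ψ, lp.ext (funext fun n => PiLp.ext fun i => ?_)⟩
  fin_cases i
  · change W ψ n 0 = η n 0
    rw [hW.plus, hFψ, hGψ, hF, hG]
    simp only [sub_add_cancel]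
    linear_combination η n 0 * hsh
  · change W ψ n 1 = η n 1
    rw [hW.minus, hFψ, hGψ, hF, hG]
    simp only [add_sub_cancel_right]
    linear_combination η n 1 * hsh

lemma mem_unitary (hW : IsWalk W l a f g) : W ∈ unitary (H2 →L[ℂ] H2) := by
  let e : H2 ≃ₗᵢ[ℂ] H2 :=
    LinearIsometryEquiv.ofSurjective ⟨W.toLinearMap, hW.norm_map⟩ hW.surjective
  have h := (Unitary.linearIsometryEquiv.symm e).2
  rw [Unitary.coe_symm_linearIsometryEquiv_apply] at h
  exact h

lemma norm_eq_one_of_mem_spectrum (hW : IsWalk W l a f g) {z : ℂ} (hz : z ∈ spectrum ℂ W) :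
    ‖z‖ = 1 :=
  mem_sphere_zero_iff_norm.1 (spectrum.subset_circle_of_unitary hW.mem_unitary hz)

/-- No point of the spectrum admits a lower bound for `W - z`. -/
lemma not_bounded_below (hW : IsWalk W l a f g) {z : ℂ} (hz : z ∈ spectrum ℂ W) (C : ℝ) :
    ¬ ∀ ψ : H2, ‖ψ‖ ≤ C * ‖W ψ - z • ψ‖ := by
  intro hC
  have hn : IsStarNormal W := isStarNormal_of_mem_unitary hW.mem_unitary
  have hA : IsStarNormal (algebraMap ℂ (H2 →L[ℂ] H2) z - W) := by
    refine ⟨?_⟩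
    rw [star_sub, ← algebraMap_star_comm]
    refine Commute.sub_left ?_ ?_
    · exact Algebra.commute_algebraMap_left _ _
    · exact Commute.sub_right (Algebra.commute_algebraMap_right _ _) hn.star_comm_self
  refine hz (isUnit_of_isStarNormal_of_bounded_below hA (C := C) fun ψ => ?_)
  refine (hC ψ).trans_eq ?_
  rw [← norm_neg, neg_sub]
  rfl

end IsWalk

lemma tsum_int_add (u : ℤ → ℝ) (k : ℤ) : ∑' n, u (n + k) = ∑' n, u n :=
  (Equiv.addRight k).tsum_eq u

lemma summable_int_add {u : ℤ → ℝ} (hu : Summable u) (k : ℤ) : Summable fun n => u (n + k) :=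
  hu.comp_injective (Equiv.addRight k).injective

/-- A discrete convexity inequality with square-summable error forces an `ℓ²` bound. -/
lemma tsum_sq_le_of_expansion {Y R : ℤ → ℝ} (hY0 : ∀ n, 0 ≤ Y n)
    (hY : Summable fun n => Y n ^ 2) (hR : Summable fun n => R n ^ 2) (N : ℤ)
    (h : ∀ n, 4 * Y (n + N) ≤ Y (n + 2 * N) + Y n + R n) :
    ∑' n, Y n ^ 2 ≤ ∑' n, R n ^ 2 := by
  have h1 := summable_int_add hY N
  have h2 := summable_int_add hY (2 * N)
  have hpt : ∀ n, 16 * Y (n + N) ^ 2 ≤ 3 * (Y (n + 2 * N) ^ 2 + Y n ^ 2 + R n ^ 2) := by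
    intro n
    have := h n
    have h0 := hY0 (n + N)
    nlinarith [sq_nonneg (Y (n + 2 * N) - Y n), sq_nonneg (Y (n + 2 * N) - R n),
      sq_nonneg (Y n - R n), hY0 n, hY0 (n + 2 * N)]
  have hsum := (h1.mul_left 16).tsum_le_tsum hpt (((h2.add hY).add hR).mul_left 3)
  rw [tsum_mul_left, tsum_mul_left, (h2.add hY).tsum_add hR, h2.tsum_add hY,
    tsum_int_add (fun n => Y n ^ 2), tsum_int_add (fun n => Y n ^ 2)] at hsum
  have h0 : 0 ≤ ∑' n, Y n ^ 2 := tsum_nonneg fun n => sq_nonneg (Y n)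
  linarith

lemma coc_norm_le {Φ : ℝ} {M : ℝ → Mat2} {B : ℝ} (hB : ∀ x, ‖M x‖ ≤ B) (n : ℕ) :
    ∃ C, 0 ≤ C ∧ ∀ x, ‖coc Φ M n x‖ ≤ C := by
  have hB0 : 0 ≤ B := (norm_nonneg _).trans (hB 0)
  induction n with
  | zero => exact ⟨2, by norm_num, fun x => mat2_norm_one_le⟩
  | succ n ih =>
    obtain ⟨C, hC0, hC⟩ := ih
    refine ⟨B * C, by positivity, fun x => ?_⟩
    exact (mat2_norm_mul_le _ _).trans (mul_le_mul (hB _) (hC _) (norm_nonneg _) hB0)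

/-- The error after `n` steps of a perturbed cocycle orbit is square-summable. -/
lemma exists_step_error {Φ θ : ℝ} {M : ℝ → Mat2} {B : ℝ} (hB : ∀ x, ‖M x‖ ≤ B) (n : ℕ) :
    ∃ C, 0 ≤ C ∧ ∀ (y : ℤ → Col2) (r : ℤ → ℝ),
      (∀ k, ‖y (k + 1) - M (θ + k * Φ) * y k‖ ≤ r k) → (Summable fun k => r k ^ 2) →
      (Summable fun k : ℤ => ‖y (k + n) - coc Φ M n (θ + k * Φ) * y k‖ ^ 2) ∧
        ∑' k : ℤ, ‖y (k + n) - coc Φ M n (θ + k * Φ) * y k‖ ^ 2 ≤ C * ∑' k, r k ^ 2 := by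
  have hB0 : 0 ≤ B := (norm_nonneg _).trans (hB 0)
  induction n with
  | zero =>
    refine ⟨0, le_rfl, fun y r _ _ => ?_⟩
    simp [coc, summable_zero]
  | succ n ih =>
    obtain ⟨C, hC0, hC⟩ := ih
    refine ⟨2 + 2 * B ^ 2 * C, by positivity, fun y r hr hs => ?_⟩
    obtain ⟨h1, h2⟩ := hC y r hr hs
    have hr0 : ∀ k, 0 ≤ r k := fun k => (norm_nonneg _).trans (hr k)
    have hsn := summable_int_add hs n
    have hpt : ∀ k : ℤ, ‖y (k + (n + 1 : ℕ)) - coc Φ M (n + 1) (θ + k * Φ) * y k‖ ^ 2 ≤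
        2 * r (k + n) ^ 2 + 2 * B ^ 2 * ‖y (k + n) - coc Φ M n (θ + k * Φ) * y k‖ ^ 2 := by
      intro k
      set E := y (k + n) - coc Φ M n (θ + k * Φ) * y k with hE
      have hx : θ + ((k + n : ℤ) : ℝ) * Φ = θ + k * Φ + n * Φ := by push_cast; ring
      have h3 := hr (k + n)
      rw [hx] at h3
      have h4 : y (k + (n + 1 : ℕ)) - coc Φ M (n + 1) (θ + k * Φ) * y k =
          (y (k + n + 1) - M (θ + k * Φ + n * Φ) * y (k + n)) + M (θ + k * Φ + n * Φ) * E := by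
        have hk : k + ((n + 1 : ℕ) : ℤ) = k + n + 1 := by push_cast; ring
        rw [hE, coc, Matrix.mul_sub, Matrix.mul_assoc, hk]
        exact (sub_add_sub_cancel (y (k + n + 1)) _ _).symm
      have h5 : ‖M (θ + k * Φ + n * Φ) * E‖ ≤ B * ‖E‖ :=
        (mat2_norm_mulCol_le _ _).trans (mul_le_mul_of_nonneg_right (hB _) (norm_nonneg _))
      have h6 : ‖y (k + (n + 1 : ℕ)) - coc Φ M (n + 1) (θ + k * Φ) * y k‖ ≤
          r (k + n) + B * ‖E‖ := by
        rw [h4]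
        exact (norm_add_le _ _).trans (add_le_add h3 h5)
      refine (pow_le_pow_left₀ (norm_nonneg _) h6 2).trans ?_
      nlinarith [sq_nonneg (r (k + n) - B * ‖E‖)]
    have hs' := (hsn.mul_left 2).add (h1.mul_left (2 * B ^ 2))
    have hs'' := hs'.of_nonneg_of_le (fun k => sq_nonneg _) hpt
    refine ⟨hs'', (hs''.tsum_le_tsum hpt hs').trans ?_⟩
    rw [(hsn.mul_left 2).tsum_add (h1.mul_left _), tsum_mul_left, tsum_mul_left,
      tsum_int_add (fun k => r k ^ 2)]
    have : 0 ≤ 2 * B ^ 2 := by positivity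
    nlinarith [mul_le_mul_of_nonneg_left h2 this]

/-- Uniform expansion of a bounded cocycle bounds approximate `ℓ²` orbits by their errors. -/
lemma exists_orbit_bound {Φ θ : ℝ} {M : ℝ → Mat2} {B : ℝ} (hB : ∀ x, ‖M x‖ ≤ B) {N : ℕ}
    (hN : ∀ (x : ℝ) (u : Col2), 4 * ‖coc Φ M N x * u‖ ≤
      ‖coc Φ M N (x + N * Φ) * (coc Φ M N x * u)‖ + ‖u‖) :
    ∃ C, 0 ≤ C ∧ ∀ (y : ℤ → Col2) (r : ℤ → ℝ),
      (∀ k, ‖y (k + 1) - M (θ + k * Φ) * y k‖ ≤ r k) → (Summable fun k => r k ^ 2) →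
      (Summable fun k => ‖y k‖ ^ 2) → ∑' k, ‖y k‖ ^ 2 ≤ C * ∑' k, r k ^ 2 := by
  obtain ⟨C, hC0, hC⟩ := exists_step_error (Φ := Φ) (θ := θ) hB N
  obtain ⟨A, hA0, hA⟩ := coc_norm_le (Φ := Φ) hB N
  refine ⟨2 * C + 2 * (4 + A) ^ 2 * C, by positivity, fun y r hr hs hy => ?_⟩
  obtain ⟨h1, h2⟩ := hC y r hr hs
  set E : ℤ → Col2 := fun k => y (k + N) - coc Φ M N (θ + k * Φ) * y k with hE
  have h1N := summable_int_add h1 N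
  set R : ℤ → ℝ := fun k => ‖E (k + N)‖ + (4 + A) * ‖E k‖ with hR
  have hRle : ∀ k, R k ^ 2 ≤ 2 * ‖E (k + N)‖ ^ 2 + 2 * (4 + A) ^ 2 * ‖E k‖ ^ 2 := fun k => by
    rw [hR]
    nlinarith [sq_nonneg (‖E (k + N)‖ - (4 + A) * ‖E k‖)]
  have hRs' := (h1N.mul_left 2).add (h1.mul_left (2 * (4 + A) ^ 2))
  have hRs : Summable fun k => R k ^ 2 := hRs'.of_nonneg_of_le (fun k => sq_nonneg _) hRle
  have hexp := tsum_sq_le_of_expansion (Y := fun k => ‖y k‖) (R := R) (fun k => norm_nonneg _)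
    hy hRs N (fun k => by
      have h3 := hN (θ + k * Φ) (y k)
      have hx : θ + k * Φ + N * Φ = θ + ((k + N : ℤ) : ℝ) * Φ := by push_cast; ring
      rw [hx] at h3
      have h4 : coc Φ M N (θ + k * Φ) * y k = y (k + N) - E k :=
        (sub_sub_cancel _ _).symm
      rw [h4, Matrix.mul_sub] at h3
      have h5 : coc Φ M N (θ + ((k + N : ℤ) : ℝ) * Φ) * y (k + N) = y (k + 2 * N) - E (k + N) := by
        rw [two_mul, ← add_assoc]; exact (sub_sub_cancel _ _).symm
      rw [h5] at h3
      have h6 : ‖y (k + 2 * N) - E (k + N) - coc Φ M N (θ + ((k + N : ℤ) : ℝ) * Φ) * E k‖ ≤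
          ‖y (k + 2 * N)‖ + ‖E (k + N)‖ + A * ‖E k‖ :=
        (norm_sub_le _ _).trans (add_le_add (norm_sub_le _ _) ((mat2_norm_mulCol_le _ _).trans
          (mul_le_mul_of_nonneg_right (hA _) (norm_nonneg _))))
      have h7 := norm_sub_norm_le (y (k + N)) (E k)
      change 4 * ‖y (k + N)‖ ≤ ‖y (k + 2 * N)‖ + ‖y k‖ + (‖E (k + N)‖ + (4 + A) * ‖E k‖)
      linarith)
  refine hexp.trans ((hRs.tsum_le_tsum hRle hRs').trans ?_)
  rw [(h1N.mul_left 2).tsum_add (h1.mul_left _), tsum_mul_left, tsum_mul_left,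
    tsum_int_add (fun k => ‖E k‖ ^ 2)]
  have : 0 ≤ 2 * (4 + A) ^ 2 := by positivity
  nlinarith [mul_le_mul_of_nonneg_left h2 this]

lemma walk_step_fst {l a F g g' z : ℂ} (hl : l ≠ 0) (hF : F ≠ 0) (hz : z ≠ 0)
    (hc : F ^ 2 + g * g' = 1) (u v G : ℂ) :
    z⁻¹ * G - z⁻¹ / (l * F) * ((z ^ 2 + a * z * g) * (z⁻¹ * (g' * u + F * v)) +
      (-(z * g') - a) * u) = z⁻¹ * ((l * G + a * (F * u - g * v) - z * v) / l) := by
  have h : z ^ 2 * z⁻¹ = z := by field_simp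
  have h' : z * z⁻¹ = 1 := by field_simp
  have e : (z ^ 2 + a * z * g) * (z⁻¹ * (g' * u + F * v)) + (-(z * g') - a) * u =
      F * (z * v + a * (g * v - F * u)) := by
    linear_combination (g' * u + F * v) * h + a * g * (g' * u + F * v) * h' + a * u * hc
  rw [e]
  field_simp
  ring

lemma walk_step_snd {l a F g g' z : ℂ} (hl : l ≠ 0) (hF : F ≠ 0) (hz : z ≠ 0)
    (hc : F ^ 2 + g * g' = 1) (hs : l ^ 2 + a ^ 2 = 1) (u v G w : ℂ) :
    w - z⁻¹ / (l * F) * ((-(a * z ^ 2) - g * z) * (z⁻¹ * (g' * u + F * v)) +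
      (a * z * g' + 1) * u) = z⁻¹ * (-(a * ((l * G + a * (F * u - g * v) - z * v) / l)) -
        (l * (F * u - g * v) - a * G - z * w)) := by
  have h : z ^ 2 * z⁻¹ = z := by field_simp
  have h' : z * z⁻¹ = 1 := by field_simp
  have e : (-(a * z ^ 2) - g * z) * (z⁻¹ * (g' * u + F * v)) + (a * z * g' + 1) * u =
      F * (F * u - g * v - a * z * v) := by
    linear_combination -a * (g' * u + F * v) * h - g * (g' * u + F * v) * h' - u * hc
  rw [e]
  field_simp
  linear_combination (F * u - g * v) * hs

namespace IsWalk

variable {W : H2 →L[ℂ] H2} {l a : ℝ} {f : ℤ → ℝ} {g : ℤ → ℂ}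

/-- If the transfer cocycle of the walk at `z` expands uniformly, then `W - z` is bounded below. -/
lemma exists_bound_below (hW : IsWalk W l a f g) {z : ℂ} (hz : ‖z‖ = 1) {f₀ : ℝ} (hf₀ : 0 < f₀)
    (hf : ∀ n, f₀ ≤ f n) (hl : 0 < l) {Φ θ : ℝ} {M : ℝ → Mat2} {B : ℝ} (hB : ∀ x, ‖M x‖ ≤ B)
    (hM : ∀ n : ℤ, M (θ + n * Φ) = (z⁻¹ / (l * f n)) •
      !![z ^ 2 + a * z * g n, -(z * (starRingEnd ℂ) (g n)) - a;
        -(a * z ^ 2) - g n * z, a * z * (starRingEnd ℂ) (g n) + 1]) {N : ℕ}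
    (hN : ∀ (x : ℝ) (u : Col2), 4 * ‖coc Φ M N x * u‖ ≤
      ‖coc Φ M N (x + N * Φ) * (coc Φ M N x * u)‖ + ‖u‖) :
    ∃ C, ∀ ψ : H2, ‖ψ‖ ≤ C * ‖W ψ - z • ψ‖ := by
  obtain ⟨C, hC0, hC⟩ := exists_orbit_bound (θ := θ) hB hN
  set K := (1 + 2 / f₀ ^ 2) * (C * (8 / l ^ 2)) with hK
  refine ⟨Real.sqrt K, fun ψ => ?_⟩
  have hz0 : z ≠ 0 := fun h => by rw [h, norm_zero] at hz; exact zero_ne_one hz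
  have hl1 : l ≤ 1 := by nlinarith [hW.shift, sq_nonneg a]
  have ha1 : |a| ≤ 1 := abs_le_one_iff_mul_self_le_one.2 (by nlinarith [hW.shift, sq_nonneg l])
  have hl0 : (l : ℂ) ≠ 0 := by exact_mod_cast hl.ne'
  have hf0 : ∀ n, (f n : ℂ) ≠ 0 := fun n => by exact_mod_cast (hf₀.trans_le (hf n)).ne'
  set η := W ψ - z • ψ with hη
  have hη0 : ∀ n, η n 0 = W ψ n 0 - z * ψ n 0 := fun n => rfl
  have hη1 : ∀ n, η n 1 = W ψ n 1 - z * ψ n 1 := fun n => rfl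
  set G : ℤ → ℂ := fun n => (starRingEnd ℂ) (g n) * ψ n 0 + (f n : ℂ) * ψ n 1 with hG
  have hGle : ∀ n, ‖G n‖ ^ 2 ≤ ‖ψ n‖ ^ 2 := fun n => by
    rw [norm_sq_fin_two, ← norm_sq_rotation (hW.coin n)]
    exact le_add_of_nonneg_left (by positivity)
  set y : ℤ → Col2 := fun n => !![z⁻¹ * G n; ψ n 0] with hy
  have hyn : ∀ n, ‖y n‖ ^ 2 = ‖G n‖ ^ 2 + ‖ψ n 0‖ ^ 2 := fun n => by
    rw [col2_norm_sq]
    simp [hy, hz]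
  have hcoin : ∀ n, (f n : ℂ) ^ 2 + g n * (starRingEnd ℂ) (g n) = 1 := fun n => by
    rw [Complex.mul_conj, Complex.normSq_eq_norm_sq]
    exact_mod_cast hW.coin n
  have hsh : (l : ℂ) ^ 2 + (a : ℂ) ^ 2 = 1 := by exact_mod_cast hW.shift
  have hstep : ∀ n : ℤ, y (n + 1) - M (θ + n * Φ) * y n =
      !![z⁻¹ * (η n 1 / l); z⁻¹ * (-(a * (η n 1 / l)) - η (n + 1) 0)] := by
    intro n
    have e1 := hη1 n
    rw [hW.minus] at e1
    have e0 := hη0 (n + 1)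
    rw [hW.plus, add_sub_cancel_right] at e0
    have e1' : η n 1 = l * G (n + 1) + a * (f n * ψ n 0 - g n * ψ n 1) - z * ψ n 1 := e1
    have e0' : η (n + 1) 0 = l * (f n * ψ n 0 - g n * ψ n 1) - a * G (n + 1)
        - z * ψ (n + 1) 0 := e0
    have hc := hcoin n
    rw [hM, Matrix.smul_mul, hy, e0', e1']
    ext i j
    fin_cases j
    fin_cases i <;> rw [Matrix.sub_apply, Matrix.smul_apply, Matrix.mul_apply, Fin.sum_univ_two]
    · exact walk_step_fst hl0 (hf0 n) hz0 hc (ψ n 0) (ψ n 1) (G (n + 1))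
    · exact walk_step_snd hl0 (hf0 n) hz0 hc hsh (ψ n 0) (ψ n 1) (G (n + 1)) (ψ (n + 1) 0)
  set r : ℤ → ℝ := fun n => 2 / l * (‖η n 1‖ + ‖η (n + 1) 0‖) with hr
  have hrle : ∀ n, ‖y (n + 1) - M (θ + n * Φ) * y n‖ ≤ r n := by
    intro n
    have hr0 : 0 ≤ r n := by positivity
    rw [hstep, ← sq_le_sq₀ (norm_nonneg _) hr0, col2_norm_sq]
    have h0 : ‖z⁻¹ * (η n 1 / l)‖ = ‖η n 1‖ / l := by
      rw [norm_mul, norm_inv, hz, norm_div, Complex.norm_real, Real.norm_of_nonneg hl.le]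
      simp
    have h1 : ‖z⁻¹ * (-(a * (η n 1 / l)) - η (n + 1) 0)‖ ≤ ‖η n 1‖ / l + ‖η (n + 1) 0‖ := by
      rw [norm_mul, norm_inv, hz, inv_one, one_mul]
      refine (norm_sub_le _ _).trans (add_le_add ?_ le_rfl)
      rw [norm_neg, norm_mul, norm_div, Complex.norm_real, Complex.norm_real,
        Real.norm_of_nonneg hl.le]
      exact mul_le_of_le_one_left (by positivity) ha1
    have h2 : ‖η (n + 1) 0‖ ≤ ‖η (n + 1) 0‖ / l := le_div_self (norm_nonneg _) hl hl1
    change ‖z⁻¹ * (η n 1 / l)‖ ^ 2 + ‖z⁻¹ * (-(a * (η n 1 / l)) - η (n + 1) 0)‖ ^ 2 ≤ r n ^ 2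
    have h3 : r n = 2 * (‖η n 1‖ / l + ‖η (n + 1) 0‖ / l) := by rw [hr]; ring
    rw [h0, h3]
    have h4 : 0 ≤ ‖η n 1‖ / l := by positivity
    have h5 := pow_le_pow_left₀ (norm_nonneg _) (h1.trans (add_le_add_right h2 _)) 2
    nlinarith [norm_nonneg (η (n + 1) 0)]
  have hrs' := ((H2_summable_coord η 1).add
    (summable_int_add (H2_summable_coord η 0) 1)).mul_left (8 / l ^ 2)
  have hrsq : ∀ n, r n ^ 2 ≤ 8 / l ^ 2 * (‖η n 1‖ ^ 2 + ‖η (n + 1) 0‖ ^ 2) := fun n => by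
    have : r n ^ 2 = 4 / l ^ 2 * (‖η n 1‖ + ‖η (n + 1) 0‖) ^ 2 := by rw [hr]; ring
    have h8 : 8 / l ^ 2 = 4 / l ^ 2 * 2 := by ring
    rw [this, h8, mul_assoc]
    gcongr
    nlinarith [sq_nonneg (‖η n 1‖ - ‖η (n + 1) 0‖)]
  have hrs : Summable fun n => r n ^ 2 := hrs'.of_nonneg_of_le (fun n => sq_nonneg _) hrsq
  have hrsum : ∑' n, r n ^ 2 ≤ 8 / l ^ 2 * ‖η‖ ^ 2 := by
    refine (hrs.tsum_le_tsum hrsq hrs').trans_eq ?_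
    rw [tsum_mul_left, (H2_summable_coord η 1).tsum_add
      (summable_int_add (H2_summable_coord η 0) 1), tsum_int_add (fun n => ‖η n 0‖ ^ 2),
      H2_norm_sq, add_comm]
  have hψs := (lp_hasSum_sq ψ).summable
  have hys : Summable fun n => ‖y n‖ ^ 2 :=
    (hψs.mul_left 2).of_nonneg_of_le (fun n => sq_nonneg _) fun n => by
      rw [hyn]
      have := hGle n
      have h2 := norm_sq_fin_two (ψ n)
      nlinarith [sq_nonneg ‖ψ n 1‖]
  have hmain := hC y r hrle hrs hys
  have hψle : ∀ n, ‖ψ n‖ ^ 2 ≤ (1 + 2 / f₀ ^ 2) * ‖y n‖ ^ 2 := by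
    intro n
    have hg1 : ‖g n‖ ≤ 1 := by
      have := hW.coin n
      nlinarith [sq_nonneg (f n), norm_nonneg (g n)]
    have h1 : f₀ * ‖ψ n 1‖ ≤ ‖G n‖ + ‖ψ n 0‖ := by
      have h2 : (f n : ℂ) * ψ n 1 = G n - (starRingEnd ℂ) (g n) * ψ n 0 := by rw [hG]; ring
      have h3 : f n * ‖ψ n 1‖ = ‖G n - (starRingEnd ℂ) (g n) * ψ n 0‖ := by
        rw [← h2, norm_mul, Complex.norm_real, Real.norm_of_nonneg (hf₀.le.trans (hf n))]
      calc f₀ * ‖ψ n 1‖ ≤ f n * ‖ψ n 1‖ := by gcongr; exact hf n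
        _ ≤ ‖G n‖ + ‖(starRingEnd ℂ) (g n) * ψ n 0‖ := h3.trans_le (norm_sub_le _ _)
        _ ≤ _ := by
          gcongr
          rw [norm_mul, RCLike.norm_conj]
          exact mul_le_of_le_one_left (norm_nonneg _) hg1
    have h4 : ‖ψ n 1‖ ^ 2 ≤ 2 / f₀ ^ 2 * (‖G n‖ ^ 2 + ‖ψ n 0‖ ^ 2) := by
      rw [div_mul_eq_mul_div, le_div_iff₀ (by positivity)]
      have := pow_le_pow_left₀ (by positivity) h1 2
      nlinarith [sq_nonneg (‖G n‖ - ‖ψ n 0‖)]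
    rw [norm_sq_fin_two, hyn]
    nlinarith [sq_nonneg ‖G n‖]
  have hfin : ‖ψ‖ ^ 2 ≤ K * ‖η‖ ^ 2 := by
    rw [← (lp_hasSum_sq ψ).tsum_eq]
    refine (hψs.tsum_le_tsum hψle (hys.mul_left _)).trans ?_
    rw [tsum_mul_left, hK, mul_assoc, mul_assoc]
    gcongr
    exact hmain.trans (by gcongr)
  rw [← sq_le_sq₀ (norm_nonneg _) (by positivity), mul_pow, Real.sq_sqrt (by positivity)]
  exact hfin

end IsWalk

lemma Function.Periodic.intervalIntegral_shift {h : ℝ → ℝ} (hp : Function.Periodic h 1) (s : ℝ) :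
    ∫ x in (0 : ℝ)..1, h (x + s) = ∫ x in (0 : ℝ)..1, h x := by
  rw [intervalIntegral.integral_comp_add_right, zero_add, add_comm 1 s,
    hp.intervalIntegral_add_eq s 0, zero_add]

namespace IsReflCocycle

variable {D : ℂ → Mat2} {T : Matrix (Fin 2) (Fin 2) (Polynomial ℂ)}

lemma cprod_det_ne (hD : IsReflCocycle D) (Φ : ℝ) (n : ℕ) (x : ℝ) : (cprod D Φ n x).det ≠ 0 := by
  rw [cprod_det, Finset.prod_ne_zero_iff]
  intro j _
  exact_mod_cast hD.det_ne (x + j * Φ)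

lemma norm_cprod_pos (hD : IsReflCocycle D) (Φ : ℝ) (n : ℕ) (x : ℝ) :
    0 < ‖cprod D Φ n x‖ := by
  have h1 := mat2_det_le (cprod D Φ n x)
  have h2 := norm_pos_iff.2 (hD.cprod_det_ne Φ n x)
  exact (norm_nonneg _).lt_of_ne fun h => by rw [← h] at h1; linarith

lemma continuous_norm_cprod (hD : IsReflCocycle D) (Φ : ℝ) (n : ℕ) :
    Continuous fun x : ℝ => ‖cprod D Φ n x‖ :=
  ((hD.continuous_cprod n).comp
    (continuous_const.prodMk Complex.continuous_ofReal : Continuous fun x : ℝ => (Φ, (x : ℂ)))).norm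

lemma continuous_log_norm_cprod (hD : IsReflCocycle D) (Φ : ℝ) (n : ℕ) :
    Continuous fun x : ℝ => Real.log ‖cprod D Φ n x‖ :=
  (hD.continuous_norm_cprod Φ n).log fun x => (hD.norm_cprod_pos Φ n x).ne'

lemma integral_log_det_cprod (hD : IsReflCocycle D) (Φ : ℝ) (n : ℕ) :
    Continuous (fun x : ℝ => Real.log ‖(cprod D Φ n x).det‖) ∧
    ∫ x in (0 : ℝ)..1, Real.log ‖(cprod D Φ n x).det‖ =
      n * ∫ x in (0 : ℝ)..1, Real.log ‖(D x).det‖ := by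
  have hc : Continuous fun x : ℝ => Real.log ‖(D x).det‖ :=
    ((hD.continuous.comp Complex.continuous_ofReal).matrix_det.norm).log
      fun x => (norm_pos_iff.2 (hD.det_ne x)).ne'
  have hp : Function.Periodic (fun x : ℝ => Real.log ‖(D x).det‖) 1 := fun x => by
    simp only
    rw [Complex.ofReal_add, Complex.ofReal_one, hD.per]
  have hsum : ∀ x : ℝ, Real.log ‖(cprod D Φ n x).det‖ =
      ∑ j ∈ Finset.range n, Real.log ‖(D ((x + j * Φ : ℝ) : ℂ)).det‖ := fun x => by
    rw [cprod_det, norm_prod, Real.log_prod]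
    · push_cast; rfl
    · intro j _
      exact_mod_cast (norm_pos_iff.2 (hD.det_ne (x + j * Φ))).ne'
  have hcj : ∀ j : ℕ, Continuous fun x : ℝ => Real.log ‖(D ((x + j * Φ : ℝ) : ℂ)).det‖ :=
    fun j => hc.comp (continuous_id.add continuous_const)
  simp only [hsum]
  refine ⟨continuous_finsetSum _ fun j _ => hcj j, ?_⟩
  rw [intervalIntegral.integral_finsetSum fun j _ => (hcj j).intervalIntegrable 0 1]
  have hshift : ∀ j : ℕ, ∫ x in (0 : ℝ)..1, Real.log ‖(D ((x + j * Φ : ℝ) : ℂ)).det‖ =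
      ∫ x in (0 : ℝ)..1, Real.log ‖(D x).det‖ := fun j => hp.intervalIntegral_shift (j * Φ)
  simp only [hshift, Finset.sum_const, Finset.card_range, nsmul_eq_mul]

/-- Jensen lower bound for the averaged growth through the lowest Laurent coefficient. -/
lemma le_integral_log_norm_cprod (hD : IsReflCocycle D)
    (hT : ∀ w, D w = (ee w)⁻¹ • evalM (ee w) T) (Φ : ℝ) {m : ℝ} (hm0 : 0 < m) {n : ℕ}
    (hm : m ^ n ≤ ‖(evalM 0 T ^ n).trace‖) :
    n * Real.log m - Real.log 2 ≤ ∫ x in (0 : ℝ)..1, Real.log ‖cprod D Φ n x‖ := by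
  set Q := (polyProd T (ee Φ) n).trace with hQ
  have hQ0 : m ^ n ≤ ‖Q.eval 0‖ := by rwa [hQ, ← evalM_trace, evalM_polyProd_zero]
  have hQx : ∀ x : ℝ, ‖Q.eval (ee x)‖ ≤ 2 * ‖cprod D Φ n x‖ := by
    intro x
    obtain ⟨u, hu, h⟩ := cprod_eq_smul_polyProd hT Φ n (x : ℂ)
    have h1 := mat2_trace_le (cprod D Φ n x)
    have h2 : ‖(cprod D Φ n x).trace‖ = ‖Q.eval (ee x)‖ := by
      rw [h, Matrix.trace_smul, evalM_trace, norm_smul, hu]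
      simp [hQ]
    rwa [h2] at h1
  obtain ⟨x₀, -, hx₀⟩ := isCompact_Icc.exists_isMinOn (Set.nonempty_Icc.2 zero_le_one)
    (hD.continuous_norm_cprod Φ n).continuousOn (s := Set.Icc (0 : ℝ) 1)
  set b := ‖cprod D Φ n x₀‖ with hb
  have hb0 : 0 < b := hD.norm_cprod_pos Φ n x₀
  have hmn : 0 < m ^ n := pow_pos hm0 n
  obtain ⟨hinteg, hJ⟩ := log_norm_eval_le_integral (Polynomial.C ((b⁻¹ : ℝ) : ℂ) * Q) (by
    rw [Polynomial.eval_mul, Polynomial.eval_C]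
    refine mul_ne_zero (by exact_mod_cast (inv_pos.2 hb0).ne') ?_
    exact norm_pos_iff.1 (hmn.trans_le hQ0))
  have hev : ∀ ζ, ‖(Polynomial.C ((b⁻¹ : ℝ) : ℂ) * Q).eval ζ‖ = b⁻¹ * ‖Q.eval ζ‖ := fun ζ => by
    rw [Polynomial.eval_mul, Polynomial.eval_C, norm_mul, Complex.norm_real,
      Real.norm_of_nonneg (inv_nonneg.2 hb0.le)]
  simp only [hev] at hinteg hJ
  have hc := hD.continuous_log_norm_cprod Φ n
  have hle : ∫ x in (0 : ℝ)..1, Real.log (b⁻¹ * ‖Q.eval (ee x)‖) ≤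
      ∫ x in (0 : ℝ)..1, (Real.log (b⁻¹ * 2) + Real.log ‖cprod D Φ n x‖) := by
    refine intervalIntegral.integral_mono_on zero_le_one hinteg
      ((continuous_const.add hc).intervalIntegrable 0 1) fun x hx => ?_
    have hx1 : b ≤ ‖cprod D Φ n x‖ := hx₀ hx
    have hpos := hD.norm_cprod_pos Φ n x
    rw [← Real.log_mul (by positivity) hpos.ne']
    rcases eq_or_ne (Q.eval (ee x)) 0 with h | h
    · rw [h, norm_zero, mul_zero, Real.log_zero]
      refine Real.log_nonneg ?_
      rw [mul_assoc, inv_mul_eq_div, one_le_div hb0]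
      linarith
    · refine Real.log_le_log (mul_pos (inv_pos.2 hb0) (norm_pos_iff.2 h)) ?_
      rw [mul_assoc]
      exact mul_le_mul_of_nonneg_left (hQx x) (inv_nonneg.2 hb0.le)
  rw [intervalIntegral.integral_add (by simp) (hc.intervalIntegrable 0 1),
    intervalIntegral.integral_const, sub_zero, one_smul] at hle
  have h1 : Real.log (b⁻¹ * m ^ n) ≤ Real.log (b⁻¹ * ‖Q.eval 0‖) :=
    Real.log_le_log (by positivity) (by gcongr)
  rw [Real.log_mul (inv_pos.2 hb0).ne' hmn.ne', Real.log_pow] at h1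
  rw [Real.log_mul (inv_pos.2 hb0).ne' two_ne_zero] at hle
  linarith

/-- The Lyapunov exponent of the normalized cocycle when the growth rate does not exceed the rates
of the lowest Laurent coefficient and of the determinant. -/
theorem hasLyap (hD : IsReflCocycle D) (hT : ∀ w, D w = (ee w)⁻¹ • evalM (ee w) T) {Φ m c : ℝ}
    (hm0 : 0 < m) (hm : (∀ n, m ^ n ≤ ‖(evalM 0 T ^ n).trace‖) ∨ Real.log m ≤ c)
    (hc : ∫ x in (0 : ℝ)..1, Real.log ‖(D x).det‖ = 2 * c)
    (hg : growth D Φ 0 ≤ max (Real.log m) c)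
    {s : ℝ → ℂ} (hs : ∀ x : ℝ, ‖s x‖ ^ 2 = ‖(D x).det‖) :
    HasLyap Φ (fun x => (s x)⁻¹ • D x) (max (Real.log m - c) 0) := by
  have hlog : ∀ (n : ℕ) (x : ℝ), Real.log ‖coc Φ (fun x => (s x)⁻¹ • D x) n x‖ =
      Real.log ‖cprod D Φ n x‖ - 1 / 2 * Real.log ‖(cprod D Φ n x).det‖ := by
    intro n x
    have hd : 0 < ‖(cprod D Φ n x).det‖ := norm_pos_iff.2 (hD.cprod_det_ne Φ n x)
    have hsq := norm_prod_sq_eq_det hs Φ n x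
    have hne : ‖∏ j ∈ Finset.range n, s (x + j * Φ)‖ ≠ 0 := fun h => by
      rw [h] at hsq; norm_num at hsq; exact hd.ne' hsq.symm
    rw [coc_smul_eq, mat2_norm_smul, norm_inv, Real.log_mul (inv_ne_zero hne)
      (hD.norm_cprod_pos Φ n x).ne', Real.log_inv, ← hsq, Real.log_pow]
    push_cast; ring
  have hI : ∀ n : ℕ, ∫ x in (0 : ℝ)..1, Real.log ‖coc Φ (fun x => (s x)⁻¹ • D x) n x‖ =
      (∫ x in (0 : ℝ)..1, Real.log ‖cprod D Φ n x‖) - n * c := by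
    intro n
    obtain ⟨h1, h2⟩ := hD.integral_log_det_cprod Φ n
    have h3 : Continuous fun x : ℝ => 1 / 2 * Real.log ‖(cprod D Φ n x).det‖ :=
      continuous_const.mul h1
    simp only [hlog]
    rw [intervalIntegral.integral_sub ((hD.continuous_log_norm_cprod Φ n).intervalIntegrable 0 1)
      (h3.intervalIntegrable 0 1), intervalIntegral.integral_const_mul, h2, hc]
    ring
  have hlow0 : ∀ n : ℕ, 0 ≤ ∫ x in (0 : ℝ)..1, Real.log ‖coc Φ (fun x => (s x)⁻¹ • D x) n x‖ := by
    intro n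
    refine intervalIntegral.integral_nonneg zero_le_one fun x _ => ?_
    rw [hlog]
    have hd : 0 < ‖(cprod D Φ n x).det‖ := norm_pos_iff.2 (hD.cprod_det_ne Φ n x)
    have h1 : Real.log ‖(cprod D Φ n x).det‖ ≤ Real.log (‖cprod D Φ n x‖ ^ 2) :=
      Real.log_le_log hd (by linarith [mat2_det_le (cprod D Φ n x)])
    rw [Real.log_pow] at h1
    push_cast at h1
    linarith
  have hup : ∀ n : ℕ, ∫ x in (0 : ℝ)..1, Real.log ‖cprod D Φ n x‖ ≤ Real.log (supN D Φ n 0) := by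
    intro n
    have h1 := intervalIntegral.integral_mono_on (μ := volume) zero_le_one
      ((hD.continuous_log_norm_cprod Φ n).intervalIntegrable 0 1)
      (intervalIntegrable_const (c := Real.log (supN D Φ n 0))) fun x _ =>
        Real.log_le_log (hD.norm_cprod_pos Φ n x) (by simpa using hD.norm_le_supN Φ n 0 x)
    simpa using h1
  have hupn : ∀ᶠ n : ℕ in Filter.atTop,
      1 / (n : ℝ) * ∫ x in (0 : ℝ)..1, Real.log ‖coc Φ (fun x => (s x)⁻¹ • D x) n x‖ ≤
        max (Real.log m - c) 0 + (Real.log (supN D Φ n 0) / n - growth D Φ 0) := by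
    filter_upwards [Filter.eventually_gt_atTop 0] with n hn
    have hn' : (0 : ℝ) < n := by exact_mod_cast hn
    have h1 : max (Real.log m - c) 0 = max (Real.log m) c - c := by
      rw [← max_sub_sub_right, sub_self]
    have h2 : 1 / (n : ℝ) * ((∫ x in (0 : ℝ)..1, Real.log ‖cprod D Φ n x‖) - n * c) =
        (∫ x in (0 : ℝ)..1, Real.log ‖cprod D Φ n x‖) / n - c := by field_simp
    have h3 := div_le_div_of_nonneg_right (hup n) hn'.le
    rw [hI, h1, h2]
    linarith
  have hlown : ∀ᶠ n : ℕ in Filter.atTop, max (Real.log m - c) 0 - Real.log 2 / n ≤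
      1 / (n : ℝ) * ∫ x in (0 : ℝ)..1, Real.log ‖coc Φ (fun x => (s x)⁻¹ • D x) n x‖ := by
    filter_upwards [Filter.eventually_gt_atTop 0] with n hn
    have hn' : (0 : ℝ) < n := by exact_mod_cast hn
    have h0 : 0 ≤ 1 / (n : ℝ) * ∫ x in (0 : ℝ)..1,
        Real.log ‖coc Φ (fun x => (s x)⁻¹ • D x) n x‖ := mul_nonneg (by positivity) (hlow0 n)
    have hl2 : 0 ≤ Real.log 2 / n := div_nonneg (Real.log_nonneg one_le_two) hn'.le
    rw [sub_le_iff_le_add]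
    refine max_le ?_ (by linarith)
    rcases hm with hm | hm
    · have h1 := div_le_div_of_nonneg_right (hD.le_integral_log_norm_cprod hT Φ hm0 (hm n)) hn'.le
      have h2 : 1 / (n : ℝ) * ((∫ x in (0 : ℝ)..1, Real.log ‖cprod D Φ n x‖) - n * c) =
          (∫ x in (0 : ℝ)..1, Real.log ‖cprod D Φ n x‖) / n - c := by field_simp
      have h3 : (n * Real.log m - Real.log 2) / n = Real.log m - Real.log 2 / n := by field_simp
      rw [hI, h2]
      linarith
    · linarith
  have hlim1 : Filter.Tendsto (fun n : ℕ => max (Real.log m - c) 0 - Real.log 2 / n) Filter.atTop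
      (nhds (max (Real.log m - c) 0)) := by
    simpa using (tendsto_const_nhds (x := max (Real.log m - c) 0)).sub
      (tendsto_const_div_atTop_nhds_zero_nat (Real.log 2))
  have hlim2 : Filter.Tendsto (fun n : ℕ => max (Real.log m - c) 0 +
      (Real.log (supN D Φ n 0) / n - growth D Φ 0)) Filter.atTop
      (nhds (max (Real.log m - c) 0)) := by
    simpa using (tendsto_const_nhds (x := max (Real.log m - c) 0)).add
      ((hD.tendsto_growth Φ 0).sub_const (growth D Φ 0))
  exact tendsto_of_tendsto_of_tendsto_of_le_of_le' hlim1 hlim2 hlown hupn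

end IsReflCocycle

lemma mat2_trace_pow (A : Mat2) {μ ν : ℂ} (htr : A.trace = μ + ν) (hdet : A.det = μ * ν) (n : ℕ) :
    (A ^ n).trace = μ ^ n + ν ^ n := by
  have hA : A ^ 2 = (μ + ν) • A - (μ * ν) • 1 := by
    rw [← htr, ← hdet, Matrix.trace_fin_two, Matrix.det_fin_two]
    ext i j
    fin_cases i <;> fin_cases j <;> simp [pow_two, Matrix.mul_apply, Fin.sum_univ_two] <;> ring
  induction n using Nat.twoStepInduction with
  | zero => norm_num
  | one => simpa using htr
  | more n h1 h2 =>
    rw [pow_add, hA, mul_sub, Matrix.mul_smul, Matrix.mul_smul, mul_one, ← pow_succ,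
      Matrix.trace_sub, Matrix.trace_smul, Matrix.trace_smul, h1, h2]
    simp only [smul_eq_mul]
    ring

lemma sq1_sq {l : ℝ} (h : l ∈ Set.Ioo (0 : ℝ) 1) : sq1 l ^ 2 = 1 - l ^ 2 := by
  rw [sq1, Real.sq_sqrt]
  nlinarith [h.1, h.2]

lemma sq1_pos {l : ℝ} (h : l ∈ Set.Ioo (0 : ℝ) 1) : 0 < sq1 l :=
  Real.sqrt_pos.2 (by nlinarith [h.1, h.2])

lemma ee_ne_zero (w : ℂ) : ee w ≠ 0 := Complex.exp_ne_zero _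

lemma ee_conj (w : ℂ) : (starRingEnd ℂ) (ee w) = (ee ((starRingEnd ℂ) w))⁻¹ := by
  rw [← ee_neg, ee, ee, ← Complex.exp_conj]
  simp [map_ofNat (starRingEnd ℂ) 2]

lemma ee_differentiable : Differentiable ℂ ee := by
  unfold ee; fun_prop

lemma pS_eq (t l w : _) : pS t l w = 1 / (-(1 + (t : ℂ) ^ 2)) *
    ((t : ℂ) ^ 2 * l * ee w - l * (ee w)⁻¹ - 2 * t * sq1 l) := by
  rw [pS, ee, ← Complex.exp_neg]

lemma qS_eq (t l w : _) : qS t l w = 1 / (-(1 + (t : ℂ) ^ 2)) *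
    ((t : ℂ) ^ 2 * l * (ee w)⁻¹ - l * ee w - 2 * t * sq1 l) := by
  rw [qS, ee, ← Complex.exp_neg]

lemma pS_conj (t l : ℝ) (w : ℂ) : pS t l ((starRingEnd ℂ) w) = (starRingEnd ℂ) (qS t l w) := by
  rw [pS_eq, qS_eq]
  simp [ee_conj, map_ofNat (starRingEnd ℂ) 2]

lemma qS_conj (t l : ℝ) (w : ℂ) : qS t l ((starRingEnd ℂ) w) = (starRingEnd ℂ) (pS t l w) := by
  rw [pS_eq, qS_eq]
  simp [ee_conj, map_ofNat (starRingEnd ℂ) 2]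

lemma one_add_sq_ne_zero (t : ℝ) : (1 + (t : ℂ) ^ 2) ≠ 0 := by
  have : (1 + t ^ 2 : ℝ) ≠ 0 := by positivity
  exact_mod_cast this

lemma pS_ofReal (t l x : ℝ) : pS t l x = -gS t l x := by
  rw [pS, gS]
  push_cast
  rw [show (2 * Real.pi * x * Complex.I : ℂ) = 2 * Real.pi * Complex.I * x by ring,
    show (-(2 * Real.pi * x) * Complex.I : ℂ) = -(2 * Real.pi * Complex.I * x) by ring]
  ring

lemma qS_ofReal (t l x : ℝ) : qS t l x = -(starRingEnd ℂ) (gS t l x) := by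
  have h := qS_conj t l x
  rwa [Complex.conj_ofReal, pS_ofReal, map_neg] at h

lemma fS_ofReal (t l x : ℝ) : (fS t l x : ℂ) = 1 / (-(1 + (t : ℂ) ^ 2)) *
    (t * l * (ee x + (ee x)⁻¹) + (t ^ 2 - 1) * sq1 l) := by
  have h : (2 * Complex.cos (2 * Real.pi * x) : ℂ) = ee x + (ee x)⁻¹ := by
    rw [Complex.two_cos, ee, ← Complex.exp_neg]
    ring_nf
  rw [← h, fS]
  push_cast
  ring

lemma fS_sq_add_pS_mul_qS {l : ℝ} (hl : l ∈ Set.Ioo (0 : ℝ) 1) (t x : ℝ) :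
    (fS t l x : ℂ) ^ 2 + pS t l x * qS t l x = 1 := by
  have h1 : (sq1 l : ℂ) ^ 2 = 1 - (l : ℂ) ^ 2 := by exact_mod_cast sq1_sq hl
  have h2 := one_add_sq_ne_zero t
  have h3 := ee_ne_zero x
  rw [fS_ofReal, pS_eq, qS_eq]
  field_simp
  linear_combination (ee x) ^ 2 * (1 + (t : ℂ) ^ 2) ^ 2 * h1

lemma fS_sq_add_norm_sq {l : ℝ} (hl : l ∈ Set.Ioo (0 : ℝ) 1) (t x : ℝ) :
    fS t l x ^ 2 + ‖gS t l x‖ ^ 2 = 1 := by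
  have h := fS_sq_add_pS_mul_qS hl t x
  rw [pS_ofReal, qS_ofReal, neg_mul_neg, Complex.mul_conj, Complex.normSq_eq_norm_sq] at h
  exact_mod_cast h

lemma Dz_det {l1 l2 : ℝ} (hl1 : l1 ∈ Set.Ioo (0 : ℝ) 1) (hl2 : l2 ∈ Set.Ioo (0 : ℝ) 1) (t x : ℝ)
    (z : ℂ) : (Dz t l1 l2 z x).det = (z * l1 * fS t l2 x) ^ 2 := by
  have h1 : (sq1 l1 : ℂ) ^ 2 = 1 - (l1 : ℂ) ^ 2 := by exact_mod_cast sq1_sq hl1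
  have h2 := fS_sq_add_pS_mul_qS hl2 t x
  rw [Dz, Matrix.det_fin_two_of]
  linear_combination (z ^ 2 * (pS t l2 x * qS t l2 x) - z ^ 2) * h1 - z ^ 2 * (l1 : ℂ) ^ 2 * h2

/-- The matrix polynomial representing `Dz` in the variable `e^{2πiw}`. -/
def DzPoly (t l1 l2 : ℝ) (z : ℂ) : Matrix (Fin 2) (Fin 2) (Polynomial ℂ) :=
  let κ : ℂ := 1 / (-(1 + (t : ℂ) ^ 2))
  let P : Polynomial ℂ := Polynomial.C (κ * (t ^ 2 * l2)) * Polynomial.X ^ 2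
    - Polynomial.C (κ * (2 * t * sq1 l2)) * Polynomial.X - Polynomial.C (κ * l2)
  let Q : Polynomial ℂ := -Polynomial.C (κ * l2) * Polynomial.X ^ 2
    - Polynomial.C (κ * (2 * t * sq1 l2)) * Polynomial.X + Polynomial.C (κ * (t ^ 2 * l2))
  let a : ℂ := sq1 l1
  !![Polynomial.C (z ^ 2) * Polynomial.X - Polynomial.C (a * z) * P,
      Polynomial.C z * Q - Polynomial.C a * Polynomial.X;
     -Polynomial.C (a * z ^ 2) * Polynomial.X + Polynomial.C z * P,
      -Polynomial.C (a * z) * Q + Polynomial.X]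

lemma Dz_eq_smul_evalM (t l1 l2 : ℝ) (z w : ℂ) :
    Dz t l1 l2 z w = (ee w)⁻¹ • evalM (ee w) (DzPoly t l1 l2 z) := by
  have h3 := ee_ne_zero w
  ext i j
  fin_cases i <;> fin_cases j <;> simp [Dz, DzPoly, evalM, pS_eq, qS_eq] <;> field_simp <;> ring

lemma evalM_zero_DzPoly (t l1 l2 : ℝ) (z : ℂ) : evalM 0 (DzPoly t l1 l2 z) =
    (z * (1 / (-(1 + (t : ℂ) ^ 2)) * l2)) •
      !![(sq1 l1 : ℂ), (t : ℂ) ^ 2; -1, -(sq1 l1 * (t : ℂ) ^ 2)] := by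
  ext i j
  fin_cases i <;> fin_cases j <;> simp [DzPoly, evalM] <;> ring

/-- The lower bound of `fS` on the real line. -/
lemma le_fS (t : ℝ) {l : ℝ} (hl : 0 ≤ l) (x : ℝ) :
    ((1 - t ^ 2) * sq1 l - 2 * |t| * l) / (1 + t ^ 2) ≤ fS t l x := by
  have h : t * Real.cos (2 * Real.pi * x) ≤ |t| := by
    refine (le_abs_self _).trans ?_
    rw [abs_mul]
    exact mul_le_of_le_one_right (abs_nonneg _) (Real.abs_cos_le_one _)
  have h2 := mul_le_mul_of_nonneg_right h hl
  have h3 : fS t l x =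
      ((1 - t ^ 2) * sq1 l - 2 * (t * Real.cos (2 * Real.pi * x) * l)) / (1 + t ^ 2) := by
    rw [fS]; field_simp; ring
  rw [h3]
  exact div_le_div_of_nonneg_right (by linarith) (by positivity)

lemma critical_lt_one (t : ℝ) : (1 - t ^ 2) / (1 + t ^ 2) ≤ 1 := by
  rw [div_le_one (by positivity)]
  nlinarith [sq_nonneg t]

lemma two_abs_mul_lt {t l : ℝ} (ht : t ∈ Set.Ioo (-1 : ℝ) 1)
    (hl : l ∈ Set.Ioo (0 : ℝ) ((1 - t ^ 2) / (1 + t ^ 2))) :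
    2 * |t| * l < (1 - t ^ 2) * sq1 l := by
  have hl' : l ∈ Set.Ioo (0 : ℝ) 1 := ⟨hl.1, hl.2.trans_le (critical_lt_one t)⟩
  have h1 : 0 < 1 - t ^ 2 := by nlinarith [ht.1, ht.2]
  have h2 : l * (1 + t ^ 2) < 1 - t ^ 2 := (lt_div_iff₀ (by positivity)).1 hl.2
  have h3 : (l * (1 + t ^ 2)) ^ 2 < (1 - t ^ 2) ^ 2 :=
    pow_lt_pow_left₀ h2 (mul_nonneg hl.1.le (by positivity)) two_ne_zero
  refine lt_of_pow_lt_pow_left₀ 2 (mul_nonneg h1.le (sq1_pos hl').le) ?_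
  rw [mul_pow, mul_pow, mul_pow, sq1_sq hl', sq_abs]
  linarith

lemma discriminant_eq {l : ℝ} (hl : l ∈ Set.Ioo (0 : ℝ) 1) (t : ℝ) :
    (1 + t ^ 2) ^ 2 * sq1 l ^ 2 - 4 * t ^ 2 = ((1 - t ^ 2) * sq1 l) ^ 2 - 4 * (t * l) ^ 2 := by
  linear_combination 4 * t ^ 2 * sq1_sq hl

lemma fS_continuous (t l : ℝ) : Continuous fun x => fS t l x := by
  unfold fS; fun_prop

/-- The larger root of `r² - (1 - t²) √(1 - l²) r + t² l² = 0`. -/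
def bigRoot (t l : ℝ) : ℝ :=
  ((1 - t ^ 2) * sq1 l + Real.sqrt ((1 + t ^ 2) ^ 2 * sq1 l ^ 2 - 4 * t ^ 2)) / 2

lemma bigRoot_pos {t l : ℝ} (ht : t ∈ Set.Ioo (-1 : ℝ) 1) (hl : l ∈ Set.Ioo (0 : ℝ) 1) :
    0 < bigRoot t l := by
  have h1 : 0 < 1 - t ^ 2 := by nlinarith [ht.1, ht.2]
  have h2 := mul_pos h1 (sq1_pos hl)
  unfold bigRoot
  positivity

lemma bigRoot_sq {t l : ℝ} (hl : l ∈ Set.Ioo (0 : ℝ) 1)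
    (hΔ : 0 ≤ (1 + t ^ 2) ^ 2 * sq1 l ^ 2 - 4 * t ^ 2) :
    bigRoot t l * ((1 - t ^ 2) * sq1 l - bigRoot t l) = (t * l) ^ 2 := by
  have h := Real.sq_sqrt hΔ
  rw [bigRoot]
  linear_combination -1 / 4 * h - 1 / 4 * discriminant_eq hl t

lemma integral_log_norm_ee_sub {ρ : ℂ} (hρ : ‖ρ‖ < 1) :
    ∫ x in (0 : ℝ)..1, Real.log ‖ee x - ρ‖ = 0 := by
  have hpi : 2 * Real.pi ≠ 0 := by positivity
  have hcm : ∀ x : ℝ, circleMap 0 1 (2 * Real.pi * x) = ee x := by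
    intro x; simp [circleMap, ee]; ring_nf
  have h3 := intervalIntegral.integral_comp_mul_left (a := 0) (b := 1)
    (fun θ => Real.log ‖circleMap 0 1 θ - ρ‖) hpi
  simp only [hcm] at h3
  rw [h3]
  refine Eq.trans ?_ (circleAverage_log_norm_sub_const₀ hρ)
  rw [Real.circleAverage]
  simp

section Nonsingular

variable {t l : ℝ}

lemma fS_pos (ht : t ∈ Set.Ioo (-1 : ℝ) 1)
    (hl : l ∈ Set.Ioo (0 : ℝ) ((1 - t ^ 2) / (1 + t ^ 2))) (x : ℝ) : 0 < fS t l x :=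
  (div_pos (sub_pos.2 (two_abs_mul_lt ht hl)) (by positivity)).trans_le (le_fS t hl.1.le x)

lemma abs_mul_lt_bigRoot (ht : t ∈ Set.Ioo (-1 : ℝ) 1)
    (hl : l ∈ Set.Ioo (0 : ℝ) ((1 - t ^ 2) / (1 + t ^ 2))) : |t| * l < bigRoot t l := by
  have h1 := two_abs_mul_lt ht hl
  have h2 := Real.sqrt_nonneg ((1 + t ^ 2) ^ 2 * sq1 l ^ 2 - 4 * t ^ 2)
  rw [bigRoot]
  linarith

lemma fS_eq_norm_sq (ht : t ∈ Set.Ioo (-1 : ℝ) 1)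
    (hl : l ∈ Set.Ioo (0 : ℝ) ((1 - t ^ 2) / (1 + t ^ 2))) (x : ℝ) :
    fS t l x = bigRoot t l / (1 + t ^ 2) * ‖ee x - (t * l / bigRoot t l : ℝ)‖ ^ 2 := by
  have hl' : l ∈ Set.Ioo (0 : ℝ) 1 := ⟨hl.1, hl.2.trans_le (critical_lt_one t)⟩
  have hX := bigRoot_pos ht hl'
  have hX' : (bigRoot t l : ℂ) ≠ 0 := by exact_mod_cast hX.ne'
  have hΔ : 0 ≤ (1 + t ^ 2) ^ 2 * sq1 l ^ 2 - 4 * t ^ 2 := by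
    rw [discriminant_eq hl']
    have h1 := two_abs_mul_lt ht hl
    have h2 : (2 * |t| * l) ^ 2 ≤ ((1 - t ^ 2) * sq1 l) ^ 2 :=
      pow_le_pow_left₀ (by have := hl.1; positivity) h1.le 2
    rw [mul_pow, mul_pow, sq_abs] at h2
    linarith
  have hroot : (bigRoot t l : ℂ) * ((1 - (t : ℂ) ^ 2) * sq1 l - bigRoot t l) = (t * l) ^ 2 := by
    exact_mod_cast bigRoot_sq hl' hΔ
  have h2 := one_add_sq_ne_zero t
  have h3 := ee_ne_zero x
  have h4 : ((‖ee x - (t * l / bigRoot t l : ℝ)‖ ^ 2 : ℝ) : ℂ) =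
      (ee x - t * l / bigRoot t l) * ((ee x)⁻¹ - t * l / bigRoot t l) := by
    rw [← Complex.normSq_eq_norm_sq, ← Complex.mul_conj, map_sub, ee_conj, Complex.conj_ofReal,
      Complex.conj_ofReal]
    push_cast
    rfl
  rw [← Complex.ofReal_inj, Complex.ofReal_mul, h4, fS_ofReal]
  push_cast
  field_simp
  linear_combination ee x * hroot

lemma integral_log_fS (ht : t ∈ Set.Ioo (-1 : ℝ) 1)
    (hl : l ∈ Set.Ioo (0 : ℝ) ((1 - t ^ 2) / (1 + t ^ 2))) :
    ∫ x in (0 : ℝ)..1, Real.log (fS t l x) = Real.log (bigRoot t l / (1 + t ^ 2)) := by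
  have hl' : l ∈ Set.Ioo (0 : ℝ) 1 := ⟨hl.1, hl.2.trans_le (critical_lt_one t)⟩
  have hX := bigRoot_pos ht hl'
  set ρ : ℂ := ((t * l / bigRoot t l : ℝ) : ℂ) with hρ
  have hρ1 : ‖ρ‖ < 1 := by
    rw [hρ, Complex.norm_real, Real.norm_eq_abs, abs_div, abs_of_pos hX, div_lt_one hX, abs_mul,
      abs_of_pos hl.1]
    exact abs_mul_lt_bigRoot ht hl
  have hne : ∀ x : ℝ, ‖ee x - ρ‖ ≠ 0 := fun x h => by
    have h1 : ee x = ρ := sub_eq_zero.1 (norm_eq_zero.1 h)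
    rw [← h1, norm_ee] at hρ1
    simp at hρ1
  have hc : Continuous fun x : ℝ => Real.log ‖ee x - ρ‖ :=
    ((ee_differentiable.continuous.comp Complex.continuous_ofReal).sub
      continuous_const).norm.log hne
  have hlog : ∀ x : ℝ, Real.log (fS t l x) =
      Real.log (bigRoot t l / (1 + t ^ 2)) + 2 * Real.log ‖ee x - ρ‖ := fun x => by
    rw [fS_eq_norm_sq ht hl, Real.log_mul (by positivity) (pow_ne_zero 2 (hne x)), Real.log_pow]
    push_cast
    rfl
  have hc2 : Continuous fun x : ℝ => 2 * Real.log ‖ee x - ρ‖ := continuous_const.mul hc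
  simp only [hlog]
  rw [intervalIntegral.integral_add (by simp) (hc2.intervalIntegrable 0 1),
    intervalIntegral.integral_const_mul, integral_log_norm_ee_sub hρ1]
  simp

end Nonsingular

lemma mat2_swap_conj (a b c d : ℂ) :
    (!![0, 1; 1, 0] * (!![a, b; c, d] : Mat2).map (starRingEnd ℂ) * !![0, 1; 1, 0] : Mat2) =
      !![(starRingEnd ℂ) d, (starRingEnd ℂ) c; (starRingEnd ℂ) b, (starRingEnd ℂ) a] := by
  ext i j
  fin_cases i <;> fin_cases j <;>
    simp [Matrix.mul_apply, Matrix.vecMul, dotProduct, Fin.sum_univ_two]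

section Nonsingular

variable {t l1 l2 : ℝ}

lemma isReflCocycle_Dz (ht : t ∈ Set.Ioo (-1 : ℝ) 1) (hl1 : l1 ∈ Set.Ioo (0 : ℝ) 1)
    (hl2 : l2 ∈ Set.Ioo (0 : ℝ) ((1 - t ^ 2) / (1 + t ^ 2))) {z : ℂ} (hz : ‖z‖ = 1) :
    IsReflCocycle (Dz t l1 l2 z) where
  diff := by
    intro i j
    fin_cases i <;> fin_cases j <;> simp only [Dz, pS, qS, Matrix.of_apply, Matrix.cons_val',
      Matrix.cons_val_zero, Matrix.cons_val_one, Matrix.cons_val_fin_one, Fin.zero_eta, Fin.mk_one]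
      <;> fun_prop
  per := by
    intro w
    have h : ee (w + 1) = ee w := by rw [ee_add, ee_one, mul_one]
    simp only [Dz, pS_eq, qS_eq, h]
  refl := by
    have hz0 : z ≠ 0 := fun h => by rw [h, norm_zero] at hz; exact zero_ne_one hz
    have hzc : (starRingEnd ℂ) z = z⁻¹ := (Complex.inv_eq_conj hz).symm
    refine ⟨z ^ 2, by rw [norm_pow, hz, one_pow], fun w => ?_⟩
    rw [Dz, Dz, mat2_swap_conj]
    ext i j
    fin_cases i <;> fin_cases j <;> simp [pS_conj, qS_conj, hzc] <;> field_simp <;> ring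
  det_ne := by
    intro x
    have hl2' : l2 ∈ Set.Ioo (0 : ℝ) 1 := ⟨hl2.1, hl2.2.trans_le (critical_lt_one t)⟩
    have hz0 : z ≠ 0 := fun h => by rw [h, norm_zero] at hz; exact zero_ne_one hz
    rw [Dz_det hl1 hl2']
    refine pow_ne_zero 2 (mul_ne_zero (mul_ne_zero hz0 ?_) ?_)
    · exact_mod_cast hl1.1.ne'
    · exact_mod_cast (fS_pos ht hl2 x).ne'

lemma SzP_eq (t l1 l2 : ℝ) (z : ℂ) :
    SzP t l1 l2 z = fun x => (z * (l1 * (|fS t l2 x| : ℝ)))⁻¹ • Dz t l1 l2 z x := by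
  funext x
  rw [SzP, mul_inv, div_eq_mul_inv]

lemma integral_log_det_Dz (ht : t ∈ Set.Ioo (-1 : ℝ) 1) (hl1 : l1 ∈ Set.Ioo (0 : ℝ) 1)
    (hl2 : l2 ∈ Set.Ioo (0 : ℝ) ((1 - t ^ 2) / (1 + t ^ 2))) {z : ℂ} (hz : ‖z‖ = 1) :
    ∫ x in (0 : ℝ)..1, Real.log ‖(Dz t l1 l2 z x).det‖ =
      2 * Real.log (l1 * (bigRoot t l2 / (1 + t ^ 2))) := by
  have hl2' : l2 ∈ Set.Ioo (0 : ℝ) 1 := ⟨hl2.1, hl2.2.trans_le (critical_lt_one t)⟩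
  have hX := bigRoot_pos ht hl2'
  have hlog : ∀ x : ℝ, Real.log ‖(Dz t l1 l2 z x).det‖ =
      2 * (Real.log l1 + Real.log (fS t l2 x)) := fun x => by
    have hf := fS_pos ht hl2 x
    rw [Dz_det hl1 hl2', norm_pow, norm_mul, norm_mul, hz, one_mul, Complex.norm_real,
      Complex.norm_real, Real.norm_of_nonneg hl1.1.le, Real.norm_of_nonneg hf.le, Real.log_pow,
      Real.log_mul hl1.1.ne' hf.ne']
    push_cast
    rfl
  have hc : Continuous fun x => Real.log (fS t l2 x) :=
    (fS_continuous t l2).log fun x => (fS_pos ht hl2 x).ne'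
  simp only [hlog]
  rw [intervalIntegral.integral_const_mul, intervalIntegral.integral_add (by simp)
    (hc.intervalIntegrable 0 1), integral_log_fS ht hl2, Real.log_mul hl1.1.ne' (by positivity)]
  simp

/-- The operator with components `wPlus` and `wMinus` is a split-step walk. -/
lemma isWalk_of_eq {Φ θ : ℝ} (hl1 : l1 ∈ Set.Ioo (0 : ℝ) 1) (hl2 : l2 ∈ Set.Ioo (0 : ℝ) 1)
    {W : H2 →L[ℂ] H2} (hW : ∀ (ψ : H2) (n : ℤ),
      W ψ n 0 = wPlus t l1 l2 Φ θ (fun m => ψ m) n ∧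
      W ψ n 1 = wMinus t l1 l2 Φ θ (fun m => ψ m) n) :
    IsWalk W l1 (sq1 l1) (fun n => fS t l2 (θ + n * Φ)) (fun n => gS t l2 (θ + n * Φ)) where
  shift := by rw [sq1_sq hl1]; ring
  coin := fun n => fS_sq_add_norm_sq hl2 t _
  plus := fun ψ n => by rw [(hW ψ n).1, wPlus]; push_cast; rfl
  minus := fun ψ n => by rw [(hW ψ n).2, wMinus]; push_cast; rfl

lemma exists_norm_SzP_le (ht : t ∈ Set.Ioo (-1 : ℝ) 1) (hl1 : l1 ∈ Set.Ioo (0 : ℝ) 1)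
    (hl2 : l2 ∈ Set.Ioo (0 : ℝ) ((1 - t ^ 2) / (1 + t ^ 2))) {z : ℂ} (hz : ‖z‖ = 1) :
    ∃ B, ∀ x, ‖SzP t l1 l2 z x‖ ≤ B := by
  obtain ⟨B, hB⟩ := (isReflCocycle_Dz ht hl1 hl2 hz).exists_bound 0 1 0 0
  have hf₀ : 0 < ((1 - t ^ 2) * sq1 l2 - 2 * |t| * l2) / (1 + t ^ 2) :=
    div_pos (sub_pos.2 (two_abs_mul_lt ht hl2)) (by positivity)
  set f₀ := ((1 - t ^ 2) * sq1 l2 - 2 * |t| * l2) / (1 + t ^ 2)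
  have hl1' := hl1.1
  refine ⟨(l1 * f₀)⁻¹ * B, fun x => ?_⟩
  have h1 := hB x (by simp)
  rw [cprod_one] at h1
  have h2 := le_fS t hl2.1.le x
  have h3 : ‖(z * (l1 * (|fS t l2 x| : ℝ)))⁻¹‖ = (l1 * fS t l2 x)⁻¹ := by
    rw [norm_inv, norm_mul, hz, one_mul, norm_mul, Complex.norm_real, Complex.norm_real,
      Real.norm_of_nonneg hl1'.le, norm_abs_eq_norm, Real.norm_of_nonneg (fS_pos ht hl2 x).le]
  rw [SzP_eq, mat2_norm_smul, h3]
  exact mul_le_mul (inv_anti₀ (by positivity) (by gcongr)) h1 (norm_nonneg _)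
    (by positivity)

/-- The Lyapunov exponent on the spectrum, from bounds on the traces of the powers of the lowest
Laurent coefficient. -/
lemma hasLyap_SzP (ht : t ∈ Set.Ioo (-1 : ℝ) 1) (hl1 : l1 ∈ Set.Ioo (0 : ℝ) 1)
    (hl2 : l2 ∈ Set.Ioo (0 : ℝ) ((1 - t ^ 2) / (1 + t ^ 2))) {Φ θ : ℝ} (hΦ : Irrational Φ)
    {W : H2 →L[ℂ] H2} (hW : ∀ (ψ : H2) (n : ℤ),
      W ψ n 0 = wPlus t l1 l2 Φ θ (fun m => ψ m) n ∧
      W ψ n 1 = wMinus t l1 l2 Φ θ (fun m => ψ m) n)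
    {z : ℂ} (hz : z ∈ spectrum ℂ W) {m : ℝ} (hm0 : 0 < m)
    (hm : ∀ n, ‖(evalM 0 (DzPoly t l1 l2 z) ^ n).trace‖ ≤ 2 * m ^ n)
    (hm' : (∀ n, m ^ n ≤ ‖(evalM 0 (DzPoly t l1 l2 z) ^ n).trace‖) ∨
      Real.log m ≤ Real.log (l1 * (bigRoot t l2 / (1 + t ^ 2)))) :
    HasLyap Φ (SzP t l1 l2 z)
      (max (Real.log m - Real.log (l1 * (bigRoot t l2 / (1 + t ^ 2)))) 0) := by
  have hl2' : l2 ∈ Set.Ioo (0 : ℝ) 1 := ⟨hl2.1, hl2.2.trans_le (critical_lt_one t)⟩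
  have hwalk := isWalk_of_eq hl1 hl2' hW
  have hz1 := hwalk.norm_eq_one_of_mem_spectrum hz
  have hD := isReflCocycle_Dz ht hl1 hl2 hz1
  have hT := Dz_eq_smul_evalM t l1 l2 z
  have hc := integral_log_det_Dz ht hl1 hl2 hz1
  have hs : ∀ x : ℝ, ‖z * (l1 * (|fS t l2 x| : ℝ))‖ ^ 2 = ‖(Dz t l1 l2 z x).det‖ := fun x => by
    rw [Dz_det hl1 hl2', norm_pow, ← mul_assoc, norm_mul, norm_mul (z * l1), Complex.norm_real,
      Complex.norm_real, norm_abs_eq_norm]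
  obtain ⟨B, hB⟩ := exists_norm_SzP_le ht hl1 hl2 hz1
  rw [SzP_eq]
  refine hD.hasLyap hT hm0 hm' hc ?_ hs
  by_contra! hg
  obtain ⟨N, hN⟩ := hD.exists_uniform_expansion hT hΦ hm0 hm hc
    ((le_max_left _ _).trans_lt hg) ((le_max_right _ _).trans_lt hg) hs
  obtain ⟨C, hC⟩ := hwalk.exists_bound_below (Φ := Φ) (θ := θ) (M := SzP t l1 l2 z) hz1
    (div_pos (sub_pos.2 (two_abs_mul_lt ht hl2)) (by positivity)) (fun n => le_fS t hl2.1.le _)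
    hl1.1 hB (fun n => by
      rw [SzP, Dz, abs_of_pos (fS_pos ht hl2 _), pS_ofReal, qS_ofReal]
      congr 1
      ext i j
      fin_cases i <;> fin_cases j <;> simp <;> ring) (N := N) (by rw [SzP_eq]; exact hN)
  exact hwalk.not_bounded_below hz C hC

lemma norm_trace_pow_evalM_zero (hl1 : l1 ∈ Set.Ioo (0 : ℝ) 1) (hl2 : 0 ≤ l2) {z : ℂ}
    (hz : ‖z‖ = 1) {μ ν : ℂ} (htr : (sq1 l1 * (1 - t ^ 2) : ℂ) = μ + ν)
    (hdet : ((t * l1) ^ 2 : ℂ) = μ * ν) (n : ℕ) :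
    ‖(evalM 0 (DzPoly t l1 l2 z) ^ n).trace‖ = (l2 / (1 + t ^ 2)) ^ n * ‖μ ^ n + ν ^ n‖ := by
  have h1 : (sq1 l1 : ℂ) ^ 2 = 1 - (l1 : ℂ) ^ 2 := by exact_mod_cast sq1_sq hl1
  set s : ℂ := z * (1 / (-(1 + (t : ℂ) ^ 2)) * l2) with hs
  have hsn : ‖s‖ = l2 / (1 + t ^ 2) := by
    rw [hs, norm_mul, hz, one_mul, norm_mul, norm_div, norm_one, norm_neg, Complex.norm_real,
      Real.norm_of_nonneg hl2, show (1 + (t : ℂ) ^ 2) = ((1 + t ^ 2 : ℝ) : ℂ) by push_cast; rfl,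
      Complex.norm_real, Real.norm_of_nonneg (by positivity)]
    ring
  rw [mat2_trace_pow (μ := s * μ) (ν := s * ν), mul_pow s, mul_pow s, ← mul_add, norm_mul, norm_pow,
    hsn]
  · rw [evalM_zero_DzPoly, Matrix.trace_smul, Matrix.trace_fin_two_of, smul_eq_mul,
      ← mul_add, ← htr]
    ring
  · rw [evalM_zero_DzPoly, Matrix.det_smul, Matrix.det_fin_two_of, Fintype.card_fin]
    linear_combination s ^ 2 * hdet - s ^ 2 * (t : ℂ) ^ 2 * h1

end Nonsingular

lemma norm_trace_pow_of_le_critical {t l1 l2 : ℝ} (ht : t ∈ Set.Ioo (-1 : ℝ) 1)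
    (hl1 : l1 ∈ Set.Ioo (0 : ℝ) 1) (hl2 : 0 ≤ l2) {z : ℂ} (hz : ‖z‖ = 1)
    (h : l1 ≤ (1 - t ^ 2) / (1 + t ^ 2)) (n : ℕ) :
    (l2 / (1 + t ^ 2) * bigRoot t l1) ^ n ≤ ‖(evalM 0 (DzPoly t l1 l2 z) ^ n).trace‖ ∧
      ‖(evalM 0 (DzPoly t l1 l2 z) ^ n).trace‖ ≤ 2 * (l2 / (1 + t ^ 2) * bigRoot t l1) ^ n := by
  have hα := bigRoot_pos ht hl1
  have h1 : 0 < 1 - t ^ 2 := by nlinarith [ht.1, ht.2]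
  have hΔ : 0 ≤ (1 + t ^ 2) ^ 2 * sq1 l1 ^ 2 - 4 * t ^ 2 := by
    have h2 : l1 * (1 + t ^ 2) ≤ 1 - t ^ 2 := (le_div_iff₀ (by positivity)).1 h
    have h3 := pow_le_pow_left₀ (mul_nonneg hl1.1.le (by positivity)) h2 2
    rw [sq1_sq hl1]
    linarith
  set α := bigRoot t l1 with hα'
  set β := (1 - t ^ 2) * sq1 l1 - α with hβ
  have hαβ : α * β = (t * l1) ^ 2 := bigRoot_sq hl1 hΔ
  have hβ0 : 0 ≤ β := nonneg_of_mul_nonneg_right (hαβ ▸ sq_nonneg _) hα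
  have hβα : β ≤ α := by
    have h2 := Real.sqrt_nonneg ((1 + t ^ 2) ^ 2 * sq1 l1 ^ 2 - 4 * t ^ 2)
    rw [hβ, hα', bigRoot]
    linarith
  rw [norm_trace_pow_evalM_zero (μ := (α : ℂ)) (ν := (β : ℂ)) hl1 hl2 hz
    (by rw [hβ]; push_cast; ring) (by exact_mod_cast hαβ.symm), mul_pow]
  have hn : ‖(α : ℂ) ^ n + (β : ℂ) ^ n‖ = α ^ n + β ^ n := by
    rw [show (α : ℂ) ^ n + (β : ℂ) ^ n = ((α ^ n + β ^ n : ℝ) : ℂ) by push_cast; rfl,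
      Complex.norm_real, Real.norm_of_nonneg (by positivity)]
  have hs : 0 ≤ (l2 / (1 + t ^ 2)) ^ n := by positivity
  have h4 : β ^ n ≤ α ^ n := pow_le_pow_left₀ hβ0 hβα n
  have h5 : 0 ≤ β ^ n := pow_nonneg hβ0 n
  rw [hn]
  constructor <;> nlinarith

lemma norm_trace_pow_of_critical_le {t l1 l2 : ℝ} (ht : t ∈ Set.Ioo (-1 : ℝ) 1)
    (hl1 : l1 ∈ Set.Ioo (0 : ℝ) 1) (hl2 : 0 ≤ l2) {z : ℂ} (hz : ‖z‖ = 1)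
    (h : (1 - t ^ 2) / (1 + t ^ 2) ≤ l1) (n : ℕ) :
    ‖(evalM 0 (DzPoly t l1 l2 z) ^ n).trace‖ ≤ 2 * (l2 / (1 + t ^ 2) * (|t| * l1)) ^ n := by
  have h1 : 0 < 1 - t ^ 2 := by nlinarith [ht.1, ht.2]
  have hΔ : 0 ≤ -((1 + t ^ 2) ^ 2 * sq1 l1 ^ 2 - 4 * t ^ 2) := by
    have h2 : 1 - t ^ 2 ≤ l1 * (1 + t ^ 2) := (div_le_iff₀ (by positivity)).1 h
    have h3 := pow_le_pow_left₀ h1.le h2 2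
    rw [sq1_sq hl1]
    linarith
  set r := Real.sqrt (-((1 + t ^ 2) ^ 2 * sq1 l1 ^ 2 - 4 * t ^ 2)) with hr
  set τ := (1 - t ^ 2) * sq1 l1 with hτ
  have hsq : (τ / 2) ^ 2 + (r / 2) ^ 2 = (t * l1) ^ 2 := by
    have h2 := Real.sq_sqrt hΔ
    rw [← hr] at h2
    linear_combination h2 / 4 - discriminant_eq hl1 t / 4
  set μ : ℂ := (τ / 2 : ℝ) + (r / 2 : ℝ) * Complex.I with hμ
  set ν : ℂ := (τ / 2 : ℝ) + (-(r / 2) : ℝ) * Complex.I with hν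
  have hnorm : ∀ s : ℝ, s ^ 2 = (r / 2) ^ 2 →
      ‖((τ / 2 : ℝ) : ℂ) + (s : ℝ) * Complex.I‖ = |t| * l1 := fun s hs => by
    rw [Complex.norm_add_mul_I, hs, hsq, Real.sqrt_sq_eq_abs, abs_mul, abs_of_pos hl1.1]
  have hμn : ‖μ‖ = |t| * l1 := hnorm _ rfl
  have hνn : ‖ν‖ = |t| * l1 := hnorm _ (neg_sq _)
  have hsqC : ((τ / 2 : ℝ) : ℂ) ^ 2 + ((r / 2 : ℝ) : ℂ) ^ 2 = (t * l1) ^ 2 := by exact_mod_cast hsq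
  rw [norm_trace_pow_evalM_zero (μ := μ) (ν := ν) hl1 hl2 hz
    (by rw [hμ, hν, hτ]; push_cast; ring)
    (by rw [hμ, hν, Complex.ofReal_neg]
        linear_combination -hsqC + ((r / 2 : ℝ) : ℂ) ^ 2 * Complex.I_sq), mul_pow]
  have hle : ‖μ ^ n + ν ^ n‖ ≤ 2 * (|t| * l1) ^ n := by
    refine (norm_add_le _ _).trans ?_
    rw [norm_pow, norm_pow, hμn, hνn, two_mul]
  have hs : 0 ≤ (l2 / (1 + t ^ 2)) ^ n := by positivity
  nlinarith

/-- Lyapunov exponent of the Szegő cocycle in the nonsingular case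
`λ₂ ∈ (0, (1−t²)/(1+t²))`, for `z` in the spectrum of the walk operator. -/
theorem lyapunov_nonsingular
    (t l1 l2 Φ θ : ℝ) (z : ℂ)
    (ht : t ∈ Set.Ioo (-1 : ℝ) 1) (ht0 : t ≠ 0)
    (hl1 : l1 ∈ Set.Ioo (0 : ℝ) 1)
    (hl2 : l2 ∈ Set.Ioo (0 : ℝ) ((1 - t ^ 2) / (1 + t ^ 2)))
    (hΦ : Irrational Φ)
    (W : H2 →L[ℂ] H2)
    (hW : ∀ (ψ : H2) (n : ℤ),
      W ψ n 0 = wPlus t l1 l2 Φ θ (fun m => ψ m) n ∧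
      W ψ n 1 = wMinus t l1 l2 Φ θ (fun m => ψ m) n)
    (hz : z ∈ spectrum ℂ W) :
    (l1 ≤ (1 - t ^ 2) / (1 + t ^ 2) →
      HasLyap Φ (SzP t l1 l2 z)
        (max (Real.log ((l2 * ((1 - t ^ 2) * sq1 l1 +
            Real.sqrt ((1 + t ^ 2) ^ 2 * (sq1 l1) ^ 2 - 4 * t ^ 2))) /
          (l1 * ((1 - t ^ 2) * sq1 l2 +
            Real.sqrt ((1 + t ^ 2) ^ 2 * (sq1 l2) ^ 2 - 4 * t ^ 2))))) 0)) ∧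
    ((1 - t ^ 2) / (1 + t ^ 2) ≤ l1 →
      HasLyap Φ (SzP t l1 l2 z) 0) := by
  have hl2' : l2 ∈ Set.Ioo (0 : ℝ) 1 := ⟨hl2.1, hl2.2.trans_le (critical_lt_one t)⟩
  have hz1 : ‖z‖ = 1 := (isWalk_of_eq hl1 hl2' hW).norm_eq_one_of_mem_spectrum hz
  have hX1 := bigRoot_pos ht hl1
  have hX2 := bigRoot_pos ht hl2'
  have hp1 := hl1.1
  have hp2 := hl2.1
  have htp : 0 < |t| := abs_pos.2 ht0
  constructor
  · intro h
    have htr := norm_trace_pow_of_le_critical ht hl1 hl2.1.le hz1 h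
    have hL := hasLyap_SzP ht hl1 hl2 hΦ hW hz (m := l2 / (1 + t ^ 2) * bigRoot t l1)
      (by positivity) (fun n => (htr n).2) (Or.inl fun n => (htr n).1)
    rw [← Real.log_div (by positivity) (by positivity)] at hL
    convert hL using 3
    have e : ∀ l, (1 - t ^ 2) * sq1 l + Real.sqrt ((1 + t ^ 2) ^ 2 * sq1 l ^ 2 - 4 * t ^ 2) =
        2 * bigRoot t l := fun l => by rw [bigRoot]; ring
    rw [e, e]
    field_simp
  · intro h
    have hle : Real.log (l2 / (1 + t ^ 2) * (|t| * l1)) ≤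
        Real.log (l1 * (bigRoot t l2 / (1 + t ^ 2))) := by
      refine Real.log_le_log (by positivity) ?_
      have h1 := mul_le_mul_of_nonneg_left (abs_mul_lt_bigRoot ht hl2).le
        (show 0 ≤ l1 / (1 + t ^ 2) by positivity)
      calc _ = l1 / (1 + t ^ 2) * (|t| * l2) := by ring
        _ ≤ _ := h1
        _ = _ := by ring
    have hL := hasLyap_SzP ht hl1 hl2 hΦ hW hz (m := l2 / (1 + t ^ 2) * (|t| * l1))
      (by positivity) (norm_trace_pow_of_critical_le ht hl1 hl2.1.le hz1 h) (Or.inr hle)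
    rwa [max_eq_right (sub_nonpos.2 hle)] at hL

end
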